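/- Let n≥2, 1≤d<n, θ∈ℝ^n, U⊂ℝ^d be open, f:U→ℝ^n be nonsingular and nondegenerate at x_0∈U, m=n−d, and η=η(n,d). Then there exist an open neighbourhood B_0 of x_0 and constants c>0 (depending on x_0, d, f) and C>0 (depending on n, f, x_0) such that for every ball B⊂B_0 there exists t_0=t_0(B,n,f) with the property: for every t≥t_0 and every ε∈(0,1) satisfying ε ≥ C e^{−tη}, one has N*_θ(B;ε,t) ≥ c ε^m e^{(d+1)t} L_d(B), where L_d denotes d-dimensional Lebesgue measure. -/

import Mathlib

open MeasureTheory Filter Set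
open scoped ENNReal NNReal

noncomputable section

/-- The set `S_n^θ(ψ)` of `(ψ,θ)`-approximable points of `ℝ^n` (sup norm on `Fin n → ℝ`):
points `x` with `‖x - (p+θ)/q‖ ≤ ψ q / q` for infinitely many `(p,q) ∈ ℤ^n × ℕ`. -/
def SApprox (n : ℕ) (θ : Fin n → ℝ) (ψ : ℝ → ℝ) : Set (Fin n → ℝ) :=
  {x | {pq : (Fin n → ℤ) × ℕ | 0 < pq.2 ∧
    ‖(fun i => x i - ((pq.1 i : ℝ) + θ i) / (pq.2 : ℝ) : Fin n → ℝ)‖ ≤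
      ψ (pq.2 : ℝ) / (pq.2 : ℝ)}.Infinite}

/-- Iterated partial derivatives along a list of coordinate directions. -/
def listPDeriv {d n : ℕ} : List (Fin d) → ((Fin d → ℝ) → (Fin n → ℝ)) → ((Fin d → ℝ) → (Fin n → ℝ))
  | [], f => f
  | i :: is, f => fun x => fderiv ℝ (listPDeriv is f) x (Pi.single i 1)

/-- `f` is `l`-nondegenerate at `x`: `f` is `C^l` near `x` and the partial derivatives of `f`
at `x` of orders `1,…,l` span `ℝ^n`. -/
def IsLNondegenerateAt {d n : ℕ} (l : ℕ) (f : (Fin d → ℝ) → (Fin n → ℝ)) (x : Fin d → ℝ) : Prop :=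
  (∃ V ∈ nhds x, ContDiffOn ℝ l f V) ∧
  Submodule.span ℝ {v : Fin n → ℝ | ∃ β : List (Fin d),
    1 ≤ β.length ∧ β.length ≤ l ∧ v = listPDeriv β f x} = ⊤

def IsNondegenerateAt {d n : ℕ} (f : (Fin d → ℝ) → (Fin n → ℝ)) (x : Fin d → ℝ) : Prop :=
  ∃ l : ℕ, IsLNondegenerateAt l f x

/-- `f` is nondegenerate in `U`: nondegenerate at almost every point of `U`. -/
def IsNondegenerateIn {d n : ℕ} (f : (Fin d → ℝ) → (Fin n → ℝ)) (U : Set (Fin d → ℝ)) : Prop :=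
  ∀ᵐ x ∂(volume : Measure (Fin d → ℝ)), x ∈ U → IsNondegenerateAt f x

/-- `f` is nonsingular on `U`: its Jacobian has rank `d` at every point of `U`. -/
def IsNonsingularOn {d n : ℕ} (f : (Fin d → ℝ) → (Fin n → ℝ)) (U : Set (Fin d → ℝ)) : Prop :=
  ∀ x ∈ U, LinearMap.rank (fderiv ℝ f x).toLinearMap = (d : Cardinal)

/-- `η(n,d)`. -/
def etaND (n d : ℕ) : ℝ := if 1 < d then 1 / ((n : ℝ) - 1) else 3 / (2 * (n : ℝ) - 1)

/-- The set counted by `N*_θ(Δ;ε,t)`. -/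
def NstarSet {d n : ℕ} (f : (Fin d → ℝ) → Fin n → ℝ) (θ : Fin n → ℝ)
    (Δ : Set (Fin d → ℝ)) (ε t : ℝ) : Set ((Fin n → ℤ) × ℤ) :=
  {pq | Real.exp (t - 1) ≤ (pq.2 : ℝ) ∧ (pq.2 : ℝ) ≤ Real.exp t ∧
    sInf ((fun x => ‖(fun i => f x i - ((pq.1 i : ℝ) + θ i) / (pq.2 : ℝ) : Fin n → ℝ)‖) '' Δ)
      ≤ ε / Real.exp t}

/-- `N*_θ(Δ;ε,t)`. -/
def Nstar {d n : ℕ} (f : (Fin d → ℝ) → Fin n → ℝ) (θ : Fin n → ℝ)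
    (Δ : Set (Fin d → ℝ)) (ε t : ℝ) : ℕ := (NstarSet f θ Δ ε t).ncard

/-- The set counted by `N_θ(Δ;ε,t)` (with `1 ≤ q ≤ e^t`). -/
def NfullSet {d n : ℕ} (f : (Fin d → ℝ) → Fin n → ℝ) (θ : Fin n → ℝ)
    (Δ : Set (Fin d → ℝ)) (ε t : ℝ) : Set ((Fin n → ℤ) × ℤ) :=
  {pq | 1 ≤ pq.2 ∧ (pq.2 : ℝ) ≤ Real.exp t ∧
    sInf ((fun x => ‖(fun i => f x i - ((pq.1 i : ℝ) + θ i) / (pq.2 : ℝ) : Fin n → ℝ)‖) '' Δ)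
      ≤ ε / Real.exp t}

/-- `N_θ(Δ;ε,t)`. -/
def Nfull {d n : ℕ} (f : (Fin d → ℝ) → Fin n → ℝ) (θ : Fin n → ℝ)
    (Δ : Set (Fin d → ℝ)) (ε t : ℝ) : ℕ := (NfullSet f θ Δ ε t).ncard

/-- Sup norm of the gradient of a scalar function on `ℝ^d`. -/
def gradSupNorm {d : ℕ} (g : (Fin d → ℝ) → ℝ) (x : Fin d → ℝ) : ℝ :=
  ‖(fun j : Fin d => fderiv ℝ g x (Pi.single j 1) : Fin d → ℝ)‖

/-- The set `𝔖_f(δ,K,T)`. -/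
def SfrakSet {d n : ℕ} (U : Set (Fin d → ℝ)) (f : (Fin d → ℝ) → Fin n → ℝ)
    (δ K : ℝ) (T : Fin n → ℝ) : Set (Fin d → ℝ) :=
  {x | x ∈ U ∧ ∃ a₀ : ℤ, ∃ a : Fin n → ℤ, a ≠ 0 ∧
    |(a₀ : ℝ) + ∑ i, f x i * (a i : ℝ)| < δ ∧
    gradSupNorm (fun y => ∑ i, f y i * (a i : ℝ)) x < K ∧
    ∀ i, |(a i : ℝ)| < T i}

/-- First-order partial derivative `∂_i f_j` (0-based indices as naturals; junk value 0
out of range). -/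
def pd1 {d m : ℕ} (f : (Fin d → ℝ) → Fin m → ℝ) (i j : ℕ) (x : Fin d → ℝ) : ℝ :=
  if h : i < d ∧ j < m then
    fderiv ℝ (fun y => f y ⟨j, h.2⟩) x (Pi.single (⟨i, h.1⟩ : Fin d) 1)
  else 0

/-- Second-order partial derivative `∂_{i'} ∂_i f_j`. -/
def pd2 {d m : ℕ} (f : (Fin d → ℝ) → Fin m → ℝ) (i i' j : ℕ) (x : Fin d → ℝ) : ℝ :=
  if h : i' < d then fderiv ℝ (fun y => pd1 f i j y) x (Pi.single (⟨i', h⟩ : Fin d) 1) else 0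

/-- The Monge map `x ↦ (x, f(x)) : ℝ^d → ℝ^{d+m}`. -/
def fullMap (d m : ℕ) (f : (Fin d → ℝ) → Fin m → ℝ) : (Fin d → ℝ) → Fin (d + m) → ℝ :=
  fun x i => if h : (i : ℕ) < d then x ⟨(i : ℕ), h⟩
    else f x ⟨(i : ℕ) - d, by have := i.isLt; omega⟩

/-- The `i`-th Minkowski successive minimum (w.r.t. the closed unit Euclidean ball) of the
lattice `g ℤ^k`. -/
def succMin {k : ℕ} (i : ℕ) (g : Matrix (Fin k) (Fin k) ℝ) : ℝ :=
  sInf {r : ℝ | 0 ≤ r ∧ i ≤ Module.finrank ℝ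
    (Submodule.span ℝ {w : Fin k → ℝ | (∃ v : Fin k → ℤ, v ≠ 0 ∧
      w = g.mulVec (fun j => (v j : ℝ))) ∧ Real.sqrt (∑ j, w j ^ 2) ≤ r})}

/-- The unipotent matrix `u₁(x) ∈ SL_{n+1}(ℝ)`, `n = d+m`. -/
def u1Mat {d m : ℕ} (f : (Fin d → ℝ) → Fin m → ℝ) (x : Fin d → ℝ) :
    Matrix (Fin (d + m + 1)) (Fin (d + m + 1)) ℝ := fun r c =>
  if (r : ℕ) = (c : ℕ) then 1
  else if (r : ℕ) < m ∧ m ≤ (c : ℕ) ∧ (c : ℕ) < d + m then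
    - pd1 f (d + m - 1 - (c : ℕ)) (m - 1 - (r : ℕ)) x
  else if (r : ℕ) < m ∧ (c : ℕ) = d + m then
    (if h : m - 1 - (r : ℕ) < m then f x ⟨m - 1 - (r : ℕ), h⟩ else 0)
      - ∑ i : Fin d, x i * pd1 f (i : ℕ) (m - 1 - (r : ℕ)) x
  else if m ≤ (r : ℕ) ∧ (r : ℕ) < d + m ∧ (c : ℕ) = d + m then
    (if h : d + m - 1 - (r : ℕ) < d then x ⟨d + m - 1 - (r : ℕ), h⟩ else 0)
  else 0

/-- The inverse `a_{ε,t,v}⁻¹` of the diagonal matrix `a_{ε,t,v}`. -/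
def aInvMat (d m : ℕ) (ε t v : ℝ) : Matrix (Fin (d + m + 1)) (Fin (d + m + 1)) ℝ :=
  Matrix.diagonal (fun i => v * (if (i : ℕ) < m then ε⁻¹
    else if (i : ℕ) < d + m then (ε ^ m * Real.exp t) ^ ((1 : ℝ) / d)
    else (v ^ (d + m + 1) * Real.exp t)⁻¹))

/-- The set `𝔊(v,t,ε)`. -/
def Gfrak {d m : ℕ} (U : Set (Fin d → ℝ)) (f : (Fin d → ℝ) → Fin m → ℝ)
    (v t ε : ℝ) : Set (Fin d → ℝ) :=
  {x | x ∈ U ∧ v ≤ succMin 1 (aInvMat d m ε t v * u1Mat f x)}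

/-- The set `𝒩_θ(t,ε,B)`. -/
def NCal {d m : ℕ} (f : (Fin d → ℝ) → Fin m → ℝ) (θ : Fin (d + m) → ℝ)
    (t : ℕ) (ε : ℝ) (B : Set (Fin d → ℝ)) : Set (ℕ × (Fin d → ℤ) × (Fin m → ℤ)) :=
  {q | 0 < q.1 ∧
    (fun i => ((q.2.1 i : ℝ) + θ (Fin.castAdd m i)) / (q.1 : ℝ)) ∈ B ∧
    Real.exp ((t : ℝ) - 1) ≤ (q.1 : ℝ) ∧ (q.1 : ℝ) ≤ Real.exp t ∧
    ‖(fun j => (q.1 : ℝ) * f (fun i => ((q.2.1 i : ℝ) + θ (Fin.castAdd m i)) / (q.1 : ℝ)) j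
        - θ (Fin.natAdd d j) - (q.2.2 j : ℝ) : Fin m → ℝ)‖ ≤ ε}

/-- The set `Δ_θ(t,ε,B,ρ)`. -/
def DeltaCal {d m : ℕ} (f : (Fin d → ℝ) → Fin m → ℝ) (θ : Fin (d + m) → ℝ)
    (t : ℕ) (ε : ℝ) (B : Set (Fin d → ℝ)) (ρ : ℝ) : Set (Fin d → ℝ) :=
  ⋃ q ∈ NCal f θ t ε B,
    Metric.ball (fun i => ((q.2.1 i : ℝ) + θ (Fin.castAdd m i)) / (q.1 : ℝ)) ρ

/-- `φ = (ε^n e^t)^{1/(n+1)}`, `n = d+m`. -/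
def phiC (d m : ℕ) (ε t : ℝ) : ℝ := (ε ^ (d + m) * Real.exp t) ^ ((1 : ℝ) / (d + m + 1))

/-- `h = dt/(2(n+1))`. -/
def hC (d m : ℕ) (t : ℝ) : ℝ := (d : ℝ) * t / (2 * ((d : ℝ) + m + 1))

def gMat (d m : ℕ) (ε t : ℝ) : Matrix (Fin (d + m + 1)) (Fin (d + m + 1)) ℝ :=
  Matrix.diagonal (fun i => phiC d m ε t *
    (if (i : ℕ) < d + m then ε⁻¹ else Real.exp (-t)))

def bMat (d m : ℕ) (t : ℝ) : Matrix (Fin (d + m + 1)) (Fin (d + m + 1)) ℝ :=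
  Matrix.diagonal (fun i => if (i : ℕ) < m then Real.exp (hC d m t)
    else if (i : ℕ) < d + m then Real.exp (-(((m : ℝ) + 1) * t) / (2 * ((d : ℝ) + m + 1)))
    else Real.exp (hC d m t))

def dMat (d m : ℕ) (ε : ℝ) : Matrix (Fin (d + m + 1)) (Fin (d + m + 1)) ℝ :=
  Matrix.diagonal (fun i => if (i : ℕ) < m then 1
    else if (i : ℕ) < d + m then Real.sqrt ε else 1)

/-- The raw nongeneric set `𝔐₀(ε,t)`. -/
def M0frak {d m : ℕ} (U : Set (Fin d → ℝ)) (f : (Fin d → ℝ) → Fin m → ℝ)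
    (ε t : ℝ) : Set (Fin d → ℝ) :=
  {x | x ∈ U ∧ phiC d m ε t * Real.exp (hC d m t) <
    succMin (d + m + 1) (dMat d m ε * bMat d m t * gMat d m ε t * u1Mat f x)}

/-- The nongeneric (special) set `𝔐(ε,t)`. -/
def Mfrak {d m : ℕ} (U : Set (Fin d → ℝ)) (f : (Fin d → ℝ) → Fin m → ℝ)
    (ε t : ℝ) : Set (Fin d → ℝ) :=
  (⋃ x ∈ M0frak U f ε t, Metric.ball x (Real.sqrt ε * Real.exp (-t / 2))) ∩ U

/-- The inhomogeneous Diophantine exponent `λ_n^θ(x)` of `(x,x²,…,x^n)`, as a value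
in `[0,∞]`. -/
def lambdaN (n : ℕ) (θ : Fin n → ℝ) (x : ℝ) : ℝ≥0∞ :=
  sSup {lam : ℝ≥0∞ | ∃ τ : ℝ, lam = ENNReal.ofReal τ ∧
    (fun i : Fin n => x ^ ((i : ℕ) + 1)) ∈ SApprox n θ (fun q => q ^ (-τ))}

end

open Pointwise in
lemma null_of_analytic {d : ℕ} (F : (Fin d → ℝ) → ℝ) (hF : AnalyticOnNhd ℝ F univ)
    (y₀ : Fin d → ℝ) (h0 : F y₀ ≠ 0) : volume {y | F y = 0} = 0 := by
  have hc : Continuous F := by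
    have := hF.continuousOn
    exact continuousOn_univ.mp this
  have hline : ∀ v : Fin d → ℝ, volume {t : ℝ | F (y₀ + t • v) = 0} = 0 := by
    intro v
    have ha : AnalyticOnNhd ℝ (fun t : ℝ => F (y₀ + t • v)) univ := by
      intro t _
      have h1 : AnalyticAt ℝ (fun t : ℝ => y₀ + t • v) t := by fun_prop
      exact AnalyticAt.fun_comp (hF _ trivial) h1
    have := ha.preimage_zero_mem_codiscrete (x := 0) (by simpa using h0)
    have h2 := ae_restrict_le_codiscreteWithin (μ := volume) (U := (univ : Set ℝ)) MeasurableSet.univ this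
    rw [Measure.restrict_univ, mem_ae_iff] at h2
    convert h2 using 2
    ext t; simp
  have hcl : MeasurableSet {p : ℝ × (Fin d → ℝ) | F (y₀ + p.1 • p.2) = 0} := by
    apply IsClosed.measurableSet
    exact isClosed_eq (by fun_prop) continuous_const
  have hae : ∀ᵐ t : ℝ, ∀ᵐ v : Fin d → ℝ, ¬ F (y₀ + t • v) = 0 := by
    rw [Measure.ae_ae_comm (p := fun (t : ℝ) (v : Fin d → ℝ) => ¬ F (y₀ + t • v) = 0) hcl.compl]
    refine Eventually.of_forall fun v => ?_
    rw [ae_iff]; simpa using hline v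
  have : ∃ t : ℝ, t ≠ 0 ∧ ∀ᵐ v : Fin d → ℝ, ¬ F (y₀ + t • v) = 0 := by
    have h2 : ∀ᵐ t : ℝ, t ≠ 0 := by
      rw [ae_iff]; simp
    obtain ⟨t, ht⟩ := (h2.and hae).exists
    exact ⟨t, ht⟩
  obtain ⟨t, ht, hv⟩ := this
  rw [ae_iff] at hv
  simp only [not_not] at hv
  have himg : {y | F y = 0} = (fun v => y₀ + v) '' (t • {v | F (y₀ + t • v) = 0}) := by
    ext y
    constructor
    · intro hy
      refine ⟨y - y₀, ?_, by simp⟩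
      refine ⟨t⁻¹ • (y - y₀), ?_, ?_⟩
      · simpa [smul_smul, ht] using hy
      · simp [smul_smul, ht]
    · rintro ⟨_, ⟨v, hv, rfl⟩, rfl⟩
      simpa using hv
  rw [himg, image_add_left, measure_preimage_add]
  rw [Measure.addHaar_smul, hv, mul_zero]


lemma compact_small {X ι : Type*} [TopologicalSpace X] {d : ℕ} (K : Set X) (hK : IsCompact K)
    (Q : Set (Fin d → ℝ)) (hQ : IsCompact Q)
    (Φ : ι → X → (Fin d → ℝ) → ℝ) (hΦ : ∀ i, Continuous (fun p : X × (Fin d → ℝ) => Φ i p.1 p.2))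
    (h : ∀ x ∈ K, ∃ i, volume {u ∈ Q | Φ i x u = 0} = 0) (τ : ℝ≥0∞) (hτ : 0 < τ) :
    ∃ ε : ℝ, 0 < ε ∧ ∀ x ∈ K, ∃ i, volume {u ∈ Q | |Φ i x u| ≤ ε} ≤ τ := by
  refine hK.induction_on (p := fun S => ∃ ε : ℝ, 0 < ε ∧ ∀ x ∈ S, ∃ i, volume {u ∈ Q | |Φ i x u| ≤ ε} ≤ τ)
    ⟨1, one_pos, by simp⟩ ?_ ?_ ?_
  · rintro s t hst ⟨ε, h0, h1⟩
    exact ⟨ε, h0, fun x hx => h1 x (hst hx)⟩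
  · rintro s t ⟨ε, h0, h1⟩ ⟨ε', h0', h1'⟩
    refine ⟨min ε ε', lt_min h0 h0', ?_⟩
    rintro x (hx | hx)
    · obtain ⟨i, hi⟩ := h1 x hx
      refine ⟨i, (measure_mono ?_).trans hi⟩
      rintro u ⟨a, b⟩; exact ⟨a, b.trans (min_le_left _ _)⟩
    · obtain ⟨i, hi⟩ := h1' x hx
      refine ⟨i, (measure_mono ?_).trans hi⟩
      rintro u ⟨a, b⟩; exact ⟨a, b.trans (min_le_right _ _)⟩
  · intro x hx
    obtain ⟨i, hi⟩ := h x hx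
    have hcx : Continuous (Φ i x) := (hΦ i).comp (by fun_prop : Continuous (fun u => (x, u)))
    have hlim : Tendsto (fun k : ℕ => volume {u ∈ Q | |Φ i x u| ≤ 1 / ((k : ℝ) + 1)}) atTop
        (nhds (volume (⋂ k : ℕ, {u ∈ Q | |Φ i x u| ≤ 1 / ((k : ℝ) + 1)}))) := by
      apply tendsto_measure_iInter_atTop
      · intro k
        exact (hQ.isClosed.inter (isClosed_le hcx.abs continuous_const)).measurableSet.nullMeasurableSet
      · intro a b hab u hu
        exact ⟨hu.1, hu.2.trans (Nat.one_div_le_one_div hab)⟩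
      · exact ⟨0, ((measure_mono (fun u hu => hu.1)).trans_lt hQ.measure_lt_top).ne⟩
    have hz : volume (⋂ k : ℕ, {u ∈ Q | |Φ i x u| ≤ 1 / ((k : ℝ) + 1)}) = 0 := by
      refine measure_mono_null ?_ hi
      intro u hu
      rw [mem_iInter] at hu
      refine ⟨(hu 0).1, ?_⟩
      have : |Φ i x u| ≤ 0 := by
        refine ge_of_tendsto' tendsto_one_div_add_atTop_nhds_zero_nat (fun k => (hu k).2)
      exact abs_eq_zero.mp (le_antisymm this (abs_nonneg _))
    rw [hz] at hlim
    obtain ⟨k, hk⟩ := (hlim.eventually (gt_mem_nhds hτ)).exists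
    set ε : ℝ := 1 / ((k : ℝ) + 1) with hε
    have hε0 : 0 < ε := by positivity
    have hev : ∀ᶠ x' in nhds x, ∀ u ∈ Q, |Φ i x' u - Φ i x u| < ε / 2 := by
      apply hQ.eventually_forall_of_forall_eventually
      intro u hu
      have hcont : Continuous (fun z : X × (Fin d → ℝ) => |Φ i z.1 z.2 - Φ i x z.2|) := by
        have := hΦ i
        have h2 : Continuous (fun z : X × (Fin d → ℝ) => Φ i x z.2) := hcx.comp continuous_snd
        fun_prop
      exact (hcont.tendsto (x, u)).eventually (gt_mem_nhds (by simpa using by positivity))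
    refine ⟨_, mem_nhdsWithin_of_mem_nhds hev, ε / 2, by positivity, ?_⟩
    intro x' hx'
    refine ⟨i, (measure_mono ?_).trans hk.le⟩
    rintro u ⟨hu, hu2⟩
    refine ⟨hu, ?_⟩
    have := hx' u hu
    have h3 : |Φ i x u| ≤ |Φ i x' u| + |Φ i x' u - Φ i x u| := by
      rw [abs_sub_comm]
      calc |Φ i x u| = |Φ i x' u + (Φ i x u - Φ i x' u)| := by ring_nf
        _ ≤ _ := abs_add_le _ _
    linarith

section Taylor
variable {E : Type} [NormedAddCommGroup E] [NormedSpace ℝ E]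

noncomputable def Tk : (k : ℕ) → {F : Type} → [NormedAddCommGroup F] → [NormedSpace ℝ F] →
    (E → F) → E → E → F
  | 0, _, _, _, g, x, _ => g x
  | k + 1, _, _, _, g, x, h => (Tk k (fderiv ℝ g) x h) h

lemma Tk_congr (k : ℕ) : ∀ {F : Type} [NormedAddCommGroup F] [NormedSpace ℝ F] (g g' : E → F) (x h : E),
    g =ᶠ[nhds x] g' → Tk k g x h = Tk k g' x h := by
  induction k with
  | zero => intro F _ _ g g' x h hg; exact hg.eq_of_nhds
  | succ k ih =>
    intro F _ _ g g' x h hg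
    simp only [Tk]
    rw [ih _ _ x h hg.fderiv]

lemma cd_fderiv {F : Type} [NormedAddCommGroup F] [NormedSpace ℝ F] {g : E → F} {x : E} {k : ℕ}
    (hg : ContDiffAt ℝ ((k + 1 : ℕ) : WithTop ℕ∞) g x) : ContDiffAt ℝ (k : WithTop ℕ∞) (fderiv ℝ g) x :=
  hg.fderiv_right (by push_cast; exact le_rfl)

lemma ev_diff {F : Type} [NormedAddCommGroup F] [NormedSpace ℝ F] {g : E → F} {x : E} {k : ℕ}
    (hg : ContDiffAt ℝ ((k + 1 : ℕ) : WithTop ℕ∞) g x) : ∀ᶠ y in nhds x, DifferentiableAt ℝ g y := by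
  have h1 : ContDiffAt ℝ (1 : WithTop ℕ∞) g x := hg.of_le (by exact_mod_cast Nat.le_add_left 1 k)
  filter_upwards [h1.eventually (by simp)] with y hy
  exact hy.differentiableAt (by simp)

lemma Tk_comp (k : ℕ) : ∀ {F G : Type} [NormedAddCommGroup F] [NormedSpace ℝ F]
    [NormedAddCommGroup G] [NormedSpace ℝ G] (L : F →L[ℝ] G) (g : E → F) (x h : E),
    ContDiffAt ℝ (k : WithTop ℕ∞) g x → Tk k (fun y => L (g y)) x h = L (Tk k g x h) := by
  induction k with
  | zero => intros; rfl
  | succ k ih =>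
    intro F G _ _ _ _ L g x h hg
    simp only [Tk]
    have h1 : fderiv ℝ (fun y => L (g y)) =ᶠ[nhds x]
        fun y => (ContinuousLinearMap.compL ℝ E F G L) (fderiv ℝ g y) := by
      filter_upwards [ev_diff hg] with y hy
      exact (L.hasFDerivAt.comp y hy.hasFDerivAt).fderiv
    rw [Tk_congr k _ _ x h h1, ih _ _ x h (cd_fderiv hg)]
    rfl

lemma Tk_symm (k : ℕ) {F : Type} [NormedAddCommGroup F] [NormedSpace ℝ F] (g : E → F) (x h v w : E)
    (hg : ContDiffAt ℝ ((k + 2 : ℕ) : WithTop ℕ∞) g x) :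
    Tk k (fderiv ℝ (fderiv ℝ g)) x h v w = Tk k (fderiv ℝ (fderiv ℝ g)) x h w v := by
  have h2 : ContDiffAt ℝ (2 : WithTop ℕ∞) g x := hg.of_le (by exact_mod_cast Nat.le_add_left 2 k)
  obtain ⟨Φ, hΦ⟩ : ∃ Φ : (E →L[ℝ] E →L[ℝ] F) →L[ℝ] (E →L[ℝ] E →L[ℝ] F), ∀ B v w, Φ B v w = B w v :=
    ⟨(ContinuousLinearMap.flipₗᵢ ℝ E E F).toContinuousLinearEquiv.toContinuousLinearMap,
      fun _ _ _ => rfl⟩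
  have h1 : fderiv ℝ (fderiv ℝ g) =ᶠ[nhds x] fun y => Φ (fderiv ℝ (fderiv ℝ g) y) := by
    filter_upwards [h2.eventually (by simp)] with y hy
    have := hy.isSymmSndFDerivAt (by simp)
    ext a b
    rw [hΦ]
    exact this a b
  have h3 := Tk_comp (F := E →L[ℝ] E →L[ℝ] F) (G := E →L[ℝ] E →L[ℝ] F) k Φ (fderiv ℝ (fderiv ℝ g)) x h (cd_fderiv (cd_fderiv hg))
  rw [← Tk_congr k _ _ x h h1] at h3
  conv_lhs => rw [h3]
  rw [hΦ]

lemma Tk_deriv (k : ℕ) : ∀ {F : Type} [NormedAddCommGroup F] [NormedSpace ℝ F] (g : E → F) (x h : E),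
    ContDiffAt ℝ ((k + 1 : ℕ) : WithTop ℕ∞) g x →
    HasFDerivAt (fun h => Tk (k + 1) g x h) (((k : ℝ) + 1) • Tk k (fderiv ℝ g) x h) h := by
  induction k with
  | zero =>
    intro F _ _ g x h hg
    simpa [Tk] using (fderiv ℝ g x).hasFDerivAt (x := h)
  | succ k ih =>
    intro F _ _ g x h hg
    have h1 := ih (fderiv ℝ g) x h (cd_fderiv hg)
    have h2 := h1.clm_apply (hasFDerivAt_id h)
    refine h2.congr_fderiv ?_
    ext e
    simp only [id, _root_.add_apply, ContinuousLinearMap.comp_apply, ContinuousLinearMap.flip_apply,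
      _root_.smul_apply, ContinuousLinearMap.id_apply]
    rw [Tk_symm k g x h e h hg]
    simp only [Tk]
    push_cast
    module

lemma Tk_smul (k : ℕ) : ∀ {F : Type} [NormedAddCommGroup F] [NormedSpace ℝ F] (g : E → F) (x h : E) (t : ℝ),
    Tk k g x (t • h) = t ^ k • Tk k g x h := by
  induction k with
  | zero => intros; simp [Tk]
  | succ k ih =>
    intro F _ _ g x h t
    simp only [Tk]
    rw [ih]
    simp only [map_smul, _root_.smul_apply, smul_smul]
    congr 1; ring

lemma Tk_contAt (k : ℕ) : ∀ {F : Type} [NormedAddCommGroup F] [NormedSpace ℝ F] (g : E → F) (x h : E),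
    ContDiffAt ℝ (k : WithTop ℕ∞) g x → ContinuousAt (fun y => Tk k g y h) x := by
  induction k with
  | zero => intro F _ _ g x h hg; exact hg.continuousAt
  | succ k ih =>
    intro F _ _ g x h hg
    exact (ih (fderiv ℝ g) x h (cd_fderiv hg)).clm_apply continuousAt_const

noncomputable def Pl (l : ℕ) {F : Type} [NormedAddCommGroup F] [NormedSpace ℝ F]
    (g : E → F) (x h : E) : F := ∑ k ∈ Finset.range (l + 1), ((k.factorial : ℝ)⁻¹) • Tk k g x h

lemma Pl_deriv (l : ℕ) {F : Type} [NormedAddCommGroup F] [NormedSpace ℝ F] (g : E → F) (x h : E)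
    (hg : ContDiffAt ℝ ((l + 1 : ℕ) : WithTop ℕ∞) g x) :
    HasFDerivAt (fun h => Pl (l + 1) g x h) (Pl l (fderiv ℝ g) x h) h := by
  unfold Pl
  simp_rw [Finset.sum_range_succ' _ (l + 1)]
  have h0 : HasFDerivAt (fun h => (((0 : ℕ).factorial : ℝ)⁻¹) • Tk 0 g x h) (0 : E →L[ℝ] F) h := by
    simp only [Tk]; exact hasFDerivAt_const _ _
  rw [← add_zero (∑ k ∈ Finset.range (l + 1), ((k.factorial : ℝ)⁻¹) • Tk k (fderiv ℝ g) x h)]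
  refine HasFDerivAt.add (HasFDerivAt.fun_sum ?_) h0
  intro k hk
  rw [Finset.mem_range] at hk
  have := (Tk_deriv k g x h (hg.of_le (by exact_mod_cast hk))).const_smul (((k + 1).factorial : ℝ)⁻¹)
  refine this.congr_fderiv ?_
  rw [smul_smul]
  congr 1
  rw [Nat.factorial_succ]
  push_cast
  have : (k.factorial : ℝ) ≠ 0 := by positivity
  field_simp

lemma Pl_zero (l : ℕ) {F : Type} [NormedAddCommGroup F] [NormedSpace ℝ F] (g : E → F) (x : E) :
    Pl l g x 0 = g x := by
  unfold Pl
  rw [Finset.sum_range_succ']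
  simp [Tk]

lemma Taylor_rem (l : ℕ) : ∀ {F : Type} [NormedAddCommGroup F] [NormedSpace ℝ F] (g : E → F) (x₀ : E),
    ContDiffAt ℝ (l : WithTop ℕ∞) g x₀ → ∀ η : ℝ, 0 < η → ∃ R : ℝ, 0 < R ∧ ∀ x h : E,
      dist x x₀ + ‖h‖ < R → ‖g (x + h) - Pl l g x h‖ ≤ η * ‖h‖ ^ l := by
  induction l with
  | zero =>
    intro F _ _ g x₀ hg η hη
    have := Metric.continuousAt_iff.mp hg.continuousAt (η / 2) (by positivity)
    obtain ⟨R, hR, h⟩ := this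
    refine ⟨R, hR, fun x h' hx => ?_⟩
    have h1 := h (x := x) (by have := norm_nonneg h'; linarith)
    have h2 := h (x := x + h') (by
      have : dist (x + h') x₀ ≤ dist (x + h') x + dist x x₀ := dist_triangle _ _ _
      simp only [dist_self_add_left] at this
      linarith)
    simp only [Pl, Finset.sum_range_succ, Finset.range_zero, Finset.sum_empty, Tk]
    simp only [Nat.factorial_zero, Nat.cast_one, inv_one, one_smul, zero_add, pow_zero, mul_one]
    rw [← dist_eq_norm]
    have := dist_triangle_right (g (x + h')) (g x) (g x₀)
    linarith
  | succ l ih =>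
    intro F _ _ g x₀ hg η hη
    obtain ⟨R, hR, h⟩ := ih (fderiv ℝ g) x₀ (cd_fderiv hg) η hη
    have hev : ∀ᶠ y in nhds x₀, ContDiffAt ℝ ((l + 1 : ℕ) : WithTop ℕ∞) g y := hg.eventually (by simp)
    obtain ⟨R', hR', h'⟩ := Metric.eventually_nhds_iff.mp hev
    refine ⟨min R R', lt_min hR hR', fun x k hx => ?_⟩
    have hxR : dist x x₀ + ‖k‖ < R := hx.trans_le (min_le_left _ _)
    have hxR' : dist x x₀ + ‖k‖ < R' := hx.trans_le (min_le_right _ _)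
    have hder : ∀ y ∈ Metric.closedBall (0 : E) ‖k‖,
        HasFDerivWithinAt (fun y => g (x + y) - Pl (l + 1) g x y)
          (fderiv ℝ g (x + y) - Pl l (fderiv ℝ g) x y) (Metric.closedBall (0 : E) ‖k‖) y := by
      intro y hy
      have hy' : ‖y‖ ≤ ‖k‖ := by simpa using hy
      have hd : dist (x + y) x₀ ≤ ‖y‖ + dist x x₀ := by
        have : dist (x + y) x₀ ≤ dist (x + y) x + dist x x₀ := dist_triangle _ _ _
        simpa only [dist_self_add_left] using this
      have hc := h' (y := x + y) (by linarith)
      have h1 : HasFDerivAt g (fderiv ℝ g (x + y)) (x + y) :=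
        (hc.differentiableAt (by simp)).hasFDerivAt
      have h2 : HasFDerivAt (fun y => g (x + y)) (fderiv ℝ g (x + y)) y :=
        (hasFDerivAt_comp_add_left x).mpr h1
      exact (h2.sub (Pl_deriv l g x y (h' (y := x) (by have := norm_nonneg k; linarith)))).hasFDerivWithinAt
    have hb : ∀ y ∈ Metric.closedBall (0 : E) ‖k‖,
        ‖fderiv ℝ g (x + y) - Pl l (fderiv ℝ g) x y‖ ≤ η * ‖k‖ ^ l := by
      intro y hy
      have hy' : ‖y‖ ≤ ‖k‖ := by simpa using hy
      refine (h x y (by linarith)).trans ?_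
      gcongr
    have hm := (convex_closedBall (0 : E) ‖k‖).norm_image_sub_le_of_norm_hasFDerivWithin_le hder hb
      (x := 0) (y := k) (by simp) (by simp)
    simp only [add_zero, Pl_zero, sub_self, sub_zero] at hm
    rw [pow_succ, ← mul_assoc]
    exact hm

end Taylor

section PolySpace

noncomputable def Hp (d : ℕ) : ℕ → Submodule ℝ ((Fin d → ℝ) → ℝ)
  | 0 => Submodule.span ℝ {fun _ => 1}
  | k + 1 => ⨆ i : Fin d, (Hp d k).map (LinearMap.mulLeft ℝ (fun u : Fin d → ℝ => u i))

instance Hp_fin (d k : ℕ) : Module.Finite ℝ (Hp d k) := by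
  induction k with
  | zero => rw [Hp]; infer_instance
  | succ k ih => rw [Hp]; infer_instance

lemma Hp_analytic (d k : ℕ) : ∀ p ∈ Hp d k, AnalyticOnNhd ℝ p univ := by
  induction k with
  | zero =>
    intro p hp
    rw [Hp, Submodule.mem_span_singleton] at hp
    obtain ⟨a, rfl⟩ := hp
    intro x _
    exact analyticAt_const (v := a • (1 : ℝ))
  | succ k ih =>
    intro p hp
    refine Submodule.iSup_induction _ (motive := fun p => AnalyticOnNhd ℝ p univ) hp ?_ ?_ ?_
    · rintro i _ ⟨q, hq, rfl⟩
      intro x hx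
      have h1 : AnalyticAt ℝ (fun u : Fin d → ℝ => u i) x :=
        (ContinuousLinearMap.proj (R := ℝ) (φ := fun _ : Fin d => ℝ) i).analyticAt x
      exact h1.mul (ih q hq x hx)
    · intro x _; exact analyticAt_const (v := (0 : ℝ))
    · intro p q hp hq x hx; exact (hp x hx).add (hq x hx)

lemma Hp_homog (d k : ℕ) : ∀ p ∈ Hp d k, ∀ (t : ℝ) u, p (t • u) = t ^ k * p u := by
  induction k with
  | zero =>
    intro p hp
    rw [Hp, Submodule.mem_span_singleton] at hp
    obtain ⟨a, rfl⟩ := hp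
    intro t u; simp
  | succ k ih =>
    intro p hp
    refine Submodule.iSup_induction _ (motive := fun p : (Fin d → ℝ) → ℝ => ∀ (t : ℝ) u, p (t • u) = t ^ (k + 1) * p u) hp ?_ ?_ ?_
    · rintro i _ ⟨q, hq, rfl⟩ t u
      simp only [LinearMap.mulLeft_apply, Pi.mul_apply, Pi.smul_apply, smul_eq_mul, ih q hq]
      ring
    · intro t u; simp
    · intro p q hp hq t u
      simp only [Pi.add_apply, hp, hq]; ring

lemma Tk_mem_Hp {d : ℕ} (k : ℕ) : ∀ {F : Type} [NormedAddCommGroup F] [NormedSpace ℝ F]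
    (L : F →L[ℝ] ℝ) (g : (Fin d → ℝ) → F) (x : Fin d → ℝ),
    (fun u => L (Tk k g x u)) ∈ Hp d k := by
  induction k with
  | zero =>
    intro F _ _ L g x
    rw [Hp, Submodule.mem_span_singleton]
    exact ⟨L (g x), by ext u; simp [Tk]⟩
  | succ k ih =>
    intro F _ _ L g x
    have : (fun u => L (Tk (k + 1) g x u)) = ∑ i : Fin d,
        LinearMap.mulLeft ℝ (fun u : Fin d → ℝ => u i)
          (fun u => (L.comp (ContinuousLinearMap.apply ℝ F (Pi.single i 1))) (Tk k (fderiv ℝ g) x u)) := by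
      ext u
      simp only [Finset.sum_apply, LinearMap.mulLeft_apply, Pi.mul_apply]
      simp only [Tk]
      have hA : ∀ A : (Fin d → ℝ) →L[ℝ] F, L (A u) = ∑ i, u i * L (A (Pi.single i 1)) := by
        intro A
        have hu : u = ∑ i, u i • (Pi.single i (1 : ℝ) : Fin d → ℝ) := by
          ext j; simp [Finset.sum_apply, Pi.single_apply]
        conv_lhs => rw [hu]
        rw [map_sum, map_sum]
        refine Finset.sum_congr rfl fun i _ => ?_
        rw [map_smul, map_smul, smul_eq_mul]
      exact hA _
    rw [this]
    refine Submodule.sum_mem _ fun i _ => ?_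
    exact Submodule.mem_iSup_of_mem i ⟨_, ih _ _ _, rfl⟩

abbrev Ix (d l : ℕ) := Σ k : Fin (l + 1), Fin (Module.finrank ℝ (Hp d k))

noncomputable def bv (d l : ℕ) (u : Fin d → ℝ) (i : Ix d l) : ℝ :=
  ((Module.finBasis ℝ (Hp d i.1)) i.2 : (Fin d → ℝ) → ℝ) u

noncomputable def pa {d l : ℕ} (a : Ix d l → ℝ) (u : Fin d → ℝ) : ℝ := ∑ i, a i * bv d l u i

noncomputable def qk {d l : ℕ} (a : Ix d l → ℝ) (k : Fin (l + 1)) : Hp d k :=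
  ∑ j, a ⟨k, j⟩ • Module.finBasis ℝ (Hp d k) j

lemma qk_apply {d l : ℕ} (a : Ix d l → ℝ) (k : Fin (l + 1)) (u : Fin d → ℝ) :
    (qk a k : (Fin d → ℝ) → ℝ) u = ∑ j, a ⟨k, j⟩ * bv d l u ⟨k, j⟩ := by
  simp [qk, bv, Finset.sum_apply]

lemma pa_eq {d l : ℕ} (a : Ix d l → ℝ) (u : Fin d → ℝ) :
    pa a u = ∑ k, (qk a k : (Fin d → ℝ) → ℝ) u := by
  simp only [qk_apply, pa]
  rw [Fintype.sum_sigma]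

lemma bv_analytic (d l : ℕ) (i : Ix d l) : AnalyticOnNhd ℝ (fun u => bv d l u i) univ :=
  Hp_analytic d i.1 _ (Module.finBasis ℝ (Hp d i.1) i.2).2

lemma pa_analytic {d l : ℕ} (a : Ix d l → ℝ) : AnalyticOnNhd ℝ (pa a) univ := by
  intro x hx
  unfold pa
  exact Finset.analyticAt_fun_sum _ fun i _ => analyticAt_const.mul (bv_analytic d l i x hx)

lemma pa_eq_zero {d l : ℕ} (a : Ix d l → ℝ) (h : ∀ u, pa a u = 0) : a = 0 := by
  have hq : ∀ k, qk a k = 0 := by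
    intro k
    ext u
    have hp : (∑ k : Fin (l + 1), Polynomial.C ((qk a k : (Fin d → ℝ) → ℝ) u) * Polynomial.X ^ (k : ℕ)) = 0 := by
      apply Polynomial.funext
      intro t
      have := h (t • u)
      rw [pa_eq] at this
      simp only [Polynomial.eval_finsetSum, Polynomial.eval_mul, Polynomial.eval_C, Polynomial.eval_pow,
        Polynomial.eval_X, Polynomial.eval_zero]
      rw [← this]
      refine Finset.sum_congr rfl fun k _ => ?_
      rw [Hp_homog d k _ (qk a k).2 t u, mul_comm]
    have := congrArg (fun p => Polynomial.coeff p k) hp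
    simp only [Polynomial.finsetSum_coeff, Polynomial.coeff_C_mul, Polynomial.coeff_X_pow,
      Polynomial.coeff_zero] at this
    rw [Finset.sum_eq_single k] at this
    · simpa using this
    · intro b _ hb
      have : (k : ℕ) ≠ b := fun h => hb (Fin.ext h.symm)
      simp [this]
    · simp
  funext ⟨k, j⟩
  exact Fintype.linearIndependent_iff.mp (Module.finBasis ℝ (Hp d k)).linearIndependent
    (fun j => a ⟨k, j⟩) (hq k) j

end PolySpace

lemma dot_le {ι : Type} [Fintype ι] (c v : ι → ℝ) : |c ⬝ᵥ v| ≤ (Fintype.card ι : ℝ) * ‖c‖ * ‖v‖ := by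
  unfold dotProduct
  refine (Finset.abs_sum_le_sum_abs _ _).trans ?_
  calc ∑ i, |c i * v i| ≤ ∑ i : ι, ‖c‖ * ‖v‖ := by
        refine Finset.sum_le_sum fun i _ => ?_
        rw [abs_mul]
        exact mul_le_mul (norm_le_pi_norm c i) (norm_le_pi_norm v i) (abs_nonneg _) (norm_nonneg _)
    _ = _ := by simp; ring

lemma lowerT {ι : Type} [Fintype ι] {d l : ℕ} (g : (Fin d → ℝ) → ι → ℝ) (x₀ : Fin d → ℝ)
    (hg : ContDiffAt ℝ (l : WithTop ℕ∞) g x₀)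
    (hND : ∀ c : ι → ℝ, (∀ k ≤ l, ∀ h, c ⬝ᵥ Tk k g x₀ h = 0) → c = 0) :
    ∃ c₀ : ℝ, 0 < c₀ ∧ ∀ᶠ x in nhds x₀, ∀ c : ι → ℝ, ∃ k ≤ l, ∃ u : Fin d → ℝ, ‖u‖ ≤ 1 ∧
      c₀ * ‖c‖ ≤ |c ⬝ᵥ Tk k g x u| := by
  have hmain : ∃ c₀ : ℝ, 0 < c₀ ∧ ∀ᶠ x in nhds x₀, ∀ c ∈ Metric.sphere (0 : ι → ℝ) 1, ∃ k ≤ l,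
      ∃ u : Fin d → ℝ, ‖u‖ ≤ 1 ∧ c₀ ≤ |c ⬝ᵥ Tk k g x u| := by
    refine (isCompact_sphere (0 : ι → ℝ) 1).induction_on (p := fun S => ∃ c₀ : ℝ, 0 < c₀ ∧
      ∀ᶠ x in nhds x₀, ∀ c ∈ S, ∃ k ≤ l,
      ∃ u : Fin d → ℝ, ‖u‖ ≤ 1 ∧ c₀ ≤ |c ⬝ᵥ Tk k g x u|) ⟨1, one_pos, by simp⟩ ?_ ?_ ?_
    · rintro s t hst ⟨c₀, h0, h⟩
      exact ⟨c₀, h0, h.mono fun x hx c hc => hx c (hst hc)⟩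
    · rintro s t ⟨c₀, h0, h⟩ ⟨c₁, h1, h'⟩
      refine ⟨min c₀ c₁, lt_min h0 h1, ?_⟩
      filter_upwards [h, h'] with x hx hx' c hc
      rcases hc with hc | hc
      · obtain ⟨k, hk, u, hu, h2⟩ := hx c hc
        exact ⟨k, hk, u, hu, (min_le_left _ _).trans h2⟩
      · obtain ⟨k, hk, u, hu, h2⟩ := hx' c hc
        exact ⟨k, hk, u, hu, (min_le_right _ _).trans h2⟩
    · intro c hc
      have hc0 : c ≠ 0 := by rintro rfl; simp at hc
      have : ∃ k ≤ l, ∃ h, c ⬝ᵥ Tk k g x₀ h ≠ 0 := by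
        by_contra hcon
        push Not at hcon
        exact hc0 (hND c hcon)
      obtain ⟨k, hk, h, hh⟩ := this
      set u : Fin d → ℝ := (1 / (‖h‖ + 1)) • h with hu
      have hu1 : ‖u‖ ≤ 1 := by
        rw [hu, norm_smul, Real.norm_of_nonneg (by positivity), one_div, inv_mul_le_iff₀ (by positivity)]
        linarith
      have hv : c ⬝ᵥ Tk k g x₀ u ≠ 0 := by
        rw [hu, Tk_smul, dotProduct_smul, smul_eq_mul]
        exact mul_ne_zero (by positivity) hh
      set v := |c ⬝ᵥ Tk k g x₀ u| with hvdef
      have hv0 : 0 < v := abs_pos.mpr hv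
      have hT : ContinuousAt (fun y => Tk k g y u) x₀ := Tk_contAt k g x₀ u (hg.of_le (by exact_mod_cast hk))
      have hcont : ContinuousAt (fun p : (ι → ℝ) × (Fin d → ℝ) => |p.1 ⬝ᵥ Tk k g p.2 u|) (c, x₀) := by
        have h2 : ContinuousAt (fun p : (ι → ℝ) × (Fin d → ℝ) => Tk k g p.2 u) (c, x₀) :=
          ContinuousAt.comp (g := fun y => Tk k g y u) hT continuousAt_snd
        unfold dotProduct
        refine ContinuousAt.abs (tendsto_finsetSum _ fun i _ => ?_)
        exact ContinuousAt.mul ((continuous_apply i).continuousAt.comp continuousAt_fst)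
          ((continuous_apply i).continuousAt.comp h2)
      have hev := hcont.eventually (lt_mem_nhds (show v / 2 < _ from by
        show v / 2 < v; linarith))
      rw [nhds_prod_eq, eventually_prod_iff] at hev
      obtain ⟨pa, hpa, pb, hpb, hab⟩ := hev
      refine ⟨{c | pa c}, mem_nhdsWithin_of_mem_nhds hpa, v / 2, by positivity, ?_⟩
      filter_upwards [hpb] with x hx c' hc'
      exact ⟨k, hk, u, hu1, (hab hc' hx).le⟩
  obtain ⟨c₀, h0, h⟩ := hmain
  refine ⟨c₀, h0, h.mono fun x hx c => ?_⟩
  by_cases hc : c = 0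
  · exact ⟨0, Nat.zero_le _, 0, by simp, by simp [hc]⟩
  · have hn : 0 < ‖c‖ := norm_pos_iff.mpr hc
    obtain ⟨k, hk, u, hu, h2⟩ := hx (‖c‖⁻¹ • c) (by simp [norm_smul, hn.ne'])
    refine ⟨k, hk, u, hu, ?_⟩
    rw [smul_dotProduct, smul_eq_mul, abs_mul, abs_inv, abs_norm, le_inv_mul_iff₀ hn] at h2
    linarith

lemma bv_bound (d l : ℕ) : ∃ C : ℝ, 0 < C ∧ ∀ (a : Ix d l → ℝ) (u : Fin d → ℝ), ‖u‖ ≤ 1 →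
    |pa a u| ≤ C * ‖a‖ ∧ (∀ s, |fderiv ℝ (pa a) u (Pi.single s 1)| ≤ C * ‖a‖) ∧
    ∀ k, |(qk a k : (Fin d → ℝ) → ℝ) u| ≤ C * ‖a‖ := by
  have hC : ∃ C : ℝ, 0 < C ∧ ∀ u : Fin d → ℝ, ‖u‖ ≤ 1 → ∀ i, |bv d l u i| ≤ C ∧
      ∀ s, |fderiv ℝ (fun u => bv d l u i) u (Pi.single s 1)| ≤ C := by
    have hcomp : IsCompact (Metric.closedBall (0 : Fin d → ℝ) 1) := isCompact_closedBall _ _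
    have h1 : ∀ i : Ix d l, ∃ C : ℝ, ∀ u ∈ Metric.closedBall (0 : Fin d → ℝ) 1, ‖bv d l u i‖ ≤ C := by
      intro i
      exact hcomp.exists_bound_of_continuousOn ((bv_analytic d l i).continuousOn.mono (subset_univ _))
    have h2 : ∀ (i : Ix d l) (s : Fin d), ∃ C : ℝ, ∀ u ∈ Metric.closedBall (0 : Fin d → ℝ) 1,
        ‖fderiv ℝ (fun u => bv d l u i) u (Pi.single s 1)‖ ≤ C := by
      intro i s
      refine hcomp.exists_bound_of_continuousOn ?_
      exact ((bv_analytic d l i).fderiv.continuousOn.mono (subset_univ _)).clm_apply continuousOn_const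
    choose C1 hC1 using h1
    choose C2 hC2 using h2
    refine ⟨∑ i, |C1 i| + ∑ i, ∑ s, |C2 i s| + 1, by positivity, fun u hu i => ?_⟩
    have hu' : u ∈ Metric.closedBall (0 : Fin d → ℝ) 1 := by simpa using hu
    have hs1 : |C1 i| ≤ ∑ i, |C1 i| := Finset.single_le_sum (f := fun i => |C1 i|) (fun _ _ => abs_nonneg _) (Finset.mem_univ i)
    have hp1 : 0 ≤ ∑ i, |C1 i| := by positivity
    have hp2 : 0 ≤ ∑ i, ∑ s, |C2 i s| := by positivity
    constructor
    · have := hC1 i u hu'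
      rw [Real.norm_eq_abs] at this
      have := le_abs_self (C1 i)
      linarith
    · intro s
      have := hC2 i s u hu'
      rw [Real.norm_eq_abs] at this
      have := le_abs_self (C2 i s)
      have h3 : |C2 i s| ≤ ∑ s, |C2 i s| := Finset.single_le_sum (f := fun s => |C2 i s|) (fun _ _ => abs_nonneg _) (Finset.mem_univ s)
      have h4 : ∑ s, |C2 i s| ≤ ∑ i, ∑ s, |C2 i s| := Finset.single_le_sum (f := fun i => ∑ s, |C2 i s|) (fun _ _ => by positivity) (Finset.mem_univ i)
      linarith
  obtain ⟨C, hC0, hC⟩ := hC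
  have hcard : (0 : ℝ) ≤ Fintype.card (Ix d l) := by positivity
  have key : ∀ (a : Ix d l → ℝ) (w : Ix d l → ℝ) (_ : ∀ i, |w i| ≤ C) (S : Finset (Ix d l)),
      |∑ i ∈ S, a i * w i| ≤ (Fintype.card (Ix d l) + 1) * C * ‖a‖ := by
    intro a w hw S
    refine (Finset.abs_sum_le_sum_abs _ _).trans ?_
    calc ∑ i ∈ S, |a i * w i| ≤ ∑ i ∈ S, ‖a‖ * C := by
          refine Finset.sum_le_sum fun i _ => ?_
          rw [abs_mul]
          exact mul_le_mul (norm_le_pi_norm a i) (hw i) (abs_nonneg _) (norm_nonneg _)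
      _ = S.card * (‖a‖ * C) := by simp
      _ ≤ Fintype.card (Ix d l) * (‖a‖ * C) := by
          gcongr; exact Finset.card_le_univ S
      _ ≤ _ := by nlinarith [mul_nonneg (norm_nonneg a) hC0.le]
  refine ⟨(Fintype.card (Ix d l) + 1) * C, by positivity, fun a u hu => ⟨?_, ?_, ?_⟩⟩
  · exact key a _ (fun i => (hC u hu i).1) _
  · intro s
    have : fderiv ℝ (pa a) u (Pi.single s 1) = ∑ i, a i * fderiv ℝ (fun u => bv d l u i) u (Pi.single s 1) := by
      have h1 : HasFDerivAt (pa a) (∑ i, a i • fderiv ℝ (fun u => bv d l u i) u) u := by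
        unfold pa
        refine HasFDerivAt.fun_sum fun i _ => ?_
        exact (bv_analytic d l i u trivial).differentiableAt.hasFDerivAt.const_mul (a i)
      rw [h1.fderiv]
      simp
    rw [this]
    exact key a _ (fun i => (hC u hu i).2 s) _
  · intro k
    rw [qk_apply]
    have := key a _ (fun i => (hC u hu i).1) (Finset.univ.map ⟨fun j => (⟨k, j⟩ : Ix d l), fun a b h => by simpa using h⟩)
    rw [Finset.sum_map] at this
    exact this

noncomputable def dotL {ι : Type} [Fintype ι] (c : ι → ℝ) : (ι → ℝ) →L[ℝ] ℝ :=
  LinearMap.toContinuousLinearMap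
    { toFun := fun v => c ⬝ᵥ v, map_add' := by intro a b; rw [dotProduct_add],
      map_smul' := by intro a b; rw [dotProduct_smul]; rfl }

lemma dotL_apply {ι : Type} [Fintype ι] (c v : ι → ℝ) : dotL c v = c ⬝ᵥ v := rfl

lemma approx_poly {ι : Type} [Fintype ι] {d l : ℕ} (g : (Fin d → ℝ) → ι → ℝ) (x₀ : Fin d → ℝ)
    (hg : ContDiffAt ℝ ((l + 1 : ℕ) : WithTop ℕ∞) g x₀)
    (hND : ∀ c : ι → ℝ, (∀ k ≤ l + 1, ∀ h, c ⬝ᵥ Tk k g x₀ h = 0) → c = 0) (η : ℝ) (hη : 0 < η) :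
    ∃ R : ℝ, 0 < R ∧ ∀ (x₁ : Fin d → ℝ) (r : ℝ), 0 < r → dist x₁ x₀ + r < R →
      ∃ a : (ι → ℝ) →ₗ[ℝ] (Ix d (l + 1) → ℝ), Function.Injective a ∧ ∀ c u, ‖u‖ ≤ 1 →
        |c ⬝ᵥ g (x₁ + r • u) - pa (a c) u| ≤ η * ‖a c‖ ∧
        ∀ s, |r * (c ⬝ᵥ fderiv ℝ g (x₁ + r • u) (Pi.single s 1)) - fderiv ℝ (pa (a c)) u (Pi.single s 1)|
          ≤ η * ‖a c‖ := by
  obtain ⟨c₀, hc₀, hlow⟩ := lowerT g x₀ hg hND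
  obtain ⟨C, hC0, hC⟩ := bv_bound d (l + 1)
  obtain ⟨R1, hR1, hlow⟩ := Metric.eventually_nhds_iff.mp hlow
  set c₁ : ℝ := c₀ / (C * (l + 1).factorial) with hc₁
  have hc₁0 : 0 < c₁ := by positivity
  set N : ℝ := (Fintype.card ι : ℝ) + 1 with hN
  have hN0 : 0 < N := by positivity
  set η' : ℝ := η * c₁ / N with hη'
  have hη'0 : 0 < η' := by positivity
  obtain ⟨R2, hR2, hT⟩ := Taylor_rem (l + 1) g x₀ hg η' hη'0
  obtain ⟨R3, hR3, hT'⟩ := Taylor_rem l (fderiv ℝ g) x₀ (cd_fderiv hg) η' hη'0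
  obtain ⟨R4, hR4, hcd⟩ := Metric.eventually_nhds_iff.mp
    (hg.eventually (by simp) : ∀ᶠ y in nhds x₀, ContDiffAt ℝ ((l + 1 : ℕ) : WithTop ℕ∞) g y)
  refine ⟨min (min (min R1 R2) (min R3 R4)) 1, by positivity, fun x₁ r hr hx => ?_⟩
  have hxR1 : dist x₁ x₀ + r < R1 := by
    refine hx.trans_le ?_; simp
  have hxR2 : dist x₁ x₀ + r < R2 := by
    refine hx.trans_le ?_; simp
  have hxR3 : dist x₁ x₀ + r < R3 := by
    refine hx.trans_le ?_; simp
  have hxR4 : dist x₁ x₀ + r < R4 := by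
    refine hx.trans_le ?_; simp
  have hr1 : r < 1 := by
    have := hx.trans_le (min_le_right _ _)
    have := dist_nonneg (x := x₁) (y := x₀)
    linarith
  -- construct linear map
  let A : ∀ k : Fin (l + 2), (ι → ℝ) →ₗ[ℝ] Hp d k := fun k =>
    LinearMap.codRestrict (Hp d k)
      { toFun := fun c u => (r ^ (k : ℕ) * ((k : ℕ).factorial : ℝ)⁻¹) * (c ⬝ᵥ Tk k g x₁ u),
        map_add' := by intro a b; ext u; simp [add_dotProduct, mul_add]
        map_smul' := by intro a b; ext u; simp [smul_dotProduct]; ring }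
      (by
        intro c
        have := (Hp d k).smul_mem (r ^ (k : ℕ) * ((k : ℕ).factorial : ℝ)⁻¹) (Tk_mem_Hp k (dotL c) g x₁)
        exact this)
  let a : (ι → ℝ) →ₗ[ℝ] (Ix d (l + 1) → ℝ) :=
    LinearMap.pi fun i => ((Module.finBasis ℝ (Hp d i.1)).coord i.2).comp (A i.1)
  have hqk : ∀ c (k : Fin (l + 2)), qk (a c) k = A k c := by
    intro c k
    unfold qk
    exact (Module.finBasis ℝ (Hp d k)).sum_repr (A k c)
  have hA : ∀ (k : Fin (l + 2)) c u, ((A k c : Hp d k) : (Fin d → ℝ) → ℝ) u =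
      (r ^ (k : ℕ) * ((k : ℕ).factorial : ℝ)⁻¹) * (c ⬝ᵥ Tk k g x₁ u) := fun _ _ _ => rfl
  have hpa : ∀ c u, pa (a c) u = c ⬝ᵥ Pl (l + 1) g x₁ (r • u) := by
    intro c u
    rw [pa_eq]
    unfold Pl
    rw [dotProduct_sum, Finset.sum_range]
    refine Finset.sum_congr rfl fun k _ => ?_
    rw [hqk, hA, Tk_smul, dotProduct_smul, dotProduct_smul, smul_eq_mul, smul_eq_mul]
    ring
  have hlb : ∀ c, c₁ * r ^ (l + 1) * ‖c‖ ≤ ‖a c‖ := by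
    intro c
    obtain ⟨k, hk, u, hu, h⟩ := hlow (y := x₁) (by linarith) c
    have h1 := (hC (a c) u hu).2.2 ⟨k, by omega⟩
    rw [hqk, hA] at h1
    simp only at h1
    rw [abs_mul, abs_of_pos (by positivity)] at h1
    have h2 : r ^ (l + 1) * ((l + 1).factorial : ℝ)⁻¹ ≤ r ^ k * (k.factorial : ℝ)⁻¹ := by
      have : r ^ (l + 1) ≤ r ^ k := pow_le_pow_of_le_one hr.le hr1.le hk
      have h3 : ((l + 1).factorial : ℝ)⁻¹ ≤ (k.factorial : ℝ)⁻¹ := by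
        gcongr
      exact mul_le_mul this h3 (by positivity) (by positivity)
    have h4 : r ^ (l + 1) * ((l + 1).factorial : ℝ)⁻¹ * (c₀ * ‖c‖) ≤ C * ‖a c‖ :=
      (mul_le_mul h2 h (by positivity) (by positivity)).trans h1
    calc c₁ * r ^ (l + 1) * ‖c‖ = C⁻¹ * (r ^ (l + 1) * ((l + 1).factorial : ℝ)⁻¹ * (c₀ * ‖c‖)) := by
          rw [hc₁]; field_simp
      _ ≤ C⁻¹ * (C * ‖a c‖) := by gcongr
      _ = ‖a c‖ := by field_simp
  refine ⟨a, ?_, ?_⟩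
  · rw [← LinearMap.ker_eq_bot, LinearMap.ker_eq_bot']
    intro c hc
    have := hlb c
    rw [hc, norm_zero] at this
    have h2 : ‖c‖ ≤ 0 := by
      by_contra hcon
      push Not at hcon
      have : 0 < c₁ * r ^ (l + 1) * ‖c‖ := by positivity
      linarith
    exact norm_le_zero_iff.mp h2
  · intro c u hu
    have hru : ‖r • u‖ ≤ r := by
      rw [norm_smul, Real.norm_of_nonneg hr.le]; nlinarith
    have hη2 : N * ‖c‖ * (η' * r ^ (l + 1)) ≤ η * ‖a c‖ := by
      have := hlb c
      calc N * ‖c‖ * (η' * r ^ (l + 1)) = η * (c₁ * r ^ (l + 1) * ‖c‖) := by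
            rw [hη']; field_simp
        _ ≤ _ := by gcongr
    have hdotN : ∀ v : ι → ℝ, |c ⬝ᵥ v| ≤ N * ‖c‖ * ‖v‖ := by
      intro v
      refine (dot_le c v).trans ?_
      gcongr
      rw [hN]; linarith
    constructor
    · rw [hpa, ← dotProduct_sub]
      refine (hdotN _).trans (le_trans ?_ hη2)
      have := hT x₁ (r • u) (by linarith)
      have h3 : ‖r • u‖ ^ (l + 1) ≤ r ^ (l + 1) := by gcongr
      have h4 : ‖g (x₁ + r • u) - Pl (l + 1) g x₁ (r • u)‖ ≤ η' * r ^ (l + 1) :=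
        this.trans (by gcongr)
      gcongr
    · intro s
      have hder : HasFDerivAt (pa (a c)) ((dotL c).comp ((Pl l (fderiv ℝ g) x₁ (r • u)).comp
          (r • ContinuousLinearMap.id ℝ (Fin d → ℝ)))) u := by
        have h1 := Pl_deriv l g x₁ (r • u) (hcd (y := x₁) (by linarith))
        have h2 : HasFDerivAt (fun u : Fin d → ℝ => r • u) (r • ContinuousLinearMap.id ℝ (Fin d → ℝ)) u :=
          (hasFDerivAt_id u).const_smul r
        have h3 := (dotL c).hasFDerivAt.comp u (h1.comp u h2)
        have h4 : pa (a c) = (dotL c) ∘ ((fun h => Pl (l + 1) g x₁ h) ∘ fun u => r • u) := by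
          ext u; rw [hpa]; rfl
        rw [h4]; exact h3
      rw [hder.fderiv]
      have h5 : ((dotL c).comp ((Pl l (fderiv ℝ g) x₁ (r • u)).comp
          (r • ContinuousLinearMap.id ℝ (Fin d → ℝ)))) (Pi.single s 1) =
          r * (c ⬝ᵥ (Pl l (fderiv ℝ g) x₁ (r • u)) (Pi.single s 1)) := by
        simp only [ContinuousLinearMap.comp_apply, _root_.smul_apply, ContinuousLinearMap.id_apply,
          map_smul, dotL_apply, smul_eq_mul]
      rw [h5, ← mul_sub, ← dotProduct_sub, abs_mul, abs_of_pos hr]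
      have h6 := hT' x₁ (r • u) (by linarith)
      have h7 : ‖(fderiv ℝ g (x₁ + r • u)) (Pi.single s 1) - (Pl l (fderiv ℝ g) x₁ (r • u)) (Pi.single s 1)‖
          ≤ η' * r ^ l := by
        rw [← _root_.sub_apply]
        refine (ContinuousLinearMap.le_opNorm _ _).trans ?_
        have h8 : ‖(Pi.single s 1 : Fin d → ℝ)‖ ≤ 1 := by
          simp [Pi.norm_single]
        have h3 : ‖r • u‖ ^ l ≤ r ^ l := by gcongr
        calc _ ≤ (η' * r ^ l) * 1 := by
              refine mul_le_mul (h6.trans (by gcongr)) h8 (norm_nonneg _) (by positivity)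
          _ = _ := mul_one _
      refine le_trans ?_ hη2
      calc r * |c ⬝ᵥ ((fderiv ℝ g (x₁ + r • u)) (Pi.single s 1) - (Pl l (fderiv ℝ g) x₁ (r • u)) (Pi.single s 1))|
          ≤ r * (N * ‖c‖ * (η' * r ^ l)) := by
            gcongr
            refine (hdotN _).trans ?_
            gcongr
        _ = _ := by ring

noncomputable def Phs {d l : ℕ} (s : Fin d) (a a' : Ix d l → ℝ) (u : Fin d → ℝ) : ℝ :=
  pa a u * fderiv ℝ (pa a') u (Pi.single s 1) - pa a' u * fderiv ℝ (pa a) u (Pi.single s 1)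

lemma pa_fderiv {d l : ℕ} (a : Ix d l → ℝ) (u : Fin d → ℝ) (s : Fin d) :
    fderiv ℝ (pa a) u (Pi.single s 1) = ∑ i, a i * fderiv ℝ (fun u => bv d l u i) u (Pi.single s 1) := by
  have h1 : HasFDerivAt (pa a) (∑ i, a i • fderiv ℝ (fun u => bv d l u i) u) u := by
    unfold pa
    refine HasFDerivAt.fun_sum fun i _ => ?_
    exact (bv_analytic d l i u trivial).differentiableAt.hasFDerivAt.const_mul (a i)
  rw [h1.fderiv]
  simp

lemma pa_smul {d l : ℕ} (t : ℝ) (a : Ix d l → ℝ) (u : Fin d → ℝ) : pa (t • a) u = t * pa a u := by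
  simp [pa, Finset.mul_sum, mul_assoc]

lemma pa_fderiv_smul {d l : ℕ} (t : ℝ) (a : Ix d l → ℝ) (u : Fin d → ℝ) (s : Fin d) :
    fderiv ℝ (pa (t • a)) u (Pi.single s 1) = t * fderiv ℝ (pa a) u (Pi.single s 1) := by
  simp [pa_fderiv, Finset.mul_sum, mul_assoc]

lemma Phs_smul {d l : ℕ} (s : Fin d) (t t' : ℝ) (a a' : Ix d l → ℝ) (u : Fin d → ℝ) :
    Phs s (t • a) (t' • a') u = t * t' * Phs s a a' u := by
  simp only [Phs, pa_smul, pa_fderiv_smul]; ring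

lemma pa_cont (d l : ℕ) : Continuous (fun p : (Ix d l → ℝ) × (Fin d → ℝ) => pa p.1 p.2) := by
  unfold pa
  refine continuous_finsetSum _ fun i _ => ?_
  have : Continuous (fun u => bv d l u i) := continuousOn_univ.mp (bv_analytic d l i).continuousOn
  exact ((continuous_apply i).comp continuous_fst).mul (this.comp continuous_snd)

lemma pa_fderiv_cont (d l : ℕ) (s : Fin d) :
    Continuous (fun p : (Ix d l → ℝ) × (Fin d → ℝ) => fderiv ℝ (pa p.1) p.2 (Pi.single s 1)) := by
  simp_rw [pa_fderiv]
  refine continuous_finsetSum _ fun i _ => ?_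
  have : Continuous (fderiv ℝ (fun u => bv d l u i)) := continuousOn_univ.mp (bv_analytic d l i).fderiv.continuousOn
  exact ((continuous_apply i).comp continuous_fst).mul ((this.comp continuous_snd).clm_apply continuous_const)

lemma Phs_analytic {d l : ℕ} (s : Fin d) (a a' : Ix d l → ℝ) : AnalyticOnNhd ℝ (Phs s a a') univ := by
  have hd : ∀ a : Ix d l → ℝ, AnalyticOnNhd ℝ (fun u => fderiv ℝ (pa a) u (Pi.single s 1)) univ := by
    intro a u hu
    have := (pa_analytic a).fderiv u hu
    exact ((ContinuousLinearMap.apply ℝ ℝ (Pi.single s 1 : Fin d → ℝ)).analyticAt _).fun_comp this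
  intro u hu
  exact ((pa_analytic a u hu).mul (hd a' u hu)).sub ((pa_analytic a' u hu).mul (hd a u hu))

lemma Phs_prop {d l : ℕ} (a a' : Ix d l → ℝ) (ha : a ≠ 0) (h : ∀ s u, Phs s a a' u = 0) :
    ∃ κ : ℝ, a' = κ • a := by
  have h1 : ∃ u, pa a u ≠ 0 := by
    by_contra hcon
    push Not at hcon
    exact ha (pa_eq_zero a hcon)
  obtain ⟨u₀, hu₀⟩ := h1
  have hcont : ContinuousAt (pa a) u₀ := (pa_analytic a u₀ trivial).continuousAt
  obtain ⟨ρ, hρ, hball⟩ := Metric.eventually_nhds_iff.mp (hcont.eventually_ne hu₀)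
  have hd : ∀ a : Ix d l → ℝ, ∀ u, HasFDerivAt (pa a) (fderiv ℝ (pa a) u) u := fun a u =>
    (pa_analytic a u trivial).differentiableAt.hasFDerivAt
  have hder : ∀ u ∈ Metric.ball u₀ ρ, HasFDerivWithinAt (fun u => pa a' u / pa a u) (0 : (Fin d → ℝ) →L[ℝ] ℝ)
      (Metric.ball u₀ ρ) u := by
    intro u hu
    have hne : pa a u ≠ 0 := hball hu
    have hinv : HasFDerivAt (fun u => (pa a u)⁻¹) (-(pa a u ^ 2)⁻¹ • fderiv ℝ (pa a) u) u :=
      (hasDerivAt_inv hne).comp_hasFDerivAt u (hd a u)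
    have := (hd a' u).fun_mul hinv
    simp_rw [div_eq_mul_inv]
    refine (this.congr_fderiv ?_).hasFDerivWithinAt
    refine ContinuousLinearMap.coe_injective (LinearMap.pi_ext' fun s => LinearMap.ext_ring ?_)
    have hs := h s u
    simp only [Phs] at hs
    simp only [LinearMap.coe_comp, ContinuousLinearMap.coe_coe, Function.comp, LinearMap.single_apply,
      _root_.smul_apply, _root_.add_apply, smul_eq_mul, _root_.zero_apply]
    field_simp
    linarith
  have hconst : ∀ u ∈ Metric.ball u₀ ρ, pa a' u / pa a u = pa a' u₀ / pa a u₀ := by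
    intro u hu
    have := (convex_ball u₀ ρ).norm_image_sub_le_of_norm_hasFDerivWithin_le hder (C := 0) (by simp)
      (x := u₀) (y := u) (by simpa using hρ) hu
    simp only [zero_mul] at this
    have := norm_le_zero_iff.mp this
    linarith
  set κ := pa a' u₀ / pa a u₀ with hκ
  refine ⟨κ, ?_⟩
  have hz : ∀ u, pa (a' - κ • a) u = pa a' u - κ * pa a u := by
    intro u
    simp [pa, Finset.mul_sum, sub_mul, mul_assoc]
  have heq : EqOn (pa (a' - κ • a)) 0 univ := by
    refine (pa_analytic (a' - κ • a)).eqOn_zero_of_preconnected_of_eventuallyEq_zero isPreconnected_univ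
      (mem_univ u₀) ?_
    filter_upwards [Metric.ball_mem_nhds u₀ hρ] with u hu
    have hne : pa a u ≠ 0 := hball hu
    have h3 := hconst u hu
    rw [hz, Pi.zero_apply, ← h3]
    field_simp
    ring
  have := pa_eq_zero _ (fun u => heq (mem_univ u))
  exact sub_eq_zero.mp this

open Pointwise in
lemma scale_vol {d : ℕ} (x₁ : Fin d → ℝ) (r : ℝ) (hr : 0 < r) (P : (Fin d → ℝ) → Prop) (τ : ℝ≥0∞)
    (h : volume {u ∈ Metric.closedBall (0 : Fin d → ℝ) 1 | P (x₁ + r • u)} ≤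
      τ * volume (Metric.closedBall (0 : Fin d → ℝ) 1)) :
    volume {y ∈ Metric.closedBall x₁ r | P y} ≤ τ * volume (Metric.closedBall x₁ r) := by
  have himg : {y ∈ Metric.closedBall x₁ r | P y} ⊆
      (fun v => x₁ + v) '' (r • {u ∈ Metric.closedBall (0 : Fin d → ℝ) 1 | P (x₁ + r • u)}) := by
    rintro y ⟨hy, hP⟩
    refine ⟨y - x₁, ⟨r⁻¹ • (y - x₁), ⟨?_, ?_⟩, ?_⟩, by simp⟩
    · rw [Metric.mem_closedBall, dist_eq_norm] at hy
      rw [mem_closedBall_zero_iff, norm_smul, norm_inv, Real.norm_of_nonneg hr.le, inv_mul_le_iff₀ hr]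
      simpa using hy
    · simpa [smul_smul, hr.ne'] using hP
    · simp [smul_smul, hr.ne']
  have hvol : volume (Metric.closedBall x₁ r) =
      ENNReal.ofReal (r ^ d) * volume (Metric.closedBall (0 : Fin d → ℝ) 1) := by
    rw [Measure.addHaar_closedBall' volume x₁ hr.le, Module.finrank_fin_fun]
  refine (measure_mono himg).trans ?_
  rw [image_add_left, measure_preimage_add, Measure.addHaar_smul, Module.finrank_fin_fun, hvol,
    abs_of_pos (by positivity)]
  rw [mul_left_comm]
  gcongr

noncomputable def Sg {ι : Type} [Fintype ι] {d : ℕ} (g : (Fin d → ℝ) → ι → ℝ) (s : Fin d) (c c' : ι → ℝ)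
    (y : Fin d → ℝ) : ℝ :=
  (c ⬝ᵥ g y) * (c' ⬝ᵥ fderiv ℝ g y (Pi.single s 1)) - (c' ⬝ᵥ g y) * (c ⬝ᵥ fderiv ℝ g y (Pi.single s 1))

lemma herr_real (η C α α' r X X' Y Y' P P' T T' : ℝ) (hη0 : 0 ≤ η) (hη1 : η ≤ 1) (hC0 : 0 ≤ C)
    (hn1 : 0 ≤ α) (hn2 : 0 ≤ α') (p1 : |X - P| ≤ η * α) (q1 : |X' - P'| ≤ η * α')
    (p2 : |r * Y - T| ≤ η * α) (q2 : |r * Y' - T'| ≤ η * α') (b1 : |P| ≤ C * α) (b1' : |P'| ≤ C * α')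
    (b2 : |T| ≤ C * α) (b2' : |T'| ≤ C * α') :
    |r * (X * Y' - X' * Y) - (P * T' - P' * T)| ≤ 2 * η * (2 * C + 1) * (α * α') ∧
      |P * T' - P' * T| ≤ 2 * C ^ 2 * (α * α') := by
  have prod : ∀ A B p q : ℝ, |A| ≤ p * α → |B| ≤ q * α' → 0 ≤ p → |A * B| ≤ p * q * (α * α') := by
    intro A B p q hA hB hp
    rw [abs_mul]
    calc |A| * |B| ≤ (p * α) * (q * α') := mul_le_mul hA hB (abs_nonneg _) (by positivity)
      _ = _ := by ring
  have prod' : ∀ A B p q : ℝ, |A| ≤ p * α → |B| ≤ q * α' → 0 ≤ p → |B * A| ≤ p * q * (α * α') := by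
    intro A B p q hA hB hp
    rw [mul_comm]; exact prod A B p q hA hB hp
  constructor
  · have f1 := prod _ _ _ _ p1 q2 hη0
    have f2 := prod _ _ _ _ p1 b2' hη0
    have f3 := prod _ _ _ _ b1 q2 hC0
    have f4 := prod' _ _ _ _ p2 q1 hη0
    have f5 := prod' _ _ _ _ p2 b1' hη0
    have f6 := prod' _ _ _ _ b2 q1 hC0
    have hid : r * (X * Y' - X' * Y) - (P * T' - P' * T) =
        (X - P) * (r * Y' - T') + (X - P) * T' + P * (r * Y' - T')
        - (X' - P') * (r * Y - T) - P' * (r * Y - T) - (X' - P') * T := by ring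
    rw [hid]
    have hαα : 0 ≤ α * α' := by positivity
    have hη2 : η * η * (α * α') ≤ η * (α * α') := by
      have : η * η ≤ η := by nlinarith
      gcongr
    have hr : 2 * η * (2 * C + 1) * (α * α') = 4 * (η * C * (α * α')) + 2 * (η * (α * α')) := by ring
    have hr2 : C * η * (α * α') = η * C * (α * α') := by ring
    rw [hr]
    rw [hr2] at f3 f6
    clear prod prod' p1 q1 p2 q2 b1 b1' b2 b2' hid hr hr2
    rw [abs_le] at f1 f2 f3 f4 f5 f6 ⊢
    constructor <;> linarith
  · have f1 := prod _ _ _ _ b1 b2' hC0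
    have f2 := prod' _ _ _ _ b2 b1' hC0
    have hr : 2 * C ^ 2 * (α * α') = 2 * (C * C * (α * α')) := by ring
    rw [hr]
    clear prod prod' p1 q1 p2 q2 b1 b1' b2 b2'
    rw [abs_le] at f1 f2 ⊢
    constructor <;> linarith

set_option maxHeartbeats 1000000 in
lemma weak_good {ι : Type} [Fintype ι] {d l : ℕ} (hd : 0 < d) (g : (Fin d → ℝ) → ι → ℝ) (x₀ : Fin d → ℝ)
    (hg : ContDiffAt ℝ ((l + 1 : ℕ) : WithTop ℕ∞) g x₀)
    (hND : ∀ c : ι → ℝ, (∀ k ≤ l + 1, ∀ h, c ⬝ᵥ Tk k g x₀ h = 0) → c = 0) (τ : ℝ≥0∞) (hτ : 0 < τ) :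
    ∃ R : ℝ, 0 < R ∧ ∃ ε : ℝ, 0 < ε ∧ ∀ (x₁ : Fin d → ℝ) (r : ℝ), 0 < r → dist x₁ x₀ + r < R →
      ∃ κ : ℝ, 0 < κ ∧
      (∀ c : ι → ℝ, ∃ μ : ℝ, 0 ≤ μ ∧ κ * ‖c‖ ≤ μ ∧ (∀ y ∈ Metric.closedBall x₁ r, |c ⬝ᵥ g y| ≤ μ) ∧
        volume {y ∈ Metric.closedBall x₁ r | |c ⬝ᵥ g y| < ε * μ} ≤ τ * volume (Metric.closedBall x₁ r)) ∧
      (∀ c c' : ι → ℝ, ∃ μ : ℝ, 0 ≤ μ ∧ (∀ i j, κ * |c i * c' j - c j * c' i| ≤ μ) ∧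
        (∀ s, ∀ y ∈ Metric.closedBall x₁ r, |Sg g s c c' y| ≤ μ) ∧
        ∃ s, volume {y ∈ Metric.closedBall x₁ r | |Sg g s c c' y| < ε * μ} ≤
          τ * volume (Metric.closedBall x₁ r)) := by
  set Q := Metric.closedBall (0 : Fin d → ℝ) 1 with hQ
  have hQc : IsCompact Q := isCompact_closedBall _ _
  have hQpos : 0 < volume Q := (Metric.measure_closedBall_pos _ _ one_pos)
  have hτQ : 0 < τ * volume Q := ENNReal.mul_pos hτ.ne' hQpos.ne'
  obtain ⟨C, hC0, hC⟩ := bv_bound d (l + 1)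
  obtain ⟨ε₁, hε₁, h1⟩ := compact_small (ι := Unit) (Metric.sphere (0 : Ix d (l + 1) → ℝ) 1)
    (isCompact_sphere _ _) Q hQc (fun _ a u => pa a u) (fun _ => pa_cont d (l + 1)) (by
      intro a ha
      refine ⟨(), measure_mono_null (fun u hu => hu.2) ?_⟩
      have : ∃ u, pa a u ≠ 0 := by
        by_contra hcon
        push Not at hcon
        have := pa_eq_zero a hcon
        rw [this] at ha; simp at ha
      obtain ⟨u, hu⟩ := this
      exact null_of_analytic _ (pa_analytic a) u hu) _ hτQ
  let K2 : Set ((Ix d (l + 1) → ℝ) × (Ix d (l + 1) → ℝ)) :=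
    (Metric.sphere 0 1 ×ˢ Metric.sphere 0 1) ∩ {p | p.1 ⬝ᵥ p.2 = 0}
  have hK2 : IsCompact K2 := by
    refine ((isCompact_sphere _ _).prod (isCompact_sphere _ _)).inter_right ?_
    refine isClosed_eq ?_ continuous_const
    unfold dotProduct; fun_prop
  obtain ⟨ε₂, hε₂, h2⟩ := compact_small (ι := Fin d) K2 hK2 Q hQc (fun s p u => Phs s p.1 p.2 u)
    (fun s => by
      unfold Phs
      have e1 : Continuous (fun p : ((Ix d (l + 1) → ℝ) × (Ix d (l + 1) → ℝ)) × (Fin d → ℝ) => (p.1.1, p.2)) := by fun_prop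
      have e2 : Continuous (fun p : ((Ix d (l + 1) → ℝ) × (Ix d (l + 1) → ℝ)) × (Fin d → ℝ) => (p.1.2, p.2)) := by fun_prop
      exact (((pa_cont d (l + 1)).comp e1).mul ((pa_fderiv_cont d (l + 1) s).comp e2)).sub
        (((pa_cont d (l + 1)).comp e2).mul ((pa_fderiv_cont d (l + 1) s).comp e1)))
    (by
      rintro ⟨a, a'⟩ ⟨⟨ha, ha'⟩, horth⟩
      have hane : a ≠ 0 := by rintro rfl; simp at ha
      have : ∃ s u, Phs s a a' u ≠ 0 := by
        by_contra hcon
        push Not at hcon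
        obtain ⟨κ, hκ⟩ := Phs_prop a a' hane hcon
        simp only [mem_ofPred_eq] at horth
        rw [hκ, dotProduct_smul, smul_eq_mul] at horth
        rcases mul_eq_zero.mp horth with h | h
        · rw [hκ, h] at ha'; simp at ha'
        · exact hane (dotProduct_self_eq_zero.mp h)
      obtain ⟨s, u, hu⟩ := this
      exact ⟨s, measure_mono_null (fun u hu => hu.2) (null_of_analytic _ (Phs_analytic s a a') u hu)⟩) _ hτQ
  set D : ℝ := 2 * C ^ 2 + 2 * (2 * C + 1) with hD
  have hD0 : 0 < D := by positivity
  set η : ℝ := min 1 (min (ε₁ / 2) (ε₂ / (4 * (2 * C + 1)))) with hη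
  have hη0 : 0 < η := by positivity
  have hη1 : η ≤ 1 := min_le_left _ _
  have hηε₁ : η ≤ ε₁ / 2 := (min_le_right _ _).trans (min_le_left _ _)
  have hηε₂ : η ≤ ε₂ / (4 * (2 * C + 1)) := (min_le_right _ _).trans (min_le_right _ _)
  obtain ⟨R, hR, hap⟩ := approx_poly g x₀ hg hND η hη0
  set ε : ℝ := min (ε₁ / (2 * (C + 1))) (ε₂ / (2 * D)) with hε
  have hε0 : 0 < ε := by positivity
  have hεa : ε * (C + 1) ≤ ε₁ / 2 := by
    calc ε * (C + 1) ≤ (ε₁ / (2 * (C + 1))) * (C + 1) := by gcongr; exact min_le_left _ _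
      _ = ε₁ / 2 := by field_simp
  have hεb : ε * D ≤ ε₂ / 2 := by
    calc ε * D ≤ (ε₂ / (2 * D)) * D := by gcongr; exact min_le_right _ _
      _ = ε₂ / 2 := by field_simp
  refine ⟨R, hR, ε, hε0, fun x₁ r hr hx => ?_⟩
  obtain ⟨a, hinj, ha⟩ := hap x₁ r hr hx
  obtain ⟨κ₀, hκ₀, hanti⟩ : ∃ κ₀ : ℝ, 0 < κ₀ ∧ ∀ c, κ₀ * ‖c‖ ≤ ‖a c‖ := by
    obtain ⟨K, hK, h⟩ := a.exists_antilipschitzWith (LinearMap.ker_eq_bot.mpr hinj)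
    refine ⟨(K : ℝ)⁻¹, by positivity, fun c => ?_⟩
    have := h.le_mul_dist c 0
    simp only [dist_zero_right, map_zero] at this
    rw [inv_mul_le_iff₀ (by positivity)]
    exact this
  have hball : ∀ y ∈ Metric.closedBall x₁ r, ∃ u : Fin d → ℝ, ‖u‖ ≤ 1 ∧ y = x₁ + r • u := by
    intro y hy
    refine ⟨r⁻¹ • (y - x₁), ?_, by simp [smul_smul, hr.ne']⟩
    rw [Metric.mem_closedBall, dist_eq_norm] at hy
    rw [norm_smul, norm_inv, Real.norm_of_nonneg hr.le, inv_mul_le_iff₀ hr]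
    simpa using hy
  refine ⟨min κ₀ (κ₀ ^ 2 / 2 * (D / r)), by positivity, ?_, ?_⟩
  · intro c
    have hCa : 0 ≤ C * ‖a c‖ := by positivity
    refine ⟨(C + 1) * ‖a c‖, by positivity, ?_, ?_, ?_⟩
    · have h3 : min κ₀ (κ₀ ^ 2 / 2 * (D / r)) * ‖c‖ ≤ κ₀ * ‖c‖ := by
        gcongr; exact min_le_left _ _
      have := hanti c
      linarith
    · intro y hy
      obtain ⟨u, hu, rfl⟩ := hball y hy
      have e1 := (ha c u hu).1
      have e2 := (hC (a c) u hu).1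
      have e3 : |c ⬝ᵥ g (x₁ + r • u)| ≤ |c ⬝ᵥ g (x₁ + r • u) - pa (a c) u| + |pa (a c) u| := by
        simpa using abs_add_le (c ⬝ᵥ g (x₁ + r • u) - pa (a c) u) (pa (a c) u)
      have e4 : η * ‖a c‖ ≤ 1 * ‖a c‖ := by gcongr
      linarith
    · apply scale_vol x₁ r hr
      by_cases hc : a c = 0
      · simp only [hc, norm_zero, mul_zero]
        rw [show {u ∈ Metric.closedBall (0 : Fin d → ℝ) 1 | |c ⬝ᵥ g (x₁ + r • u)| < 0} = ∅ from
          Set.eq_empty_of_forall_notMem (fun u hu => absurd hu.2 (not_lt.mpr (abs_nonneg (_ : ℝ))))]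
        simp
      · have hpos : 0 < ‖a c‖ := norm_pos_iff.mpr hc
        obtain ⟨-, h3⟩ := h1 (‖a c‖⁻¹ • a c) (by simp [norm_smul, hpos.ne'])
        refine le_trans (measure_mono ?_) h3
        rintro u ⟨huQ, hu⟩
        refine ⟨huQ, ?_⟩
        have hu1 : ‖u‖ ≤ 1 := by simpa using huQ
        have e1 := (ha c u hu1).1
        rw [pa_smul, abs_mul, abs_inv, abs_norm, inv_mul_le_iff₀ hpos]
        have e3 : |pa (a c) u| ≤ |c ⬝ᵥ g (x₁ + r • u) - pa (a c) u| + |c ⬝ᵥ g (x₁ + r • u)| := by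
          rw [abs_sub_comm]
          simpa using abs_add_le (pa (a c) u - c ⬝ᵥ g (x₁ + r • u)) (c ⬝ᵥ g (x₁ + r • u))
        have e4 : ε * (C + 1) * ‖a c‖ ≤ ε₁ / 2 * ‖a c‖ := by gcongr
        have e5 : η * ‖a c‖ ≤ ε₁ / 2 * ‖a c‖ := by gcongr
        nlinarith
  · intro c c'
    -- reduce to orthogonal pair
    set t : ℝ := (a c ⬝ᵥ a c') / (a c ⬝ᵥ a c) with ht
    set c2 : ι → ℝ := c' - t • c with hc2
    have hS : ∀ s y, Sg g s c c' y = Sg g s c c2 y := by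
      intro s y
      simp only [Sg, hc2, sub_dotProduct, smul_dotProduct, smul_eq_mul]; ring
    have hminor : ∀ i j, c i * c' j - c j * c' i = c i * c2 j - c j * c2 i := by
      intro i j; simp only [hc2, Pi.sub_apply, Pi.smul_apply, smul_eq_mul]; ring
    have hcn : ∀ i j, min κ₀ (κ₀ ^ 2 / 2 * (D / r)) * |c i * c' j - c j * c' i| ≤ D / r * (‖a c‖ * ‖a c2‖) := by
      intro i j
      rw [hminor]
      have e1 : |c i * c2 j - c j * c2 i| ≤ 2 * (‖c‖ * ‖c2‖) := by
        have f1 : |c i * c2 j| ≤ ‖c‖ * ‖c2‖ := by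
          rw [abs_mul]; exact mul_le_mul (norm_le_pi_norm c i) (norm_le_pi_norm c2 j) (abs_nonneg _) (norm_nonneg _)
        have f2 : |c j * c2 i| ≤ ‖c‖ * ‖c2‖ := by
          rw [abs_mul]; exact mul_le_mul (norm_le_pi_norm c j) (norm_le_pi_norm c2 i) (abs_nonneg _) (norm_nonneg _)
        have := abs_sub (c i * c2 j) (c j * c2 i)
        linarith
      have e2 : (κ₀ * ‖c‖) * (κ₀ * ‖c2‖) ≤ ‖a c‖ * ‖a c2‖ :=
        mul_le_mul (hanti c) (hanti c2) (by positivity) (by positivity)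
      calc min κ₀ (κ₀ ^ 2 / 2 * (D / r)) * |c i * c2 j - c j * c2 i|
          ≤ (κ₀ ^ 2 / 2 * (D / r)) * (2 * (‖c‖ * ‖c2‖)) := by
            gcongr; exact min_le_right _ _
        _ = D / r * ((κ₀ * ‖c‖) * (κ₀ * ‖c2‖)) := by ring
        _ ≤ _ := by gcongr
    have herr : ∀ s u, ‖u‖ ≤ 1 → |r * Sg g s c c2 (x₁ + r • u) - Phs s (a c) (a c2) u| ≤
        2 * η * (2 * C + 1) * (‖a c‖ * ‖a c2‖) ∧ |Phs s (a c) (a c2) u| ≤ 2 * C ^ 2 * (‖a c‖ * ‖a c2‖) := by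
      intro s u hu
      obtain ⟨p1, p2⟩ := ha c u hu
      obtain ⟨q1, q2⟩ := ha c2 u hu
      obtain ⟨b1, b2, -⟩ := hC (a c) u hu
      obtain ⟨b1', b2', -⟩ := hC (a c2) u hu
      specialize p2 s
      specialize q2 s
      specialize b2 s
      specialize b2' s
      simp only [Sg, Phs]
      generalize c ⬝ᵥ g (x₁ + r • u) = X at *
      generalize c2 ⬝ᵥ g (x₁ + r • u) = X' at *
      generalize c ⬝ᵥ fderiv ℝ g (x₁ + r • u) (Pi.single s 1) = Y at *
      generalize c2 ⬝ᵥ fderiv ℝ g (x₁ + r • u) (Pi.single s 1) = Y' at *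
      generalize pa (a c) u = P at *
      generalize pa (a c2) u = P' at *
      generalize fderiv ℝ (pa (a c)) u (Pi.single s 1) = T at *
      generalize fderiv ℝ (pa (a c2)) u (Pi.single s 1) = T' at *
      exact herr_real η C ‖a c‖ ‖a c2‖ r X X' Y Y' P P' T T' hη0.le hη1 hC0.le (norm_nonneg _) (norm_nonneg _) p1 q1 p2 q2 b1 b1' b2 b2'
    have hrμ : r * (D / r * (‖a c‖ * ‖a c2‖)) = D * (‖a c‖ * ‖a c2‖) := by field_simp
    refine ⟨D / r * (‖a c‖ * ‖a c2‖), by positivity, hcn, ?_, ?_⟩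
    · intro s y hy
      obtain ⟨u, hu, rfl⟩ := hball y hy
      rw [hS]
      obtain ⟨e1, e2⟩ := herr s u hu
      have hαα : 0 ≤ ‖a c‖ * ‖a c2‖ := by positivity
      have e3 : |r * Sg g s c c2 (x₁ + r • u)| ≤ D * (‖a c‖ * ‖a c2‖) := by
        have e4 : 2 * η * (2 * C + 1) * (‖a c‖ * ‖a c2‖) ≤ 2 * 1 * (2 * C + 1) * (‖a c‖ * ‖a c2‖) := by gcongr
        rw [abs_le] at *
        constructor <;> nlinarith
      rw [abs_mul, abs_of_pos hr, ← hrμ] at e3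
      exact le_of_mul_le_mul_left e3 hr
    · by_cases h0 : ‖a c‖ * ‖a c2‖ = 0
      · refine ⟨⟨0, hd⟩, ?_⟩
        rw [h0]
        simp only [mul_zero]
        rw [show {y ∈ Metric.closedBall x₁ r | |Sg g ⟨0, hd⟩ c c' y| < 0} = ∅ from
          Set.eq_empty_of_forall_notMem (fun u hu => absurd hu.2 (not_lt.mpr (abs_nonneg (_ : ℝ))))]
        simp
      · have hpos1 : 0 < ‖a c‖ := lt_of_le_of_ne (norm_nonneg _) (fun h => h0 (by rw [← h, zero_mul]))
        have hpos2 : 0 < ‖a c2‖ := lt_of_le_of_ne (norm_nonneg _) (fun h => h0 (by rw [← h, mul_zero]))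
        have horth : a c ⬝ᵥ a c2 = 0 := by
          have hne : a c ⬝ᵥ a c ≠ 0 := fun h => (norm_pos_iff.mp hpos1) (dotProduct_self_eq_zero.mp h)
          rw [hc2, map_sub, map_smul, dotProduct_sub, dotProduct_smul, ht, smul_eq_mul]
          field_simp; ring
        obtain ⟨s, hs⟩ := h2 (‖a c‖⁻¹ • a c, ‖a c2‖⁻¹ • a c2) (by
          refine ⟨⟨?_, ?_⟩, ?_⟩
          · simp [norm_smul, hpos1.ne']
          · simp [norm_smul, hpos2.ne']
          · simp [smul_dotProduct, dotProduct_smul, horth])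
        refine ⟨s, ?_⟩
        apply scale_vol x₁ r hr
        refine le_trans (measure_mono ?_) hs
        rintro u ⟨huQ, hu⟩
        refine ⟨huQ, ?_⟩
        have hu1 : ‖u‖ ≤ 1 := by simpa using huQ
        obtain ⟨e1, e2⟩ := herr s u hu1
        rw [hS] at hu
        show |Phs s (‖a c‖⁻¹ • a c) (‖a c2‖⁻¹ • a c2) u| ≤ ε₂
        rw [Phs_smul, abs_mul, abs_of_pos (show 0 < ‖a c‖⁻¹ * ‖a c2‖⁻¹ by positivity), ← mul_inv,
          inv_mul_le_iff₀ (by positivity)]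
        have hu3 : |r * Sg g s c c2 (x₁ + r • u)| < ε * D * (‖a c‖ * ‖a c2‖) := by
          rw [abs_mul, abs_of_pos hr, mul_assoc, ← hrμ]
          rw [show ε * (r * (D / r * (‖a c‖ * ‖a c2‖))) = r * (ε * (D / r * (‖a c‖ * ‖a c2‖))) by ring]
          exact mul_lt_mul_of_pos_left hu hr
        have e4 : 2 * η * (2 * C + 1) * (‖a c‖ * ‖a c2‖) ≤ ε₂ / 2 * (‖a c‖ * ‖a c2‖) := by
          gcongr
          calc 2 * η * (2 * C + 1) ≤ 2 * (ε₂ / (4 * (2 * C + 1))) * (2 * C + 1) := by gcongr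
            _ = ε₂ / 2 := by field_simp; ring
        have e5 : ε * D * (‖a c‖ * ‖a c2‖) ≤ ε₂ / 2 * (‖a c‖ * ‖a c2‖) := by gcongr
        have e6 : |Phs s (a c) (a c2) u| ≤ |r * Sg g s c c2 (x₁ + r • u) - Phs s (a c) (a c2) u| +
            |r * Sg g s c c2 (x₁ + r • u)| := by
          rw [abs_sub_comm]
          simpa using abs_add_le (Phs s (a c) (a c2) u - r * Sg g s c c2 (x₁ + r • u)) (r * Sg g s c c2 (x₁ + r • u))
        linarith

def gof {d n : ℕ} (f : (Fin d → ℝ) → Fin n → ℝ) (x : Fin d → ℝ) : Fin (n + 1) → ℝ := Fin.cons 1 (f x)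

lemma gof_cd {d n : ℕ} (f : (Fin d → ℝ) → Fin n → ℝ) (x : Fin d → ℝ) (k : WithTop ℕ∞)
    (hf : ContDiffAt ℝ k f x) : ContDiffAt ℝ k (gof f) x := by
  rw [contDiffAt_pi] at hf ⊢
  intro i
  refine Fin.cases ?_ (fun j => ?_) i
  · simp only [gof, Fin.cons_zero]; exact contDiffAt_const
  · simpa only [gof, Fin.cons_succ] using hf j

lemma gof_dot {d n : ℕ} (f : (Fin d → ℝ) → Fin n → ℝ) (x : Fin d → ℝ) (c : Fin (n + 1) → ℝ) :
    c ⬝ᵥ gof f x = c 0 + Fin.tail c ⬝ᵥ f x := by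
  simp [dotProduct, Fin.sum_univ_succ, gof, Fin.tail]

lemma listPDeriv_append {d n : ℕ} (β : List (Fin d)) (i : Fin d) (f : (Fin d → ℝ) → Fin n → ℝ) :
    listPDeriv (β ++ [i]) f = listPDeriv β (fun x => fderiv ℝ f x (Pi.single i 1)) := by
  induction β with
  | nil => rfl
  | cons j β ih => simp only [List.cons_append, listPDeriv, ih]

lemma polar {d n : ℕ} (x₀ : Fin d → ℝ) (c : Fin n → ℝ) (k : ℕ) :
    ∀ (f : (Fin d → ℝ) → Fin n → ℝ), ContDiffAt ℝ (k : WithTop ℕ∞) f x₀ →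
    (∀ h, c ⬝ᵥ Tk k f x₀ h = 0) → ∀ β : List (Fin d), β.length = k → c ⬝ᵥ listPDeriv β f x₀ = 0 := by
  induction k with
  | zero =>
    intro f hf h β hβ
    rw [List.length_eq_zero_iff] at hβ
    subst hβ
    exact h 0
  | succ k ih =>
    intro f hf h β hβ
    rcases List.eq_nil_or_concat β with rfl | ⟨β', i, rfl⟩
    · simp at hβ
    rw [List.concat_eq_append, listPDeriv_append]
    have hl : β'.length = k := by simpa using hβ
    let ev : ((Fin d → ℝ) →L[ℝ] (Fin n → ℝ)) →L[ℝ] (Fin n → ℝ) :=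
      ContinuousLinearMap.apply ℝ (Fin n → ℝ) (Pi.single i 1)
    refine ih (fun x => fderiv ℝ f x (Pi.single i 1)) ?_ ?_ β' hl
    · exact ev.contDiff.contDiffAt.comp x₀ (cd_fderiv hf)
    · intro v
      have e1 : Tk k (fun x => fderiv ℝ f x (Pi.single i 1)) x₀ v = Tk k (fderiv ℝ f) x₀ v (Pi.single i 1) :=
        Tk_comp k ev (fderiv ℝ f) x₀ v (cd_fderiv hf)
      rw [e1]
      have e2 := ((dotL c).hasFDerivAt.comp v (Tk_deriv k f x₀ v hf))
      have e3 : (⇑(dotL c) ∘ fun h => Tk (k + 1) f x₀ h) = fun _ => 0 := by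
        funext w; simp only [Function.comp, dotL_apply, h]
      rw [e3] at e2
      have e4 := e2.unique (hasFDerivAt_const (0 : ℝ) v)
      have e5 := congrArg (fun L => L (Pi.single i 1)) e4
      simp only [ContinuousLinearMap.comp_apply, _root_.smul_apply, _root_.zero_apply, map_smul, dotL_apply, smul_eq_mul] at e5
      rcases mul_eq_zero.mp e5 with h6 | h6
      · exfalso; have : (0 : ℝ) ≤ k := by positivity
        linarith
      · exact h6

lemma nd_setup {d n : ℕ} (hdn : d < n) (f : (Fin d → ℝ) → Fin n → ℝ) (x₀ : Fin d → ℝ)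
    (h : IsNondegenerateAt f x₀) :
    ∃ l : ℕ, ContDiffAt ℝ ((l + 2 : ℕ) : WithTop ℕ∞) f x₀ ∧
      ∀ c : Fin (n + 1) → ℝ, (∀ k ≤ l + 2, ∀ h, c ⬝ᵥ Tk k (gof f) x₀ h = 0) → c = 0 := by
  obtain ⟨l, ⟨V, hV, hcd⟩, hsp⟩ := h
  have hcd' : ContDiffAt ℝ (l : WithTop ℕ∞) f x₀ := hcd.contDiffAt hV
  have hl2 : 2 ≤ l := by
    by_contra hl
    have hle : ⊤ ≤ Submodule.span ℝ (range fun i : Fin d => listPDeriv [i] f x₀) := by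
      rw [← hsp]
      apply Submodule.span_mono
      rintro v ⟨β, h1, h2, rfl⟩
      obtain ⟨i, rfl⟩ := List.length_eq_one_iff.mp (show β.length = 1 by omega)
      exact ⟨i, rfl⟩
    have h1 := finrank_range_le_card (R := ℝ) (fun i : Fin d => listPDeriv [i] f x₀)
    rw [Set.finrank, top_le_iff.mp hle] at h1
    simp at h1
    omega
  obtain ⟨l, rfl⟩ : ∃ l', l = l' + 2 := ⟨l - 2, by omega⟩
  refine ⟨l, hcd', fun c hc => ?_⟩
  have htail : Fin.tail c = 0 := by
    have hann : ∀ v ∈ Submodule.span ℝ {v : Fin n → ℝ | ∃ β : List (Fin d),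
        1 ≤ β.length ∧ β.length ≤ l + 2 ∧ v = listPDeriv β f x₀}, Fin.tail c ⬝ᵥ v = 0 := by
      intro v hv
      induction hv using Submodule.span_induction with
      | mem v hv =>
        obtain ⟨β, h1, h2, rfl⟩ := hv
        obtain ⟨k, hk⟩ : ∃ k, β.length = k + 1 := ⟨β.length - 1, by omega⟩
        have hcdk : ContDiffAt ℝ ((k + 1 : ℕ) : WithTop ℕ∞) f x₀ := hcd'.of_le (by exact_mod_cast (by omega : k + 1 ≤ l + 2))
        refine polar x₀ (Fin.tail c) (k + 1) f hcdk (fun w => ?_) β hk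
        have e1 := hc (k + 1) (by omega) w
        rw [← dotL_apply, ← Tk_comp (k + 1) (dotL c) (gof f) x₀ w (gof_cd f x₀ _ hcdk)] at e1
        rw [← dotL_apply, ← Tk_comp (k + 1) (dotL (Fin.tail c)) f x₀ w hcdk, ← e1]
        simp only [Tk, dotL_apply, gof_dot]
        rw [show (fderiv ℝ fun y => c 0 + Fin.tail c ⬝ᵥ f y) = fderiv ℝ (fun y => Fin.tail c ⬝ᵥ f y) from
          funext fun y => fderiv_const_add _]
      | zero => simp
      | add x y _ _ hx hy => rw [dotProduct_add, hx, hy, add_zero]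
      | smul a x _ hx => rw [dotProduct_smul, hx, smul_zero]
    exact dotProduct_self_eq_zero.mp (hann _ (by rw [hsp]; trivial))
  have h0 := hc 0 (by omega) 0
  simp only [Tk, gof_dot, htail, zero_dotProduct, add_zero] at h0
  funext i
  refine Fin.cases h0 (fun j => ?_) i
  exact congrFun htail j

lemma vol_cb {d : ℕ} (x y : Fin d → ℝ) (r : ℝ) (k : ℕ) (hr : 0 ≤ r) :
    volume (Metric.closedBall x (k * r)) = (k : ℝ≥0∞) ^ d * volume (Metric.closedBall y r) := by
  rw [Real.volume_pi_closedBall _ (by positivity), Real.volume_pi_closedBall _ hr, Fintype.card_fin,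
    ENNReal.ofReal_pow (by positivity), ENNReal.ofReal_pow (by positivity), ← mul_pow]
  congr 1
  rw [show (2 * (k * r) : ℝ) = k * (2 * r) by ring, ENNReal.ofReal_mul (by positivity), ENNReal.ofReal_natCast]

def Prot {X P : Type*} [PartialOrder P] (ψ : P → X → ℝ) (ε₀ : ℝ) (S : Set P) (z : X) : Prop :=
  ∃ F : Set P, F ⊆ S ∧ (∀ s ∈ F, ∀ t ∈ F, s ≤ t ∨ t ≤ s) ∧ (∀ s ∈ F, ε₀ ≤ ψ s z ∧ ψ s z ≤ 1) ∧
    ∀ s ∈ S, s ∉ F → (∀ t ∈ F, s ≤ t ∨ t ≤ s) → 1 ≤ ψ s z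

def Kn (N d : ℕ) : ℕ → ℕ
  | 0 => 0
  | j + 1 => N * 6 ^ d * (1 + Kn N d j)

lemma nondiv {d N : ℕ} {τB : ℝ} (hτB : 1 < τB) (hN : IsEmpty (Besicovitch.SatelliteConfig (Fin d → ℝ) N τB))
    {P : Type*} [PartialOrder P] (rk : P → ℕ) (hrk : StrictMono rk) (ψ : P → (Fin d → ℝ) → ℝ)
    (x₀ : Fin d → ℝ) (R : ℝ) (ε₀ : ℝ) (τ : ℝ≥0∞) (S₀ : Set P)
    (hcont : ∀ s ∈ S₀, ContinuousOn (ψ s) (Metric.ball x₀ R))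
    (hgood : ∀ s ∈ S₀, ∀ c ρ, 0 < ρ → dist c x₀ + ρ < R → (∃ y ∈ Metric.closedBall c ρ, 1 ≤ ψ s y) →
      volume {y ∈ Metric.closedBall c ρ | ψ s y < ε₀} ≤ τ * volume (Metric.closedBall c ρ)) (j : ℕ) :
    ∀ S ⊆ S₀, ∀ D : Finset ℕ, D.card = j → (∀ s ∈ S, rk s ∈ D) → ∀ x r, 0 < r →
      dist x x₀ + 5 ^ j * r < R → (∀ s ∈ S, ∃ y ∈ Metric.closedBall x r, 1 ≤ ψ s y) →
      volume {z ∈ Metric.closedBall x r | ¬ Prot ψ ε₀ S z} ≤ (Kn N d j : ℝ≥0∞) * τ * volume (Metric.closedBall x r) := by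
  induction j with
  | zero =>
    intro S hS D hD hSD x r hr hx hy
    rw [Finset.card_eq_zero] at hD
    subst hD
    have : {z ∈ Metric.closedBall x r | ¬ Prot ψ ε₀ S z} = ∅ := by
      refine Set.eq_empty_of_forall_notMem (fun z hz => hz.2 ⟨∅, by simp, by simp, by simp, ?_⟩)
      intro s hs; exact absurd (hSD s hs) (by simp)
    rw [this]; simp
  | succ j ih =>
    intro S hS D hD hSD x r hr hx hy
    have h5 : (1 : ℝ) ≤ 5 ^ j := one_le_pow₀ (by norm_num)
    have h5' : (5 : ℝ) ^ (j + 1) * r = 5 * (5 ^ j * r) := by ring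
    have h5r : r ≤ 5 ^ j * r := by nlinarith
    let A : Set (Fin d → ℝ) := {y | y ∈ Metric.closedBall x r ∧ ∃ s ∈ S, ψ s y < 1}
    -- choice of radius
    have hchoice : ∀ y : A, ∃ ρ : ℝ, 0 < ρ ∧ ρ < 2 * r ∧ (∃ s ∈ S, ∀ z ∈ Metric.closedBall (y : Fin d → ℝ) ρ, ψ s z < 1) ∧
        (∀ s ∈ S, ∃ z ∈ Metric.closedBall (y : Fin d → ℝ) (2 * ρ), 1 ≤ ψ s z) := by
      rintro ⟨y, hyx, s, hs, hys⟩
      rw [Metric.mem_closedBall] at hyx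
      have hyR : y ∈ Metric.ball x₀ R := by
        rw [Metric.mem_ball]
        have := dist_triangle y x x₀
        linarith
      let RR : Set ℝ := {ρ | 0 < ρ ∧ ∃ s ∈ S, ∀ z ∈ Metric.closedBall y ρ, ψ s z < 1}
      have hbd : ∀ ρ ∈ RR, ρ < 2 * r := by
        rintro ρ ⟨hρ, s', hs', hz⟩
        by_contra hcon
        push Not at hcon
        obtain ⟨w, hw, hw1⟩ := hy s' hs'
        refine absurd (hz w ?_) (not_lt.mpr hw1)
        rw [Metric.mem_closedBall] at hw ⊢
        have := dist_triangle_right w y x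
        linarith
      have hne : RR.Nonempty := by
        have hc : ContinuousAt (ψ s) y := (hcont s (hS hs)).continuousAt (Metric.isOpen_ball.mem_nhds hyR)
        have hev : ∀ᶠ z in nhds y, ψ s z < 1 := hc.eventually_lt continuousAt_const hys
        obtain ⟨ρ, hρ, h⟩ := Metric.nhds_basis_closedBall.eventually_iff.mp hev
        exact ⟨ρ, hρ, s, hs, fun z hz => h hz⟩
      have hBA : BddAbove RR := ⟨2 * r, fun ρ hρ => (hbd ρ hρ).le⟩
      have hsup : 0 < sSup RR := by
        obtain ⟨ρ, hρ⟩ := hne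
        exact hρ.1.trans_le (le_csSup hBA hρ)
      obtain ⟨ρ, hρ, hlt⟩ := exists_lt_of_lt_csSup hne (show sSup RR / 2 < sSup RR by linarith)
      refine ⟨ρ, hρ.1, hbd ρ hρ, hρ.2, fun s' hs' => ?_⟩
      by_contra hcon
      push Not at hcon
      have : 2 * ρ ∈ RR := ⟨by linarith [hρ.1], s', hs', hcon⟩
      have := le_csSup hBA this
      linarith
    choose ρ hρ0 hρr hρs hρ2 using hchoice
    choose s hsS hs1 using hρs
    let q : Besicovitch.BallPackage A (Fin d → ℝ) :=
      { c := fun y => y, r := ρ, rpos := hρ0, r_bound := 2 * r, r_le := fun y => (hρr y).le }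
    obtain ⟨fam, hdisj, hcov⟩ := Besicovitch.exist_disjoint_covering_families hτB hN q
    let Un : Set (Fin d → ℝ) := {z ∈ Metric.closedBall x r | ¬ Prot ψ ε₀ S z}
    -- local estimate
    have hloc : ∀ y : A, volume (Un ∩ Metric.closedBall (y : Fin d → ℝ) (ρ y)) ≤
        ((1 + Kn N d j : ℕ) : ℝ≥0∞) * τ * 2 ^ d * volume (Metric.closedBall (y : Fin d → ℝ) (ρ y)) := by
      intro y
      have hyx : dist (y : Fin d → ℝ) x ≤ r := y.2.1
      have htri := dist_triangle (y : Fin d → ℝ) x x₀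
      have hR1 : dist (y : Fin d → ℝ) x₀ + 5 ^ j * (2 * ρ y) < R := by
        have : 5 ^ j * (2 * ρ y) ≤ 5 ^ j * (2 * (2 * r)) := by
          have := hρr y
          gcongr
        linarith
      have hR2 : dist (y : Fin d → ℝ) x₀ + 2 * ρ y < R := by
        have : 1 * (2 * ρ y) ≤ 5 ^ j * (2 * ρ y) := by
          have := (hρ0 y).le
          gcongr
        linarith
      let S' : Set P := {t ∈ S | t ≠ s y ∧ (t ≤ s y ∨ s y ≤ t)}
      have hS'S : S' ⊆ S := fun t ht => ht.1
      have h1 := ih S' (hS'S.trans hS) (D.erase (rk (s y)))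
        (by rw [Finset.card_erase_of_mem (hSD _ (hsS y)), hD]; rfl)
        (by
          rintro t ⟨htS, hne, hcmp⟩
          refine Finset.mem_erase.mpr ⟨?_, hSD t htS⟩
          rcases hcmp with h | h
          · exact (hrk (lt_of_le_of_ne h hne)).ne
          · exact (hrk (lt_of_le_of_ne h hne.symm)).ne')
        (y : Fin d → ℝ) (2 * ρ y) (by linarith [hρ0 y]) hR1 (fun t ht => hρ2 y t ht.1)
      have h2 := hgood (s y) (hS (hsS y)) (y : Fin d → ℝ) (2 * ρ y) (by linarith [hρ0 y]) hR2 (hρ2 y _ (hsS y))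
      have hvol : volume (Metric.closedBall (y : Fin d → ℝ) (2 * ρ y)) = 2 ^ d * volume (Metric.closedBall (y : Fin d → ℝ) (ρ y)) := by
        have := vol_cb (y : Fin d → ℝ) (y : Fin d → ℝ) (ρ y) 2 (hρ0 y).le
        exact_mod_cast this
      calc volume (Un ∩ Metric.closedBall (y : Fin d → ℝ) (ρ y))
          ≤ volume ({z ∈ Metric.closedBall (y : Fin d → ℝ) (2 * ρ y) | ψ (s y) z < ε₀} ∪
              {z ∈ Metric.closedBall (y : Fin d → ℝ) (2 * ρ y) | ¬ Prot ψ ε₀ S' z}) := by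
            apply measure_mono
            rintro z ⟨⟨hzx, hz⟩, hzy⟩
            have hz2 : z ∈ Metric.closedBall (y : Fin d → ℝ) (2 * ρ y) :=
              Metric.closedBall_subset_closedBall (by linarith [hρ0 y]) hzy
            by_contra hcon
            rw [Set.mem_union, not_or] at hcon
            have c1 : ε₀ ≤ ψ (s y) z := by
              by_contra h; exact hcon.1 ⟨hz2, not_le.mp h⟩
            have c2 : Prot ψ ε₀ S' z := by
              by_contra h; exact hcon.2 ⟨hz2, h⟩
            apply hz
            obtain ⟨F, hFS, hch, hF1, hF2⟩ := c2
            refine ⟨insert (s y) F, ?_, ?_, ?_, ?_⟩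
            · rintro t (rfl | ht)
              · exact hsS y
              · exact hS'S (hFS ht)
            · rintro t (rfl | ht) t' (rfl | ht')
              · exact Or.inl le_rfl
              · exact (hFS ht').2.2.symm
              · exact (hFS ht).2.2
              · exact hch t ht t' ht'
            · rintro t (rfl | ht)
              · exact ⟨c1, (hs1 y z hzy).le⟩
              · exact hF1 t ht
            · intro t htS htF hcmp
              rw [Set.mem_insert_iff, not_or] at htF
              exact hF2 t ⟨htS, htF.1, hcmp _ (Set.mem_insert _ _)⟩ htF.2
                (fun u hu => hcmp u (Set.mem_insert_of_mem _ hu))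
        _ ≤ τ * volume (Metric.closedBall (y : Fin d → ℝ) (2 * ρ y)) +
            (Kn N d j : ℝ≥0∞) * τ * volume (Metric.closedBall (y : Fin d → ℝ) (2 * ρ y)) :=
          (measure_union_le _ _).trans (add_le_add h2 h1)
        _ = _ := by rw [hvol]; push_cast; ring
    have hcount : ∀ i, (fam i).Countable := fun i => by
      refine (hdisj i).countable_of_nonempty_interior (fun y _ => ?_)
      exact ⟨_, Metric.ball_subset_interior_closedBall (Metric.mem_ball_self (hρ0 y))⟩
    have hfam : ∀ i, volume (⋃ y ∈ fam i, Un ∩ Metric.closedBall (y : Fin d → ℝ) (ρ y)) ≤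
        ((1 + Kn N d j : ℕ) : ℝ≥0∞) * τ * 6 ^ d * volume (Metric.closedBall x r) := by
      intro i
      calc volume (⋃ y ∈ fam i, Un ∩ Metric.closedBall (y : Fin d → ℝ) (ρ y))
          ≤ ∑' y : fam i, volume (Un ∩ Metric.closedBall (y : Fin d → ℝ) (ρ y)) :=
            measure_biUnion_le _ (hcount i) _
        _ ≤ ∑' y : fam i, ((1 + Kn N d j : ℕ) : ℝ≥0∞) * τ * 2 ^ d * volume (Metric.closedBall (y : Fin d → ℝ) (ρ y)) :=
            ENNReal.tsum_le_tsum (fun y => hloc y)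
        _ = ((1 + Kn N d j : ℕ) : ℝ≥0∞) * τ * 2 ^ d * volume (⋃ y ∈ fam i, Metric.closedBall (y : Fin d → ℝ) (ρ y)) := by
            rw [ENNReal.tsum_mul_left, measure_biUnion (hcount i) (hdisj i) (fun y _ => measurableSet_closedBall)]
        _ ≤ ((1 + Kn N d j : ℕ) : ℝ≥0∞) * τ * 2 ^ d * volume (Metric.closedBall x ((3 : ℕ) * r)) := by
            gcongr
            refine Set.iUnion₂_subset (fun y _ => ?_)
            apply Metric.closedBall_subset_closedBall'
            have : dist (y : Fin d → ℝ) x ≤ r := y.2.1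
            have := hρr y
            push_cast
            linarith
        _ = _ := by
            rw [vol_cb x x r 3 hr.le, show (6 : ℝ≥0∞) = 2 * 3 by norm_num, mul_pow]
            push_cast; ring
    have hsub : Un ⊆ ⋃ i, ⋃ y ∈ fam i, Un ∩ Metric.closedBall (y : Fin d → ℝ) (ρ y) := by
      intro z hz
      have hzA : z ∈ A := by
        refine ⟨hz.1, ?_⟩
        by_contra hcon
        push Not at hcon
        exact hz.2 ⟨∅, by simp, by simp, by simp, fun t ht _ _ => hcon t ht⟩
      have := hcov ⟨⟨z, hzA⟩, rfl⟩
      simp only [Set.mem_iUnion] at this ⊢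
      obtain ⟨i, y, hy, hzy⟩ := this
      exact ⟨i, y, hy, hz, Metric.ball_subset_closedBall hzy⟩
    calc volume Un ≤ ∑ i : Fin N, volume (⋃ y ∈ fam i, Un ∩ Metric.closedBall (y : Fin d → ℝ) (ρ y)) :=
          (measure_mono hsub).trans (measure_iUnion_fintype_le _ _)
      _ ≤ ∑ i : Fin N, ((1 + Kn N d j : ℕ) : ℝ≥0∞) * τ * 6 ^ d * volume (Metric.closedBall x r) :=
          Finset.sum_le_sum (fun i _ => hfam i)
      _ = _ := by
        rw [Finset.sum_const, Finset.card_univ, Fintype.card_fin, nsmul_eq_mul, Kn]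
        push_cast; ring

lemma plu_aux {k : ℕ} (M : Fin k → Fin k → ℝ) {a₀ a₁ : Fin k} (ha : a₀ ≠ a₁) :
    ∃ lam mu : Fin k → ℝ, ∀ ξ ζ : Fin k → ℝ,
      Matrix.detRowAlternating (Function.update (Function.update M a₀ ξ) a₁ ζ) =
        (lam ⬝ᵥ ξ) * (mu ⬝ᵥ ζ) - (mu ⬝ᵥ ξ) * (lam ⬝ᵥ ζ) := by
  set F : (Fin k → ℝ) [⋀^Fin k]→ₗ[ℝ] ℝ := Matrix.detRowAlternating with hF
  by_cases hz : ∀ ξ ζ : Fin k → ℝ, F (Function.update (Function.update M a₀ ξ) a₁ ζ) = 0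
  · exact ⟨0, 0, fun ξ ζ => by simp [hz]⟩
  push Not at hz
  obtain ⟨u, w, huw⟩ := hz
  set A : Fin k → Fin k → ℝ := Function.update (Function.update M a₀ u) a₁ w with hA
  have hA' : IsUnit (Matrix.det (Matrix.of A)) := isUnit_iff_ne_zero.mpr huw
  set B := (Matrix.of A)⁻¹ with hB
  refine ⟨F A • fun i => B i a₀, fun i => B i a₁, fun ξ ζ => ?_⟩
  have hexp : ∀ ξ : Fin k → ℝ, ξ = ∑ a, ((fun i => B i a) ⬝ᵥ ξ) • A a := by
    intro ξ
    have h1 : Matrix.vecMul (Matrix.vecMul ξ B) (Matrix.of A) = ξ := by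
      rw [Matrix.vecMul_vecMul, hB, Matrix.nonsing_inv_mul _ hA', Matrix.vecMul_one]
    conv_lhs => rw [← h1, Matrix.vecMul_eq_sum]
    refine Finset.sum_congr rfl (fun a _ => ?_)
    rw [dotProduct_comm]; rfl
  have hone : ∀ (a : Fin k) (ξ : Fin k → ℝ), F (Function.update A a ξ) = ((fun i => B i a) ⬝ᵥ ξ) * F A := by
    intro a ξ
    conv_lhs => rw [hexp ξ]
    exact Matrix.det_updateRow_sum (Matrix.of A) a _
  have hMA : Function.update (Function.update M a₀ ξ) a₁ ζ = Function.update (Function.update A a₀ ξ) a₁ ζ := by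
    funext a
    by_cases h1 : a = a₁
    · subst h1; simp
    · by_cases h0 : a = a₀
      · subst h0; simp [h1]
      · simp [h1, h0, hA]
  have hA1 : Function.update (Function.update A a₀ ξ) a₁ (A a₁) = Function.update A a₀ ξ := by
    funext a
    by_cases h1 : a = a₁
    · subst h1; simp [ha.symm]
    · simp [h1]
  have hA0 : F (Function.update (Function.update A a₀ ξ) a₁ (A a₀)) = - F (Function.update A a₁ ξ) := by
    rw [← F.map_swap _ ha]
    congr 1
    funext a
    simp only [Function.comp]
    by_cases h1 : a = a₁
    · subst h1; simp [ha]
    · by_cases h0 : a = a₀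
      · subst h0; simp [ha]
      · rw [Equiv.swap_apply_of_ne_of_ne h0 h1]; simp [h1, h0]
  rw [hMA]
  conv_lhs => rw [hexp ζ]
  rw [F.map_update_sum, Finset.sum_eq_add a₀ a₁ ha]
  · rw [F.map_update_smul, F.map_update_smul, hA1, hA0, hone, hone]
    simp only [smul_dotProduct, smul_eq_mul]; ring
  · intro a _ hne
    rw [F.map_update_smul, F.map_eq_zero_of_eq (i := a) (j := a₁) _ _ hne.2, smul_zero]
    simp [hne.1, hne.2]
  · simp
  · simp

/-- `Gd v ρ = det (ρ a ⬝ v b)`. -/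
noncomputable def Gd {ι : Type} [Fintype ι] {k : ℕ} (v : Fin k → ι → ℝ) : (ι → ℝ) [⋀^Fin k]→ₗ[ℝ] ℝ :=
  Matrix.detRowAlternating.compLinearMap (LinearMap.pi fun b => (dotL (v b)).toLinearMap)

lemma Gd_apply {ι : Type} [Fintype ι] {k : ℕ} (v : Fin k → ι → ℝ) (ρ : Fin k → ι → ℝ) :
    Gd v ρ = Matrix.det (Matrix.of fun a b => v b ⬝ᵥ ρ a) := by
  rfl

lemma Gd_update {ι : Type} [Fintype ι] {k : ℕ} (v : Fin k → ι → ℝ) (ρ : Fin k → ι → ℝ) {a₀ a₁ : Fin k}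
    (ha : a₀ ≠ a₁) : ∃ c c' : ι → ℝ, ∀ ξ ζ : ι → ℝ,
      Gd v (Function.update (Function.update ρ a₀ ξ) a₁ ζ) =
        (c ⬝ᵥ ξ) * (c' ⬝ᵥ ζ) - (c' ⬝ᵥ ξ) * (c ⬝ᵥ ζ) := by
  obtain ⟨lam, mu, h⟩ := plu_aux (fun a b => v b ⬝ᵥ ρ a) ha
  have hl : ∀ (lam : Fin k → ℝ) (ξ : ι → ℝ), (∑ b, lam b • v b) ⬝ᵥ ξ = lam ⬝ᵥ (fun b => v b ⬝ᵥ ξ) := by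
    intro lam ξ
    rw [sum_dotProduct]
    simp only [smul_dotProduct, smul_eq_mul]
    rfl
  refine ⟨∑ b, lam b • v b, ∑ b, mu b • v b, fun ξ ζ => ?_⟩
  simp only [hl]
  rw [← h]
  show Matrix.detRowAlternating _ = _
  congr 1
  funext a b
  by_cases h1 : a = a₁
  · subst h1; simp [dotL_apply]
  · by_cases h0 : a = a₀
    · subst h0; simp [h1, dotL_apply]
    · simp [h1, h0, dotL_apply]

lemma Gd_update_one {ι : Type} [Fintype ι] [DecidableEq ι] {k : ℕ} (v : Fin k → ι → ℝ) (ρ : Fin k → ι → ℝ) (a₀ : Fin k) :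
    ∃ c : ι → ℝ, ∀ ξ : ι → ℝ, Gd v (Function.update ρ a₀ ξ) = c ⬝ᵥ ξ := by
  refine ⟨fun i => Gd v (Function.update ρ a₀ (Pi.single i 1)), fun ξ => ?_⟩
  conv_lhs => rw [pi_eq_sum_univ' ξ, (Gd v).map_update_sum]
  refine Finset.sum_congr rfl (fun i _ => ?_)
  rw [(Gd v).map_update_smul, smul_eq_mul, mul_comm]

lemma Gd_cons {ι : Type} [Fintype ι] {k : ℕ} (u : ι → ℝ) (v : Fin k → ι → ℝ) (ρ : Fin (k + 1) → ι → ℝ) :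
    Gd (Fin.cons u v : Fin (k + 1) → ι → ℝ) ρ =
      ∑ a : Fin (k + 1), (-1) ^ (a : ℕ) * (u ⬝ᵥ ρ a) * Gd v (fun b => ρ (a.succAbove b)) := by
  rw [Gd_apply, Matrix.det_succ_column_zero]
  rfl

lemma Gd_change {ι : Type} [Fintype ι] {k : ℕ} (v v' : Fin k → ι → ℝ) (M : Matrix (Fin k) (Fin k) ℝ)
    (h : ∀ b, v' b = ∑ b', M b' b • v b') (ρ : Fin k → ι → ℝ) : Gd v' ρ = Gd v ρ * M.det := by
  rw [Gd_apply, Gd_apply, ← Matrix.det_mul]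
  congr 1
  funext a b
  simp only [Matrix.of_apply, Matrix.mul_apply, h, sum_dotProduct, smul_dotProduct, smul_eq_mul]
  exact Finset.sum_congr rfl (fun _ _ => mul_comm _ _)

/-- integer to real vector -/
def ir {ι : Type} (u : ι → ℤ) : ι → ℝ := fun i => (u i : ℝ)

lemma ir_ne {ι : Type} {u : ι → ℤ} (h : u ≠ 0) : ir u ≠ 0 := by
  intro h'
  apply h
  funext i
  have := congrFun h' i
  simpa [ir] using this

lemma Gd_minor {ι : Type} [Fintype ι] [DecidableEq ι] {k : ℕ} (v : Fin k → ι → ℤ) (σ : Fin k → ι) :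
    Gd (fun b => ir (v b)) (fun a => Pi.single (σ a) 1) = ((Matrix.det (Matrix.of fun a b => v b (σ a)) : ℤ) : ℝ) := by
  rw [Gd_apply, Int.cast_det]
  congr 1
  funext a b
  simp [ir]

lemma exists_minor {ι : Type} [Fintype ι] [DecidableEq ι] {k : ℕ} (v : Fin k → ι → ℤ)
    (hv : LinearIndependent ℝ (fun b => ir (v b))) :
    ∃ σ : Fin k → ι, Function.Injective σ ∧ 1 ≤ |Gd (fun b => ir (v b)) (fun a => Pi.single (σ a) 1)| := by
  let r : ι → Fin k → ℝ := fun i b => ir (v b) i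
  have hsp : Submodule.span ℝ (range r) = ⊤ := by
    have hc : LinearIndependent ℝ (Matrix.of (fun b => ir (v b)) : Matrix (Fin k) ι ℝ).row := hv
    have h1 := hc.rank_matrix
    rw [Matrix.rank_eq_finrank_span_cols] at h1
    apply Submodule.eq_top_of_finrank_eq
    rw [Module.finrank_fintype_fun_eq_card, ← h1]
    rfl
  have hfr : Module.finrank ℝ (Submodule.span ℝ (range r)) = k := by rw [hsp]; simp
  have hex := Submodule.exists_fun_fin_finrank_span_eq ℝ (range r)
  rw [hfr] at hex
  obtain ⟨p, hp1, -, hp3⟩ := hex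
  choose σ hσ using hp1
  have hdet : Gd (fun b => ir (v b)) (fun a => Pi.single (σ a) 1) ≠ 0 := by
    have h1 : IsUnit (Matrix.of p : Matrix (Fin k) (Fin k) ℝ) :=
      Matrix.linearIndependent_rows_iff_isUnit.mp hp3
    have h2 := (Matrix.isUnit_iff_isUnit_det _).mp h1
    have h3 : Gd (fun b => ir (v b)) (fun a => Pi.single (σ a) 1) = (Matrix.of p).det := by
      rw [Gd_apply]
      congr 1
      funext a b
      simp [← hσ a, r]
    rw [h3]; exact h2.ne_zero
  refine ⟨σ, ?_, ?_⟩
  · by_contra hinj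
    apply hdet
    apply (Gd _).map_eq_zero_of_not_injective
    intro h
    exact hinj (fun a b hab => h (by simp [hab]))
  · rw [Gd_minor] at hdet ⊢
    have : (Matrix.det (Matrix.of fun a b => v b (σ a)) : ℤ) ≠ 0 := by exact_mod_cast hdet
    exact_mod_cast Int.one_le_abs this

section
set_option linter.unusedSectionVars false
set_option linter.unusedSimpArgs false
variable {ι : Type} [Fintype ι] [DecidableEq ι] {d : ℕ}

noncomputable def row (g : (Fin d → ℝ) → ι → ℝ) (δ K T : ℝ) (s : Fin d) (x : Fin d → ℝ) : Bool ⊕ ι → ι → ℝ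
  | Sum.inl false => δ⁻¹ • g x
  | Sum.inl true => K⁻¹ • fderiv ℝ g x (Pi.single s 1)
  | Sum.inr i => T⁻¹ • Pi.single i 1

noncomputable def psi (g : (Fin d → ℝ) → ι → ℝ) (δ K T : ℝ) {k : ℕ} (v : Fin k → ι → ℝ) (x : Fin d → ℝ) : ℝ :=
  ‖(fun p : Fin d × (Fin k → Bool ⊕ ι) => Gd v (fun a => row g δ K T p.1 x (p.2 a)))‖

lemma psi_comp_le (g : (Fin d → ℝ) → ι → ℝ) (δ K T : ℝ) {k : ℕ} (v : Fin k → ι → ℝ) (x : Fin d → ℝ)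
    (s : Fin d) (σ : Fin k → Bool ⊕ ι) : |Gd v (fun a => row g δ K T s x (σ a))| ≤ psi g δ K T v x :=
  norm_le_pi_norm (fun p : Fin d × (Fin k → Bool ⊕ ι) => Gd v (fun a => row g δ K T p.1 x (p.2 a))) (s, σ)

lemma psi_exists (g : (Fin d → ℝ) → ι → ℝ) (δ K T : ℝ) {k : ℕ} (v : Fin k → ι → ℝ) (x : Fin d → ℝ)
    (h : 1 ≤ psi g δ K T v x) : ∃ (s : Fin d) (σ : Fin k → Bool ⊕ ι), 1 ≤ |Gd v (fun a => row g δ K T s x (σ a))| := by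
  by_contra hcon
  push Not at hcon
  have : psi g δ K T v x < 1 := (pi_norm_lt_iff one_pos).mpr (fun p => hcon p.1 p.2)
  linarith

lemma row_eq_update (g : (Fin d → ℝ) → ι → ℝ) (δ K T : ℝ) {k : ℕ} (σ : Fin k → Bool ⊕ ι)
    (hσ : Function.Injective σ) (a₀ a₁ : Fin k) (h0 : σ a₀ = Sum.inl false) (h1 : σ a₁ = Sum.inl true)
    (s : Fin d) (x : Fin d → ℝ) :
    (fun a => row g δ K T s x (σ a)) = Function.update (Function.update
      (fun a => Sum.elim (fun _ => 0) (fun i => T⁻¹ • (Pi.single i 1 : ι → ℝ)) (σ a)) a₀ (δ⁻¹ • g x)) a₁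
      (K⁻¹ • fderiv ℝ g x (Pi.single s 1)) := by
  funext a
  by_cases e1 : a = a₁
  · subst e1; simp [h1, row]
  · by_cases e0 : a = a₀
    · subst e0; simp [h0, row, e1]
    · simp only [Function.update_of_ne e1, Function.update_of_ne e0]
      rcases hh : σ a with (_ | _) | i
      · exact absurd (hσ (hh.trans h0.symm)) e0
      · exact absurd (hσ (hh.trans h1.symm)) e1
      · rfl

lemma shape (g : (Fin d → ℝ) → ι → ℝ) (e0 : ι → ℝ) (he0 : ∀ x, e0 ⬝ᵥ g x = 1)
    (he1 : ∀ x s, e0 ⬝ᵥ fderiv ℝ g x (Pi.single s 1) = 0) (δ K T : ℝ) {k : ℕ} (v : Fin k → ι → ℝ)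
    (σ : Fin k → Bool ⊕ ι) :
    (∃ a : ℝ, ∀ s x, Gd v (fun a => row g δ K T s x (σ a)) = a) ∨
    (∃ c : ι → ℝ, ∀ s x, Gd v (fun a => row g δ K T s x (σ a)) = c ⬝ᵥ g x) ∨
    (∃ c c' : ι → ℝ, ∀ s x, Gd v (fun a => row g δ K T s x (σ a)) = Sg g s c c' x) := by
  by_cases hσ : Function.Injective σ
  swap
  · left
    refine ⟨0, fun s x => (Gd v).map_eq_zero_of_not_injective _ (fun h => hσ (fun a b hab => h ?_))⟩
    simp [hab]
  by_cases h0 : ∃ a₀, σ a₀ = Sum.inl false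
  · obtain ⟨a₀, h0⟩ := h0
    by_cases h1 : ∃ a₁, σ a₁ = Sum.inl true
    · obtain ⟨a₁, h1⟩ := h1
      have hne : a₀ ≠ a₁ := by rintro rfl; rw [h0] at h1; simp at h1
      obtain ⟨c, c', hcc⟩ := Gd_update v
        (fun a => Sum.elim (fun _ => 0) (fun i => T⁻¹ • (Pi.single i 1 : ι → ℝ)) (σ a)) hne
      right; right
      refine ⟨δ⁻¹ • c, K⁻¹ • c', fun s x => ?_⟩
      rw [row_eq_update g δ K T σ hσ a₀ a₁ h0 h1, hcc, Sg]
      simp only [smul_dotProduct, dotProduct_smul, smul_eq_mul]; ring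
    · right; left
      obtain ⟨c, hc⟩ := Gd_update_one v
        (fun a => Sum.elim (fun _ => 0) (fun i => T⁻¹ • (Pi.single i 1 : ι → ℝ)) (σ a)) a₀
      refine ⟨δ⁻¹ • c, fun s x => ?_⟩
      rw [smul_dotProduct, ← dotProduct_smul, ← hc]
      congr 1
      funext a
      by_cases e0 : a = a₀
      · subst e0; simp [h0, row]
      · simp only [Function.update_of_ne e0]
        rcases hh : σ a with (_ | _) | i
        · exact absurd (hσ (hh.trans h0.symm)) e0
        · exact absurd ⟨a, hh⟩ h1
        · rfl
  · by_cases h1 : ∃ a₁, σ a₁ = Sum.inl true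
    · obtain ⟨a₁, h1⟩ := h1
      right; right
      obtain ⟨c, hc⟩ := Gd_update_one v
        (fun a => Sum.elim (fun _ => 0) (fun i => T⁻¹ • (Pi.single i 1 : ι → ℝ)) (σ a)) a₁
      refine ⟨e0, K⁻¹ • c, fun s x => ?_⟩
      rw [Sg, he0, he1, mul_zero, sub_zero, one_mul, smul_dotProduct, ← dotProduct_smul, ← hc]
      congr 1
      funext a
      by_cases e0 : a = a₁
      · subst e0; simp [h1, row]
      · simp only [Function.update_of_ne e0]
        rcases hh : σ a with (_ | _) | i
        · exact absurd ⟨a, hh⟩ h0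
        · exact absurd (hσ (hh.trans h1.symm)) e0
        · rfl
    · left
      refine ⟨Gd v (fun a => Sum.elim (fun _ => 0) (fun i => T⁻¹ • (Pi.single i 1 : ι → ℝ)) (σ a)), fun s x => ?_⟩
      congr 1
      funext a
      rcases hh : σ a with (_ | _) | i
      · exact absurd ⟨a, hh⟩ h0
      · exact absurd ⟨a, hh⟩ h1
      · rfl

/-- The conclusion of `weak_good` on one ball. -/
def WG (g : (Fin d → ℝ) → ι → ℝ) (τ : ℝ≥0∞) (ε κ : ℝ) (x₁ : Fin d → ℝ) (r : ℝ) : Prop :=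
  (∀ c : ι → ℝ, ∃ μ : ℝ, 0 ≤ μ ∧ κ * ‖c‖ ≤ μ ∧ (∀ y ∈ Metric.closedBall x₁ r, |c ⬝ᵥ g y| ≤ μ) ∧
    volume {y ∈ Metric.closedBall x₁ r | |c ⬝ᵥ g y| < ε * μ} ≤ τ * volume (Metric.closedBall x₁ r)) ∧
  (∀ c c' : ι → ℝ, ∃ μ : ℝ, 0 ≤ μ ∧ (∀ i j, κ * |c i * c' j - c j * c' i| ≤ μ) ∧
    (∀ s, ∀ y ∈ Metric.closedBall x₁ r, |Sg g s c c' y| ≤ μ) ∧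
    ∃ s, volume {y ∈ Metric.closedBall x₁ r | |Sg g s c c' y| < ε * μ} ≤
      τ * volume (Metric.closedBall x₁ r))

lemma psi_good (g : (Fin d → ℝ) → ι → ℝ) (e0 : ι → ℝ) (he0 : ∀ x, e0 ⬝ᵥ g x = 1)
    (he1 : ∀ x s, e0 ⬝ᵥ fderiv ℝ g x (Pi.single s 1) = 0) (δ K T : ℝ) {k : ℕ} (v : Fin k → ι → ℝ)
    (τ : ℝ≥0∞) (ε κ : ℝ) (hε : 0 < ε) (x₁ : Fin d → ℝ) (r : ℝ) (hW : WG g τ ε κ x₁ r)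
    (hy : ∃ y ∈ Metric.closedBall x₁ r, 1 ≤ psi g δ K T v y) :
    volume {y ∈ Metric.closedBall x₁ r | psi g δ K T v y < min ε 1} ≤ τ * volume (Metric.closedBall x₁ r) := by
  obtain ⟨y, hyB, hy1⟩ := hy
  obtain ⟨s, σ, hs⟩ := psi_exists g δ K T v y hy1
  rcases shape g e0 he0 he1 δ K T v σ with ⟨a, ha⟩ | ⟨c, hc⟩ | ⟨c, c', hc⟩
  · rw [ha] at hs
    have : {y ∈ Metric.closedBall x₁ r | psi g δ K T v y < min ε 1} = ∅ := by
      refine Set.eq_empty_of_forall_notMem (fun z hz => ?_)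
      have h1 := psi_comp_le g δ K T v z s σ
      rw [ha] at h1
      have h2 := hz.2.trans_le (min_le_right _ _)
      linarith
    rw [this]; simp
  · obtain ⟨μ, -, -, h2, h3⟩ := hW.1 c
    refine le_trans (measure_mono ?_) h3
    rintro z ⟨hzB, hz⟩
    refine ⟨hzB, ?_⟩
    have hμ : 1 ≤ μ := by rw [hc] at hs; exact hs.trans (h2 y hyB)
    have h1 := psi_comp_le g δ K T v z s σ
    rw [hc] at h1
    have h4 := hz.trans_le (min_le_left _ _)
    nlinarith
  · obtain ⟨μ, -, -, h2, s', h3⟩ := hW.2 c c'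
    refine le_trans (measure_mono ?_) h3
    rintro z ⟨hzB, hz⟩
    refine ⟨hzB, ?_⟩
    have hμ : 1 ≤ μ := by rw [hc] at hs; exact hs.trans (h2 s y hyB)
    have h1 := psi_comp_le g δ K T v z s' σ
    rw [hc] at h1
    have h4 := hz.trans_le (min_le_left _ _)
    nlinarith

lemma psi_cont (g : (Fin d → ℝ) → ι → ℝ) (δ K T : ℝ) {k : ℕ} (v : Fin k → ι → ℝ) (B : Set (Fin d → ℝ))
    (hg : ContinuousOn g B) (hg' : ContinuousOn (fderiv ℝ g) B) : ContinuousOn (psi g δ K T v) B := by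
  unfold psi
  apply ContinuousOn.norm
  rw [continuousOn_pi]
  rintro ⟨s, σ⟩
  have hG : Continuous (fun ρ : Fin k → ι → ℝ => Gd v ρ) := by
    simp only [Gd_apply]
    apply Continuous.matrix_det
    refine continuous_matrix (fun a b => ?_)
    simp only [Matrix.of_apply, dotProduct]
    fun_prop
  refine hG.comp_continuousOn (continuousOn_pi.mpr (fun a => ?_))
  rcases hh : σ a with (_ | _) | i
  · simp only [hh, row]; exact (continuous_const_smul δ⁻¹).comp_continuousOn hg
  · simp only [hh, row]; exact (continuous_const_smul K⁻¹).comp_continuousOn (hg'.clm_apply continuousOn_const)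
  · simp only [hh, row]; exact continuousOn_const

lemma exists_of_vol (τ : ℝ≥0∞) (hτ : τ < 1) (x₁ : Fin d → ℝ) (r : ℝ) (hr : 0 < r) (p : (Fin d → ℝ) → Prop)
    (h : volume {y ∈ Metric.closedBall x₁ r | p y} ≤ τ * volume (Metric.closedBall x₁ r)) :
    ∃ y ∈ Metric.closedBall x₁ r, ¬ p y := by
  by_contra hcon
  push Not at hcon
  have : {y ∈ Metric.closedBall x₁ r | p y} = Metric.closedBall x₁ r :=
    Set.ext fun y => ⟨fun h => h.1, fun h => ⟨h, hcon y h⟩⟩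
  rw [this] at h
  have h1 : volume (Metric.closedBall x₁ r) ≠ 0 := (Metric.measure_closedBall_pos _ _ hr).ne'
  have h2 : volume (Metric.closedBall x₁ r) ≠ ⊤ := measure_closedBall_lt_top.ne
  have h3 : τ * volume (Metric.closedBall x₁ r) < 1 * volume (Metric.closedBall x₁ r) :=
    ENNReal.mul_lt_mul_left h1 h2 hτ
  rw [one_mul] at h3
  exact absurd h (not_le.mpr h3)

lemma Gd_row2 (g : (Fin d → ℝ) → ι → ℝ) (δ K T : ℝ) {k : ℕ} (v : Fin (k + 2) → ι → ℝ) (τ : Fin (k + 2) → ι)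
    (s : Fin d) (y : Fin d → ℝ) :
    Gd v (fun a => row g δ K T s y ((Fin.cons (Sum.inl false) (Fin.cons (Sum.inl true) (fun a => Sum.inr (τ a.succ.succ))) :
      Fin (k + 2) → Bool ⊕ ι) a)) = (δ⁻¹ * (K⁻¹ * T⁻¹ ^ k)) *
      Gd v (Function.update (Function.update (fun a => (Pi.single (τ a) 1 : ι → ℝ)) 0 (g y)) 1
        (fderiv ℝ g y (Pi.single s 1))) := by
  have h := (Gd v).map_smul_univ (Fin.cons δ⁻¹ (Fin.cons K⁻¹ (fun _ => T⁻¹)) : Fin (k + 2) → ℝ)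
    (Function.update (Function.update (fun a => (Pi.single (τ a) 1 : ι → ℝ)) 0 (g y)) 1
        (fderiv ℝ g y (Pi.single s 1)))
  rw [Fin.prod_univ_succ, Fin.prod_univ_succ] at h
  simp only [Fin.cons_zero, Fin.cons_succ, Finset.prod_const, Finset.card_univ, Fintype.card_fin, smul_eq_mul] at h
  rw [← h]
  congr 1
  funext a
  refine Fin.cases ?_ (fun a => Fin.cases ?_ (fun a => ?_) a) a
  · simp [row]
  · simp [row]
  · have h1 : a.succ.succ ≠ 1 := by
      rw [← Fin.succ_zero_eq_one]; intro h; exact Fin.succ_ne_zero _ (Fin.succ_injective _ h)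
    simp [row, h1]

lemma low1 (g : (Fin d → ℝ) → ι → ℝ) (δ K T : ℝ) (v : Fin 1 → ι → ℤ) (hv : LinearIndependent ℝ (fun b => ir (v b)))
    (τ : ℝ≥0∞) (hτ : τ < 1) (ε κ : ℝ) (hε : 0 < ε) (x₁ : Fin d → ℝ) (r : ℝ) (hr : 0 < r) (hκ : 0 < κ)
    (hW : WG g τ ε κ x₁ r) (hδ : 0 < δ) (hδκ : δ ≤ ε * κ) (hd : 0 < d) :
    ∃ y ∈ Metric.closedBall x₁ r, 1 ≤ psi g δ K T (fun b => ir (v b)) y := by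
  obtain ⟨μ, -, h1, -, h3⟩ := hW.1 (ir (v 0))
  obtain ⟨y, hy, hy2⟩ := exists_of_vol τ hτ x₁ r hr _ h3
  refine ⟨y, hy, le_trans ?_ (psi_comp_le g δ K T _ y ⟨0, hd⟩ (fun _ => Sum.inl false))⟩
  rw [Gd_apply, Matrix.det_fin_one]
  simp only [Matrix.of_apply, row, dotProduct_smul, smul_eq_mul, abs_mul, abs_inv, abs_of_pos hδ]
  rw [le_inv_mul_iff₀ hδ]
  have hn : 1 ≤ ‖ir (v 0)‖ := by
    have h0 : v 0 ≠ 0 := by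
      intro h
      exact hv.ne_zero 0 (by rw [h]; funext i; simp [ir])
    obtain ⟨i, hi⟩ := Function.ne_iff.mp h0
    have h4 := norm_le_pi_norm (ir (v 0)) i
    have h5 : (1 : ℝ) ≤ |((v 0 i : ℤ) : ℝ)| := by exact_mod_cast Int.one_le_abs hi
    exact h5.trans h4
  have h6 : ε * (κ * 1) ≤ ε * (κ * ‖ir (v 0)‖) := by gcongr
  have h7 : ε * (κ * ‖ir (v 0)‖) ≤ ε * μ := by gcongr
  have h8 := not_lt.mp hy2
  linarith

lemma low2 (g : (Fin d → ℝ) → ι → ℝ) (δ K T : ℝ) {k : ℕ} (v : Fin (k + 2) → ι → ℤ)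
    (hv : LinearIndependent ℝ (fun b => ir (v b)))
    (τ : ℝ≥0∞) (hτ : τ < 1) (ε κ : ℝ) (hε : 0 < ε) (x₁ : Fin d → ℝ) (r : ℝ) (hr : 0 < r) (hκ : 0 < κ)
    (hW : WG g τ ε κ x₁ r) (hδ : 0 < δ) (hK : 0 < K) (hT : 0 < T) (hδκ : δ * (K * T ^ k) ≤ ε * κ) :
    ∃ y ∈ Metric.closedBall x₁ r, 1 ≤ psi g δ K T (fun b => ir (v b)) y := by
  obtain ⟨σ, -, hσ⟩ := exists_minor v hv
  obtain ⟨c, c', hcc⟩ := Gd_update (fun b => ir (v b)) (fun a => (Pi.single (σ a) 1 : ι → ℝ)) (a₀ := 0) (a₁ := 1)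
    (by simp [Fin.ext_iff])
  have hm := hcc (Pi.single (σ 0) 1) (Pi.single (σ 1) 1)
  rw [Function.update_eq_self, Function.update_eq_self] at hm
  simp only [dotProduct_single, mul_one] at hm
  rw [hm] at hσ
  obtain ⟨μ, -, h1, -, s, h3⟩ := hW.2 c c'
  obtain ⟨y, hy, hy2⟩ := exists_of_vol τ hτ x₁ r hr _ h3
  refine ⟨y, hy, le_trans ?_ (psi_comp_le g δ K T _ y s (Fin.cons (Sum.inl false) (Fin.cons (Sum.inl true) (fun a => Sum.inr (σ a.succ.succ)))))⟩
  rw [Gd_row2, hcc]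
  have hS : (c ⬝ᵥ g y) * (c' ⬝ᵥ fderiv ℝ g y (Pi.single s 1)) - (c' ⬝ᵥ g y) * (c ⬝ᵥ fderiv ℝ g y (Pi.single s 1)) = Sg g s c c' y := rfl
  rw [hS, abs_mul, show δ⁻¹ * (K⁻¹ * T⁻¹ ^ k) = (δ * (K * T ^ k))⁻¹ by rw [mul_inv, mul_inv, inv_pow],
    abs_inv, abs_of_pos (show 0 < δ * (K * T ^ k) by positivity), le_inv_mul_iff₀ (by positivity)]
  have h4 := h1 (σ 0) (σ 1)
  have h5 : κ * 1 ≤ κ * |c (σ 0) * c' (σ 1) - c (σ 1) * c' (σ 0)| := by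
    gcongr
    rw [mul_comm (c (σ 1))]; exact hσ
  have h7 : ε * (κ * 1) ≤ ε * μ := by
    gcongr; linarith
  have h8 := not_lt.mp hy2
  linarith

end

lemma low3 {d n : ℕ} (f : (Fin d → ℝ) → Fin (n + 1) → ℝ) (δ K T : ℝ) (v : Fin (n + 2) → Fin (n + 2) → ℤ)
    (hv : LinearIndependent ℝ (fun b => ir (v b))) (c₃ : ℝ) (y : Fin d → ℝ) (s : Fin d) (j : Fin (n + 1))
    (hy : c₃ ≤ |fderiv ℝ (gof f) y (Pi.single s 1) j.succ|)
    (hy0 : fderiv ℝ (gof f) y (Pi.single s 1) 0 = 0)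
    (hδ : 0 < δ) (hK : 0 < K) (hT : 0 < T) (hδκ : δ * (K * T ^ n) ≤ c₃) :
    1 ≤ psi (gof f) δ K T (fun b => ir (v b)) y := by
  obtain ⟨σ, hσi, hσ⟩ := exists_minor v hv
  have hσb : Function.Bijective σ := (Finite.injective_iff_bijective).mp hσi
  let τ : Fin (n + 2) → Fin (n + 2) := Equiv.swap 1 j.succ
  have hτ : 1 ≤ |Gd (fun b => ir (v b)) (fun a => Pi.single (τ a) 1)| := by
    let e := Equiv.ofBijective σ hσb
    have h1 := (Gd (fun b => ir (v b))).map_perm (fun a => Pi.single (σ a) 1) ((Equiv.swap 1 j.succ).trans e.symm)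
    have h2 : ((fun a => Pi.single (σ a) (1 : ℝ)) ∘ ⇑((Equiv.swap 1 j.succ).trans e.symm) : Fin (n + 2) → Fin (n + 2) → ℝ)
        = fun a => Pi.single (τ a) 1 := by
      funext a
      have : σ (e.symm (Equiv.swap 1 j.succ a)) = Equiv.swap 1 j.succ a := e.apply_symm_apply _
      simp only [Function.comp, Equiv.trans_apply, this, τ]
    rw [h2] at h1
    rw [h1]
    rcases Int.units_eq_one_or (Equiv.Perm.sign ((Equiv.swap 1 j.succ).trans e.symm)) with h | h
    · rw [h]; simpa using hσ
    · rw [h]; simpa using hσ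
  have hj0 : (0 : Fin (n + 2)) ≠ j.succ := (Fin.succ_ne_zero _).symm
  have hτ0 : τ 0 = 0 := Equiv.swap_apply_of_ne_of_ne (by simp [Fin.ext_iff]) hj0
  have hτ1 : τ 1 = j.succ := Equiv.swap_apply_left _ _
  refine le_trans ?_ (psi_comp_le (gof f) δ K T _ y s (Fin.cons (Sum.inl false) (Fin.cons (Sum.inl true) (fun a => Sum.inr (τ a.succ.succ)))))
  rw [Gd_row2]
  set G := Gd (fun b => ir (v b)) with hG
  set w := fderiv ℝ (gof f) y (Pi.single s 1) with hw
  -- expand second vector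
  have h01 : (0 : Fin (n + 2)) ≠ 1 := by simp [Fin.ext_iff]
  have key : G (Function.update (Function.update (fun a => (Pi.single (τ a) 1 : Fin (n + 2) → ℝ)) 0 (gof f y)) 1 w) =
      w j.succ * G (fun a => Pi.single (τ a) 1) := by
    obtain ⟨c, c', hcc⟩ := Gd_update (fun b => ir (v b)) (fun a => (Pi.single (τ a) 1 : Fin (n + 2) → ℝ)) h01
    -- N i i' 
    have hz : ∀ i i' : Fin (n + 2), (i ≠ 0 ∧ i ≠ j.succ) ∨ (i' ≠ 0 ∧ i' ≠ j.succ) ∨ i = i' → c i * c' i' - c' i * c i' = 0 := by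
      intro i i' h
      have h1 := hcc (Pi.single i 1) (Pi.single i' 1)
      simp only [dotProduct_single, mul_one] at h1
      rw [← h1]
      have hex : ∀ i : Fin (n + 2), i ≠ 0 ∧ i ≠ j.succ → ∃ a, a ≠ 0 ∧ a ≠ 1 ∧ τ a = i := by
        rintro i ⟨hi0, hij⟩
        refine ⟨Equiv.swap 1 j.succ i, ?_, ?_, Equiv.swap_apply_self _ _ _⟩
        · intro h
          have := congrArg (Equiv.swap 1 j.succ) h
          rw [Equiv.swap_apply_self] at this
          exact hi0 (this.trans hτ0)
        · intro h
          have := congrArg (Equiv.swap 1 j.succ) h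
          rw [Equiv.swap_apply_self] at this
          exact hij (this.trans hτ1)
      rcases h with h | h | h
      · obtain ⟨a, ha0, ha1, ha⟩ := hex i h
        refine (Gd _).map_eq_zero_of_eq (i := 0) (j := a) _ ?_ ha0.symm
        simp [ha0, ha1, h01, ha]
      · obtain ⟨a, ha0, ha1, ha⟩ := hex i' h
        refine (Gd _).map_eq_zero_of_eq (i := 1) (j := a) _ ?_ ha1.symm
        simp [ha0, ha1, ha]
      · subst h
        refine (Gd _).map_eq_zero_of_eq (i := 0) (j := 1) _ ?_ h01
        simp
    have hm := hcc (Pi.single (τ 0) 1) (Pi.single (τ 1) 1)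
    rw [Function.update_eq_self, Function.update_eq_self, hτ0, hτ1] at hm
    simp only [dotProduct_single, mul_one] at hm
    rw [hG, hcc, hm]
    have hsum : (c ⬝ᵥ gof f y) * (c' ⬝ᵥ w) - (c' ⬝ᵥ gof f y) * (c ⬝ᵥ w) =
        ∑ i, ∑ i', (c i * c' i' - c' i * c i') * (gof f y i * w i') := by
      simp only [dotProduct, Finset.sum_mul_sum, ← Finset.sum_sub_distrib]
      exact Finset.sum_congr rfl (fun i _ => Finset.sum_congr rfl (fun i' _ => by ring))
    rw [hsum, Finset.sum_eq_add 0 j.succ hj0, Finset.sum_eq_single j.succ, Finset.sum_eq_single 0]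
    · rw [hy0]
      simp [gof]; ring
    · intro i' _ hi'
      rw [hz j.succ i', zero_mul]
      by_cases h : i' = j.succ
      · right; right; exact h.symm
      · right; left; exact ⟨hi', h⟩
    · simp
    · intro i' _ hi'
      rw [hz 0 i', zero_mul]
      by_cases h : i' = 0
      · right; right; exact h.symm
      · right; left; exact ⟨h, hi'⟩
    · simp
    · intro i _ hi
      refine Finset.sum_eq_zero (fun i' _ => ?_)
      rw [hz i i' (Or.inl hi), zero_mul]
    · simp
    · simp
  rw [key, abs_mul, show δ⁻¹ * (K⁻¹ * T⁻¹ ^ n) = (δ * (K * T ^ n))⁻¹ by rw [mul_inv, mul_inv, inv_pow],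
    abs_inv, abs_of_pos (show 0 < δ * (K * T ^ n) by positivity), le_inv_mul_iff₀ (by positivity), mul_one, abs_mul]
  have h2 : |w j.succ| * 1 ≤ |w j.succ| * |G (fun a => Pi.single (τ a) 1)| := by gcongr
  linarith

def IsTup {ι : Type} (V : Submodule ℝ (ι → ℝ)) {k : ℕ} (v : Fin k → ι → ℤ) : Prop :=
  LinearIndependent ℝ (fun b => ir (v b)) ∧ Submodule.span ℝ (range fun b => ir (v b)) = V

lemma IsTup.fr {ι : Type} {V : Submodule ℝ (ι → ℝ)} {k : ℕ} {v : Fin k → ι → ℤ} (h : IsTup V v) :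
    Module.finrank ℝ V = k := by
  rw [← h.2, finrank_span_eq_card h.1, Fintype.card_fin]

lemma exists_min {ι : Type} [Fintype ι] [DecidableEq ι] (V : Submodule ℝ (ι → ℝ))
    (h : ∃ (k : ℕ) (v : Fin k → ι → ℤ), IsTup V v) :
    ∃ (k : ℕ) (w : Fin k → ι → ℤ), IsTup V w ∧ ∀ (k' : ℕ) (v' : Fin k' → ι → ℤ), IsTup V v' →
      ∀ (d : ℕ) (g : (Fin d → ℝ) → ι → ℝ) (δ K T : ℝ) (x : Fin d → ℝ),
        psi g δ K T (fun b => ir (w b)) x ≤ psi g δ K T (fun b => ir (v' b)) x := by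
  classical
  obtain ⟨k, v, hv⟩ := h
  let H : (Fin k → ι → ℤ) → ℕ := fun v => ∑ σ : Fin k → ι, (Matrix.det (Matrix.of fun a b => v b (σ a))).natAbs
  have hH : ∀ v, ((H v : ℕ) : ℝ) = ∑ σ : Fin k → ι, |Gd (fun b => ir (v b)) (fun a => Pi.single (σ a) 1)| := by
    intro v
    simp only [H, Gd_minor, Nat.cast_sum, Nat.cast_natAbs, Int.cast_abs]
  have hex : ∃ h, ∃ v : Fin k → ι → ℤ, IsTup V v ∧ H v = h := ⟨_, v, hv, rfl⟩
  obtain ⟨w, hw, hwH⟩ := Nat.find_spec hex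
  refine ⟨k, w, hw, fun k' v' hv' d g δ K T x => ?_⟩
  obtain rfl : k' = k := by rw [← hv'.fr, ← hv.fr]
  have hle : H w ≤ H v' := by rw [hwH]; exact Nat.find_min' hex ⟨v', hv', rfl⟩
  have hmem : ∀ b, ∃ c : Fin k' → ℝ, ∑ i, c i • ir (w i) = ir (v' b) := by
    intro b
    rw [← Submodule.mem_span_range_iff_exists_fun, hw.2, ← hv'.2]
    exact Submodule.subset_span ⟨b, rfl⟩
  choose c hc using hmem
  let M : Matrix (Fin k') (Fin k') ℝ := Matrix.of fun b' b => c b b'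
  have hM := Gd_change (fun b => ir (w b)) (fun b => ir (v' b)) M (fun b => (hc b).symm)
  have h1 : ((H v' : ℕ) : ℝ) = H w * |M.det| := by
    rw [hH, hH, Finset.sum_mul]
    exact Finset.sum_congr rfl (fun σ _ => by rw [hM, abs_mul])
  have h2 : (0 : ℝ) < H w := by
    obtain ⟨σ, -, hσ⟩ := exists_minor w hw.1
    rw [hH]
    refine lt_of_lt_of_le (lt_of_lt_of_le one_pos hσ)
      (Finset.single_le_sum (f := fun σ : Fin k' → ι => |Gd (fun b => ir (w b)) (fun a => Pi.single (σ a) 1)|)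
      (fun _ _ => abs_nonneg _) (Finset.mem_univ σ))
  have h3 : (1 : ℝ) ≤ |M.det| := by
    have : ((H w : ℕ) : ℝ) ≤ H v' := by exact_mod_cast hle
    rw [h1] at this
    exact le_of_mul_le_mul_left (by linarith) h2
  refine (pi_norm_le_iff_of_nonneg (norm_nonneg _)).mpr (fun p => ?_)
  refine le_trans ?_ (psi_comp_le g δ K T _ x p.1 p.2)
  rw [hM, abs_mul, Real.norm_eq_abs]
  exact le_mul_of_one_le_right (abs_nonneg _) h3

abbrev PP (ι : Type) := {V : Submodule ℝ (ι → ℝ) // ∃ (k : ℕ) (v : Fin k → ι → ℤ), IsTup V v}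

section
variable {ι : Type} [Fintype ι] [DecidableEq ι] {d : ℕ}

noncomputable def wk (V : PP ι) : ℕ := (exists_min V.1 V.2).choose
noncomputable def wt (V : PP ι) : Fin (wk V) → ι → ℤ := (exists_min V.1 V.2).choose_spec.choose
lemma wt_tup (V : PP ι) : IsTup V.1 (wt V) := (exists_min V.1 V.2).choose_spec.choose_spec.1
lemma wt_min (V : PP ι) {k' : ℕ} (v' : Fin k' → ι → ℤ) (h : IsTup V.1 v')
    (g : (Fin d → ℝ) → ι → ℝ) (δ K T : ℝ) (x : Fin d → ℝ) :
        psi g δ K T (fun b => ir (wt V b)) x ≤ psi g δ K T (fun b => ir (v' b)) x :=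
  (exists_min V.1 V.2).choose_spec.choose_spec.2 k' v' h d g δ K T x

lemma prot_good (g : (Fin d → ℝ) → ι → ℝ) (δ K T ε₀ : ℝ) (h0 : 0 < ε₀) (h1 : ε₀ ≤ 1) (x : Fin d → ℝ)
    (hP : Prot (fun (V : PP ι) x => psi g δ K T (fun b => ir (wt V b)) x) ε₀ {V | V.1 ≠ ⊥} x)
    (u : ι → ℤ) (hu : u ≠ 0) :
    ∃ s j, ε₀ / (Fintype.card ι + 1) ≤ |ir u ⬝ᵥ row g δ K T s x j| := by
  obtain ⟨F, hFS, hch, hFψ, hF⟩ := hP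
  by_contra hcon
  push Not at hcon
  have hbot : IsTup (⊥ : Submodule ℝ (ι → ℝ)) (Fin.elim0 : Fin 0 → ι → ℤ) :=
    ⟨linearIndependent_empty_type, by simp⟩
  let A : Set (Submodule ℝ (ι → ℝ)) := {W | (W = ⊥ ∨ ∃ V ∈ F, V.1 = W) ∧ ir u ∉ W}
  obtain ⟨W, hWA, hWmax⟩ := (wellFounded_gt (α := Submodule ℝ (ι → ℝ))).has_min A
    ⟨⊥, Or.inl rfl, by simpa using ir_ne hu⟩
  -- a tuple for W with psi ≤ 1
  obtain ⟨k, w, hw, hwψ⟩ : ∃ (k : ℕ) (w : Fin k → ι → ℤ), IsTup W w ∧ psi g δ K T (fun b => ir (w b)) x ≤ 1 := by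
    rcases hWA.1 with h | ⟨V, hV, rfl⟩
    · refine ⟨0, Fin.elim0, h ▸ hbot, (pi_norm_le_iff_of_nonneg zero_le_one).mpr (fun p => ?_)⟩
      rw [Gd_apply, Matrix.det_fin_zero]; simp
    · exact ⟨wk V, wt V, wt_tup V, (hFψ V hV).2⟩
  have hcons : (fun b => ir ((Fin.cons u w : Fin (k + 1) → ι → ℤ) b)) =
      (Fin.cons (ir u) (fun b => ir (w b)) : Fin (k + 1) → ι → ℝ) := by
    funext b; refine Fin.cases ?_ (fun b => ?_) b <;> simp
  have hT : IsTup (W ⊔ Submodule.span ℝ {ir u}) (Fin.cons u w : Fin (k + 1) → ι → ℤ) := by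
    unfold IsTup
    rw [hcons]
    refine ⟨linearIndependent_finCons.mpr ⟨hw.1, ?_⟩, ?_⟩
    · rw [hw.2]; exact hWA.2
    · rw [Fin.range_cons, Submodule.span_insert, hw.2, sup_comm]
  let V' : PP ι := ⟨W ⊔ Submodule.span ℝ {ir u}, k + 1, _, hT⟩
  have huV' : Submodule.span ℝ {ir u} ≤ V'.1 := le_sup_right
  have hV'S : V'.1 ≠ ⊥ := by
    intro h
    rw [h, le_bot_iff, Submodule.span_singleton_eq_bot] at huV'
    exact ir_ne hu huV'
  have hcomp : ∀ t ∈ F, V' ≤ t ∨ t ≤ V' := by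
    intro t ht
    have hWt : W ≤ t.1 ∨ t.1 ≤ W := by
      rcases hWA.1 with h | ⟨V, hV, rfl⟩
      · left; rw [h]; exact bot_le
      · exact hch V hV t ht
    by_cases hut : ir u ∈ t.1
    · left
      have : W ≤ t.1 := hWt.resolve_right (fun h => hWA.2 (h hut))
      exact sup_le this ((Submodule.span_singleton_le_iff_mem _ _).mpr hut)
    · right
      have : t.1 ≤ W := by
        rcases hWt with h | h
        · by_contra hn
          exact hWmax t.1 ⟨Or.inr ⟨t, ht, rfl⟩, hut⟩ (lt_of_le_not_ge h hn)
        · exact h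
      exact (le_trans this (le_sup_left : W ≤ V'.1) : t.1 ≤ V'.1)
  have hge : ε₀ ≤ psi g δ K T (fun b => ir (wt V' b)) x := by
    by_cases hm : V' ∈ F
    · exact (hFψ V' hm).1
    · exact h1.trans (hF V' hV'S hm hcomp)
  have hge2 := hge.trans (wt_min V' _ hT g δ K T x)
  rw [hcons] at hge2
  have hk : (k : ℝ) ≤ Fintype.card ι := by
    have h3 := Submodule.finrank_le W
    rw [hw.fr, Module.finrank_fintype_fun_eq_card] at h3
    exact_mod_cast h3
  refine absurd hge2 (not_le.mpr ((pi_norm_lt_iff h0).mpr (fun p => ?_)))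
  rw [Gd_cons, Real.norm_eq_abs]
  refine lt_of_le_of_lt (Finset.abs_sum_le_sum_abs _ _) ?_
  refine lt_of_lt_of_le (Finset.sum_lt_sum_of_nonempty (g := fun _ => ε₀ / (Fintype.card ι + 1)) Finset.univ_nonempty (fun a _ => ?_)) ?_
  · rw [abs_mul, abs_mul, abs_pow, abs_neg, abs_one, one_pow, one_mul]
    refine lt_of_le_of_lt (mul_le_of_le_one_right (abs_nonneg _) ?_) (hcon p.1 (p.2 a))
    exact (psi_comp_le g δ K T (fun b => ir (w b)) x p.1 (fun b => p.2 (a.succAbove b))).trans hwψ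
  · rw [Finset.sum_const, Finset.card_univ, Fintype.card_fin, nsmul_eq_mul, mul_div_assoc', div_le_iff₀ (by positivity)]
    push_cast
    nlinarith
end

lemma gof_fd {d n : ℕ} (f : (Fin d → ℝ) → Fin n → ℝ) (y : Fin d → ℝ) (hf : DifferentiableAt ℝ f y) (h : Fin d → ℝ) :
    fderiv ℝ (gof f) y h = Fin.cons 0 (fderiv ℝ f y h) := by
  have : HasFDerivAt (gof f) (ContinuousLinearMap.pi (Fin.cons 0 (fun i => (ContinuousLinearMap.proj i).comp (fderiv ℝ f y)) :
      Fin (n + 1) → (Fin d → ℝ) →L[ℝ] ℝ)) y := by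
    rw [hasFDerivAt_pi]
    refine fun i => Fin.cases ?_ (fun i => ?_) i
    · exact hasFDerivAt_const _ _
    · exact hasFDerivAt_pi'.mp hf.hasFDerivAt i
  rw [this.fderiv]
  funext i
  refine Fin.cases ?_ (fun i => ?_) i <;> simp

lemma gof_fd0 {d n : ℕ} (f : (Fin d → ℝ) → Fin n → ℝ) (y : Fin d → ℝ) (h : Fin d → ℝ) :
    fderiv ℝ (gof f) y h 0 = 0 := by
  by_cases hd : DifferentiableAt ℝ (gof f) y
  · have h1 := hasFDerivAt_pi'.mp hd.hasFDerivAt 0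
    have h2 := h1.unique (hasFDerivAt_const (1 : ℝ) y)
    exact DFunLike.congr_fun h2 h
  · rw [fderiv_zero_of_not_differentiableAt hd]; simp

lemma good_points {d n l : ℕ} (hd : 0 < d) (f : (Fin d → ℝ) → Fin (n + 1) → ℝ) (x₀ : Fin d → ℝ)
    (hf : ContDiffAt ℝ ((l + 2 : ℕ) : WithTop ℕ∞) f x₀)
    (hND : ∀ c : Fin (n + 2) → ℝ, (∀ k ≤ l + 2, ∀ h, c ⬝ᵥ Tk k (gof f) x₀ h = 0) → c = 0)
    (s₀ : Fin d) (j₀ : Fin (n + 1)) (hs : fderiv ℝ f x₀ (Pi.single s₀ 1) j₀ ≠ 0) :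
    ∃ R : ℝ, 0 < R ∧ ∃ ε₁ : ℝ, 0 < ε₁ ∧ ∃ c₃ : ℝ, 0 < c₃ ∧ ∀ (z : Fin d → ℝ) (r : ℝ), 0 < r →
      dist z x₀ + 5 ^ (n + 3) * r < R → ∃ κ : ℝ, 0 < κ ∧ ∀ δ K T : ℝ, 0 < δ → 0 < K → 1 ≤ T → δ ≤ κ →
        δ * (K * T ^ (n - 1)) ≤ κ → δ * (K * T ^ n) ≤ c₃ →
        volume {x ∈ Metric.closedBall z r | ¬ ∀ u : Fin (n + 2) → ℤ, u ≠ 0 → ∃ s j,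
          ε₁ ≤ |ir u ⬝ᵥ row (gof f) δ K T s x j|} ≤ 2⁻¹ * volume (Metric.closedBall z r) := by
  obtain ⟨N, τB, hτB, hN⟩ := HasBesicovitchCovering.no_satelliteConfig (α := Fin d → ℝ)
  set τ : ℝ≥0∞ := (2 * (Kn N d (n + 3) + 1 : ℕ) : ℝ≥0∞)⁻¹ with hτ
  have hτ0 : 0 < τ := ENNReal.inv_pos.mpr (ENNReal.mul_ne_top (by simp) (ENNReal.natCast_ne_top _))
  have hτK : (Kn N d (n + 3) : ℝ≥0∞) * τ ≤ 2⁻¹ := by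
    rw [hτ, ENNReal.mul_inv (by simp) (by simp), mul_left_comm]
    refine mul_le_of_le_one_right' ?_
    rw [← div_eq_mul_inv]
    refine ENNReal.div_le_of_le_mul ?_
    rw [one_mul]
    exact_mod_cast Nat.le_succ _
  have hτ1 : τ < 1 := by
    rw [hτ, ENNReal.inv_lt_one]
    have : 1 < 2 * (Kn N d (n + 3) + 1) := by omega
    exact_mod_cast this
  have hg := gof_cd f x₀ _ hf
  obtain ⟨R₁, hR₁, ε, hε, hW⟩ := weak_good (l := l + 1) hd (gof f) x₀ hg hND τ hτ0
  have hev : ∀ᶠ y in nhds x₀, ContDiffAt ℝ ((l + 2 : ℕ) : WithTop ℕ∞) f y := hf.eventually (by generalize l + 2 = k; simp)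
  have hfdc : ∀ y, ContDiffAt ℝ ((l + 2 : ℕ) : WithTop ℕ∞) f y → ContinuousAt (fderiv ℝ f) y := by
    intro y hy
    exact (hy.fderiv_right (m := 0) (by norm_cast; omega)).continuousAt
  have hgdc : ∀ y, ContDiffAt ℝ ((l + 2 : ℕ) : WithTop ℕ∞) (gof f) y → ContinuousAt (fderiv ℝ (gof f)) y := by
    intro y hy
    exact (hy.fderiv_right (m := 0) (by norm_cast; omega)).continuousAt
  set c₃ := |fderiv ℝ f x₀ (Pi.single s₀ 1) j₀| / 2 with hc₃
  have hc₃0 : 0 < c₃ := by have := abs_pos.mpr hs; positivity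
  have hev2 : ∀ᶠ y in nhds x₀, c₃ < |fderiv ℝ f y (Pi.single s₀ 1) j₀| := by
    have h1 : ContinuousAt (fun y => |fderiv ℝ f y (Pi.single s₀ 1) j₀|) x₀ := by
      have := (hfdc x₀ hf).clm_apply (continuousAt_const (y := (Pi.single s₀ 1 : Fin d → ℝ)))
      exact (continuousAt_pi.mp this j₀).abs
    refine h1.eventually (lt_mem_nhds ?_)
    have := abs_pos.mpr hs
    linarith
  obtain ⟨R₂, hR₂, hball⟩ := Metric.eventually_nhds_iff_ball.mp (hev.and hev2)
  have hdiff : ∀ y ∈ Metric.ball x₀ R₂, DifferentiableAt ℝ f y := fun y hy =>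
    (hball y hy).1.differentiableAt (by norm_cast)
  refine ⟨min R₁ R₂, lt_min hR₁ hR₂, min ε 1 / ((n + 2 : ℕ) + 1), by positivity, c₃, hc₃0, ?_⟩
  intro z r hr hzr
  have h5 : (1 : ℝ) ≤ 5 ^ (n + 3) := one_le_pow₀ (by norm_num)
  have hzr' : dist z x₀ + r < min R₁ R₂ := by nlinarith
  obtain ⟨κ, hκ, hWG⟩ := hW z r hr (hzr'.trans_le (min_le_left _ _))
  refine ⟨ε * κ, by positivity, ?_⟩
  intro δ K T hδ hK hT h1 h2 h3
  have hT0 : 0 < T := by linarith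
  let S₀ : Set (PP (Fin (n + 2))) := {V | V.1 ≠ ⊥}
  let ψ : PP (Fin (n + 2)) → (Fin d → ℝ) → ℝ := fun V x => psi (gof f) δ K T (fun b => ir (wt V b)) x
  have he0 : ∀ x, (Pi.single 0 1 : Fin (n + 2) → ℝ) ⬝ᵥ gof f x = 1 := by intro x; simp [gof]
  have he1 : ∀ x s, (Pi.single 0 1 : Fin (n + 2) → ℝ) ⬝ᵥ fderiv ℝ (gof f) x (Pi.single s 1) = 0 := by
    intro x s; simp [gof_fd0]
  have hrk : StrictMono (fun V : PP (Fin (n + 2)) => Module.finrank ℝ V.1) := by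
    intro V W hVW
    exact Submodule.finrank_lt_finrank_of_lt hVW
  have key := nondiv hτB hN (fun V : PP (Fin (n + 2)) => Module.finrank ℝ V.1) hrk ψ x₀ (min R₁ R₂) (min ε 1) τ S₀
    (by
      intro V _
      refine psi_cont _ _ _ _ _ _ (fun y hy => ?_) (fun y hy => ?_)
      · have hy' := Metric.ball_subset_ball (min_le_right R₁ R₂) hy
        exact (gof_cd f y _ (hball y hy').1).continuousAt.continuousWithinAt
      · have hy' := Metric.ball_subset_ball (min_le_right R₁ R₂) hy
        exact (hgdc y (gof_cd f y _ (hball y hy').1)).continuousWithinAt)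
    (by
      intro V _ c ρ hρ hc hy
      obtain ⟨κ', _, hWG'⟩ := hW c ρ hρ (hc.trans_le (min_le_left _ _))
      exact psi_good _ _ he0 he1 δ K T _ τ ε κ' hε c ρ hWG' hy)
    (n + 3) S₀ subset_rfl (Finset.range (n + 3)) (by simp)
    (by
      intro V _
      have := Submodule.finrank_le V.1
      rw [Module.finrank_fintype_fun_eq_card, Fintype.card_fin] at this
      rw [Finset.mem_range]; omega)
    z r hr hzr
    (by
      intro V hV
      have ht := wt_tup V
      have hle := Submodule.finrank_le V.1
      rw [Module.finrank_fintype_fun_eq_card, Fintype.card_fin, ht.fr] at hle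
      have hne : wk V ≠ 0 := by
        intro h
        have := ht.fr
        rw [h] at this
        exact hV (Submodule.finrank_eq_zero.mp this)
      have main : ∀ (k : ℕ) (v : Fin k → Fin (n + 2) → ℤ), LinearIndependent ℝ (fun b => ir (v b)) → k ≤ n + 2 → k ≠ 0 →
          ∃ y ∈ Metric.closedBall z r, 1 ≤ psi (gof f) δ K T (fun b => ir (v b)) y := by
        intro k v hv hk hk0
        rcases k with _ | _ | k
        · exact absurd rfl hk0
        · exact low1 _ δ K T v hv τ hτ1 ε κ hε z r hr hκ hWG hδ h1 hd
        · by_cases hkn : k = n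
          · subst hkn
            have hzB : z ∈ Metric.ball x₀ R₂ := by
              rw [Metric.mem_ball]; have := hzr'.trans_le (min_le_right R₁ R₂); linarith
            refine ⟨z, Metric.mem_closedBall_self hr.le, low3 f δ K T v hv c₃ z s₀ j₀ ?_ (gof_fd0 _ _ _) hδ hK hT0 h3⟩
            rw [gof_fd f z (hdiff z hzB), Fin.cons_succ]
            exact (hball z hzB).2.le
          · refine low2 _ δ K T v hv τ hτ1 ε κ hε z r hr hκ hWG hδ hK hT0 (le_trans ?_ h2)
            gcongr
            omega
      exact main _ _ ht.1 hle hne)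
  refine le_trans (measure_mono ?_) (key.trans ?_)
  · rintro x ⟨hx, hx2⟩
    refine ⟨hx, fun hP => hx2 (fun u hu => ?_)⟩
    have := prot_good (gof f) δ K T (min ε 1) (by positivity) (min_le_right _ _) x hP u hu
    rwa [Fintype.card_fin] at this
  · gcongr

lemma kron {G E : Type} [AddCommGroup G] [NormedAddCommGroup E] [InnerProductSpace ℝ E] [FiniteDimensional ℝ E]
    (r : ℕ) : ∀ (W : Submodule ℝ E), Module.finrank ℝ W ≤ r → ∀ (b : G →+ E) (χ : G →+ ℝ) (a : ℝ), 0 < a →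
    (∀ g, b g ∈ W) → (∀ g, b g ≠ 0 → a ≤ ‖b g‖) → (∀ g, b g = 0 → ∃ m : ℤ, χ g = m) →
    ∃ X : E, ‖X‖ ≤ (2 ^ r - 1) / a ∧ ∀ g, ∃ m : ℤ, inner ℝ (b g) X = χ g + m := by
  induction r with
  | zero =>
    intro W hW b χ a ha hbW hb hχ
    have hW0 : W = ⊥ := Submodule.finrank_eq_zero.mp (by omega)
    refine ⟨0, by simp, fun g => ?_⟩
    have := hbW g
    rw [hW0, Submodule.mem_bot] at this
    obtain ⟨m, hm⟩ := hχ g this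
    exact ⟨-m, by rw [hm]; simp⟩
  | succ r ih =>
    intro W hW b χ a ha hbW hb hχ
    have hpow : (1 : ℝ) ≤ 2 ^ r := one_le_pow₀ (by norm_num)
    by_cases hall : ∀ g, b g = 0
    · refine ⟨0, ?_, fun g => ?_⟩
      · rw [norm_zero]; apply div_nonneg _ ha.le; rw [pow_succ]; linarith
      · obtain ⟨m, hm⟩ := hχ g (hall g)
        exact ⟨-m, by rw [hm]; simp⟩
    push Not at hall
    obtain ⟨g₁, hg₁⟩ := hall
    let S : Set ℝ := {x | ∃ g, b g ≠ 0 ∧ x = ‖b g‖}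
    have hSne : S.Nonempty := ⟨_, g₁, hg₁, rfl⟩
    have hSa : ∀ x ∈ S, a ≤ x := by rintro x ⟨g, hg, rfl⟩; exact hb g hg
    have hSb : BddBelow S := ⟨a, hSa⟩
    have hinf : a ≤ sInf S := le_csInf hSne hSa
    obtain ⟨_, ⟨g₀, hg₀, rfl⟩, hlt⟩ := exists_lt_of_csInf_lt hSne (show sInf S < sInf S / (9/10) by
      rw [lt_div_iff₀ (by norm_num)]; nlinarith)
    have hnear : ∀ g, b g ≠ 0 → 9 / 10 * ‖b g₀‖ ≤ ‖b g‖ := by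
      intro g hg
      have h1 := csInf_le hSb ⟨g, hg, rfl⟩
      rw [lt_div_iff₀ (by norm_num)] at hlt
      linarith
    set b₀ := b g₀ with hb₀
    have hb₀n : 0 < ‖b₀‖ := norm_pos_iff.mpr hg₀
    have hab : a ≤ ‖b₀‖ := hb g₀ hg₀
    have hN : inner ℝ b₀ b₀ = ‖b₀‖ ^ 2 := real_inner_self_eq_norm_sq b₀
    have hN0 : ‖b₀‖ ^ 2 ≠ 0 := by positivity
    let p : E → ℝ := fun x => inner ℝ x b₀ / ‖b₀‖ ^ 2
    have hpadd : ∀ x y, p (x + y) = p x + p y := by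
      intro x y; simp only [p, inner_add_left, add_div]
    have hpb : p b₀ = 1 := by simp only [p]; rw [hN, div_self hN0]
    let π : E → E := fun x => x - p x • b₀
    have hπ0 : ∀ x, inner ℝ (π x) b₀ = 0 := by
      intro x
      simp only [π, inner_sub_left, inner_smul_left, hN, p]
      simp; field_simp; ring
    have hdec : ∀ x, x = π x + p x • b₀ := by intro x; simp only [π]; abel
    have hnorm : ∀ x, ‖x‖ ^ 2 = ‖π x‖ ^ 2 + p x ^ 2 * ‖b₀‖ ^ 2 := by
      intro x
      conv_lhs => rw [hdec x]
      rw [norm_add_sq_real, inner_smul_right, hπ0, norm_smul, mul_pow, Real.norm_eq_abs, sq_abs]; ring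
    have hself : ∀ x y, inner ℝ (π x) y = inner ℝ x (π y) := by
      intro x y
      have h1 : inner ℝ (π x) y = inner ℝ (π x) (π y) := by
        conv_lhs => rw [hdec y]
        rw [inner_add_right, inner_smul_right, hπ0]; ring
      have h2 : inner ℝ x (π y) = inner ℝ (π x) (π y) := by
        conv_lhs => rw [hdec x]
        rw [inner_add_left, inner_smul_left, real_inner_comm, real_inner_comm (π y) b₀, hπ0]
        rw [real_inner_comm]; simp
      rw [h1, h2]
    let b' : G →+ E := AddMonoidHom.mk' (fun g => π (b g)) (by
      intro x y; simp only [π, map_add, hpadd, add_smul]; abel)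
    set s := Int.fract (χ g₀) with hs
    let χ' : G →+ ℝ := AddMonoidHom.mk' (fun g => χ g - s * p (b g)) (by
      intro x y; simp only [map_add, hpadd]; ring)
    -- reduction mod g₀
    have hpz : ∀ g (m : ℤ), p (b (g - m • g₀)) = p (b g) - m := by
      intro g m
      rw [map_sub, map_zsmul, ← hb₀]
      simp only [p, inner_sub_left, sub_div, ← Int.cast_smul_eq_zsmul ℝ, inner_smul_left]
      rw [hN]; simp; field_simp
    have hπz : ∀ g (m : ℤ), π (b (g - m • g₀)) = π (b g) := by
      intro g m
      simp only [π]
      rw [hpz, map_sub, map_zsmul, ← hb₀, sub_smul, ← Int.cast_smul_eq_zsmul ℝ]; abel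
    have hround : ∀ g, (p (b g) - round (p (b g))) ^ 2 ≤ 1 / 4 := by
      intro g
      have := abs_sub_round (p (b g))
      rw [← sq_abs]; nlinarith [abs_nonneg (p (b g) - round (p (b g)))]
    have hW' : Module.finrank ℝ (W ⊓ (Submodule.span ℝ {b₀})ᗮ : Submodule ℝ E) ≤ r := by
      have hlt : (W ⊓ (Submodule.span ℝ {b₀})ᗮ : Submodule ℝ E) < W := by
        refine lt_of_le_of_ne inf_le_left (fun h => ?_)
        have h1 : b₀ ∈ (W ⊓ (Submodule.span ℝ {b₀})ᗮ : Submodule ℝ E) := by rw [h]; exact hbW g₀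
        have h2 := Submodule.mem_orthogonal_singleton_iff_inner_right.mp h1.2
        rw [hN] at h2; exact hN0 h2
      have := Submodule.finrank_lt_finrank_of_lt hlt
      omega
    obtain ⟨X, hX, hXg⟩ := ih _ hW' b' χ' (a / 2) (by positivity)
      (by
        intro g
        refine ⟨W.sub_mem (hbW g) (W.smul_mem _ (hbW g₀)), ?_⟩
        exact Submodule.mem_orthogonal_singleton_iff_inner_left.mpr (hπ0 _))
      (by
        intro g hg
        have hg' : π (b g) ≠ 0 := hg
        show a / 2 ≤ ‖π (b g)‖
        set m := round (p (b g)) with hm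
        have hne : b (g - m • g₀) ≠ 0 := by
          intro h
          apply hg'
          rw [← hπz g m, h]; simp [π, p]
        have h1 := hnear _ hne
        have h2 := hnorm (b (g - m • g₀))
        rw [hπz, hpz] at h2
        have h3 := hround g
        have h4 : (9 / 10 * ‖b₀‖) ^ 2 ≤ ‖b (g - m • g₀)‖ ^ 2 := by gcongr
        have h5 : (p (b g) - m) ^ 2 * ‖b₀‖ ^ 2 ≤ 1 / 4 * ‖b₀‖ ^ 2 := by gcongr
        have h6 : a ^ 2 ≤ ‖b₀‖ ^ 2 := by gcongr
        refine le_of_sq_le_sq ?_ (norm_nonneg _)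
        nlinarith)
      (by
        intro g hg
        have hg' : π (b g) = 0 := hg
        set m := round (p (b g)) with hm
        have hz : b (g - m • g₀) = 0 := by
          by_contra hne
          have h1 := hnear _ hne
          have h2 := hnorm (b (g - m • g₀))
          rw [hπz, hpz, hg', norm_zero] at h2
          have h3 := hround g
          have h4 : (9 / 10 * ‖b₀‖) ^ 2 ≤ ‖b (g - m • g₀)‖ ^ 2 := by gcongr
          have h5 : (p (b g) - m) ^ 2 * ‖b₀‖ ^ 2 ≤ 1 / 4 * ‖b₀‖ ^ 2 := by gcongr
          nlinarith [sq_pos_of_pos hb₀n]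
        have hpm : p (b g) = m := by
          have := hpz g m
          rw [hz] at this
          simp [p] at this
          simp only [p]; linarith
        obtain ⟨k, hk⟩ := hχ _ hz
        refine ⟨k + m * ⌊χ g₀⌋, ?_⟩
        show χ g - s * p (b g) = _
        rw [map_sub, map_zsmul, zsmul_eq_mul] at hk
        rw [hpm, hs, Int.fract]
        push_cast
        linarith)
    refine ⟨π X + (s / ‖b₀‖ ^ 2) • b₀, ?_, fun g => ?_⟩
    · have h1 : ‖π X‖ ≤ ‖X‖ := by
        refine le_of_sq_le_sq ?_ (norm_nonneg _)
        rw [hnorm X]; nlinarith [mul_nonneg (sq_nonneg (p X)) (sq_nonneg ‖b₀‖)]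
      have h2 : ‖(s / ‖b₀‖ ^ 2) • b₀‖ ≤ 1 / a := by
        rw [norm_smul, Real.norm_eq_abs, abs_of_nonneg (div_nonneg (Int.fract_nonneg _) (sq_nonneg _))]
        rw [div_mul_eq_mul_div, div_le_div_iff₀ (by positivity) ha]
        have := Int.fract_lt_one (χ g₀)
        have h0 := Int.fract_nonneg (χ g₀)
        calc s * ‖b₀‖ * a ≤ 1 * ‖b₀‖ * ‖b₀‖ := by gcongr
          _ = 1 * ‖b₀‖ ^ 2 := by ring
      have h3 : (2 ^ (r + 1) - 1) / a = (2 ^ r - 1) / (a / 2) + 1 / a := by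
        field_simp; ring
      rw [h3]
      exact (norm_add_le _ _).trans (add_le_add (h1.trans hX) h2)
    · obtain ⟨m, hm⟩ := hXg g
      refine ⟨m, ?_⟩
      have h1 : inner ℝ (π (b g)) X = χ g - s * p (b g) + m := hm
      rw [inner_add_right, ← hself, h1, inner_smul_right]
      simp only [p]; ring

lemma blich {ι : Type} [Fintype ι] (S : Set (ι → ℝ)) (hS : MeasurableSet S) (hfin : volume S ≠ ⊤) :
    ∃ y : ι → ℝ, volume S ≤ ({w : ι → ℤ | y + ir w ∈ S}.encard : ℝ≥0∞) := by
  classical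
  let F := ZSpan.fundamentalDomain (Pi.basisFun ℝ ι)
  have hF := ZSpan.isAddFundamentalDomain (Pi.basisFun ℝ ι) volume
  have hvol : volume F = 1 := by
    show volume (ZSpan.fundamentalDomain (Pi.basisFun ℝ ι)) = 1
    rw [ZSpan.fundamentalDomain_pi_basisFun, volume_pi_pi]; simp
  have : IsProbabilityMeasure (volume.restrict F) := ⟨by rw [Measure.restrict_apply_univ, hvol]⟩
  have : VAddInvariantMeasure (Submodule.span ℤ (range (Pi.basisFun ℝ ι))) (ι → ℝ) volume :=
    (inferInstance : VAddInvariantMeasure (Submodule.span ℤ (range (Pi.basisFun ℝ ι))).toAddSubgroup (ι → ℝ) volume)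
  have h1 := hF.lintegral_eq_tsum' (S.indicator 1)
  rw [lintegral_indicator_one hS] at h1
  rw [← lintegral_tsum] at h1
  swap
  · intro g
    exact ((measurable_one.indicator hS).comp (measurable_const_vadd _)).aemeasurable
  have h1' : volume S = ∫⁻ (a : ι → ℝ), ∑' (g : Submodule.span ℤ (range (Pi.basisFun ℝ ι))), S.indicator 1 (-g +ᵥ a) ∂(volume.restrict F) := h1
  obtain ⟨y, hy⟩ := exists_lintegral_le (μ := volume.restrict F) (by rw [← h1']; exact hfin)
  rw [← h1'] at hy
  refine ⟨y, hy.trans ?_⟩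
  let B : Set (Submodule.span ℤ (range (Pi.basisFun ℝ ι))) := {g | -g +ᵥ y ∈ S}
  have h2 : ∑' (g : Submodule.span ℤ (range (Pi.basisFun ℝ ι))), S.indicator (1 : (ι → ℝ) → ℝ≥0∞) (-g +ᵥ y) = (B.encard : ℝ≥0∞) := by
    rw [← ENNReal.tsum_set_one, tsum_subtype B (fun _ => (1 : ℝ≥0∞))]
    refine tsum_congr (fun g => ?_)
    by_cases h : -g +ᵥ y ∈ S
    · rw [indicator_of_mem h, indicator_of_mem (show g ∈ B from h)]; rfl
    · rw [indicator_of_notMem h, indicator_of_notMem (show g ∉ B from h)]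
  rw [h2]
  have hw : ∀ g : Submodule.span ℤ (range (Pi.basisFun ℝ ι)), ∃ w : ι → ℤ, ir w = -g.1 := by
    intro g
    obtain ⟨c, hc⟩ := (Submodule.mem_span_range_iff_exists_fun ℤ).mp g.2
    refine ⟨-c, ?_⟩
    rw [← hc]
    funext i
    simp [ir, Finset.sum_apply, Pi.single_apply]
  choose w hw using hw
  have hinj : Function.Injective w := by
    intro g g' h
    have h3 := hw g
    rw [h, hw g'] at h3
    exact Subtype.ext (neg_injective h3.symm)
  have h3 : (w '' B).encard = B.encard := hinj.encard_image B
  rw [← h3]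
  have h4 : (w '' B) ⊆ {w : ι → ℤ | y + ir w ∈ S} := by
    rintro _ ⟨g, hg, rfl⟩
    show y + ir (w g) ∈ S
    rw [hw, add_comm]
    exact hg
  exact_mod_cast encard_le_encard h4

lemma kron_pts {ι J : Type} [Fintype ι] [DecidableEq ι] [Fintype J] (ρ : J → ι → ℝ)
    (h : ∀ u : ι → ℤ, u ≠ 0 → ∃ j, 1 ≤ |ir u ⬝ᵥ ρ j|) (y : ι → ℝ) :
    ∃ X : J → ℝ, (∀ j, |X j| ≤ 2 ^ Fintype.card J) ∧ ∃ w : ι → ℤ, ∀ i, ∑ j, X j * ρ j i = y i + w i := by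
  let b : (ι → ℤ) →+ EuclideanSpace ℝ J := AddMonoidHom.mk' (fun u => WithLp.toLp 2 (fun j => ir u ⬝ᵥ ρ j)) (by
    intro u v
    ext j
    simp [ir, dotProduct, add_mul, Finset.sum_add_distrib])
  let χ : (ι → ℤ) →+ ℝ := AddMonoidHom.mk' (fun u => ir u ⬝ᵥ y) (by
    intro u v; simp [ir, dotProduct, add_mul, Finset.sum_add_distrib])
  have hge : ∀ u, u ≠ 0 → 1 ≤ ‖b u‖ := by
    intro u hu
    obtain ⟨j, hj⟩ := h u hu
    exact hj.trans (PiLp.norm_apply_le (b u) j)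
  obtain ⟨X, hX, hXg⟩ := kron (Fintype.card J) (⊤ : Submodule ℝ (EuclideanSpace ℝ J)) (by simp) b χ 1 one_pos
    (fun _ => Submodule.mem_top) (fun u hu => hge u (by rintro rfl; exact hu (map_zero b)))
    (fun u hu => by
      have : u = 0 := by
        by_contra hne
        have := hge u hne
        rw [hu, norm_zero] at this; linarith
      exact ⟨0, by rw [this, map_zero]; simp⟩)
  refine ⟨fun j => X j, fun j => ?_, ?_⟩
  · have := (PiLp.norm_apply_le X j).trans hX
    rw [Real.norm_eq_abs] at this; linarith
  · choose m hm using hXg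
    refine ⟨fun i => m (Pi.single i 1), fun i => ?_⟩
    have h1 := hm (Pi.single i 1)
    have hir : ir (Pi.single i 1 : ι → ℤ) = Pi.single i 1 := by
      funext k; by_cases hk : k = i
      · subst hk; simp [ir]
      · simp [ir, hk]
    have h2 : χ (Pi.single i 1) = y i := by
      show ir (Pi.single i 1 : ι → ℤ) ⬝ᵥ y = y i
      rw [hir]; simp
    rw [h2, PiLp.inner_apply] at h1
    rw [← h1]
    refine Finset.sum_congr rfl (fun j _ => ?_)
    show X j * ρ j i = X j * _
    rw [show (b (Pi.single i 1)) j = ir (Pi.single i 1 : ι → ℤ) ⬝ᵥ ρ j from rfl, hir]; simp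

/-- consequence at a good point -/
lemma good_cover {d : ℕ} {ι : Type} [Fintype ι] [DecidableEq ι] (g : (Fin d → ℝ) → ι → ℝ) (δ K T ε₁ : ℝ) (hε₁ : 0 < ε₁)
    (x : Fin d → ℝ) (h : ∀ u : ι → ℤ, u ≠ 0 → ∃ s j, ε₁ ≤ |ir u ⬝ᵥ row g δ K T s x j|) (y : ι → ℝ) :
    ∃ (α : ℝ) (β : Fin d → ℝ) (γ : ι → ℝ) (w : ι → ℤ), |α| ≤ (d + 1) * 2 ^ (d * (2 + Fintype.card ι)) ∧
      (∀ s, |β s| ≤ (d + 1) * 2 ^ (d * (2 + Fintype.card ι))) ∧ (∀ i, |γ i| ≤ (d + 1) * 2 ^ (d * (2 + Fintype.card ι))) ∧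
      ∀ i, (ε₁ * δ)⁻¹ * α * g x i + ∑ s, (ε₁ * K)⁻¹ * β s * fderiv ℝ g x (Pi.single s 1) i + (ε₁ * T)⁻¹ * γ i = y i + w i := by
  obtain ⟨X, hX, w, hw⟩ := kron_pts (J := Fin d × (Bool ⊕ ι)) (fun p => ε₁⁻¹ • row g δ K T p.1 x p.2)
    (by
      intro u hu
      obtain ⟨s, j, hs⟩ := h u hu
      refine ⟨(s, j), ?_⟩
      rw [dotProduct_smul, smul_eq_mul, abs_mul, abs_inv, abs_of_pos hε₁, le_inv_mul_iff₀ hε₁]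
      linarith) y
  have hc : Fintype.card (Fin d × (Bool ⊕ ι)) = d * (2 + Fintype.card ι) := by simp
  rw [hc] at hX
  set D : ℝ := 2 ^ (d * (2 + Fintype.card ι)) with hD
  have hD0 : 0 ≤ D := by positivity
  have hsum : ∀ j, |∑ s, X (s, j)| ≤ (d + 1) * D := by
    intro j
    refine (Finset.abs_sum_le_sum_abs _ _).trans ((Finset.sum_le_sum (fun s _ => hX (s, j))).trans ?_)
    rw [Finset.sum_const, Finset.card_univ, Fintype.card_fin, nsmul_eq_mul]; nlinarith
  refine ⟨∑ s, X (s, Sum.inl false), fun s => X (s, Sum.inl true), fun i => ∑ s, X (s, Sum.inr i), w, hsum _, ?_, fun i => hsum _, ?_⟩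
  · intro s
    have hd0 : (0 : ℝ) ≤ d := Nat.cast_nonneg d
    have := hX (s, Sum.inl true)
    nlinarith
  · intro i
    rw [← hw i, Fintype.sum_prod_type]
    simp only [Fintype.sum_sum_type, Fintype.sum_bool, row, Pi.smul_apply, smul_eq_mul]
    simp only [Finset.sum_add_distrib]
    have hT : ∑ s, ∑ i', X (s, Sum.inr i') * (ε₁⁻¹ * (T⁻¹ * (Pi.single i' 1 : ι → ℝ) i)) = (ε₁ * T)⁻¹ * ∑ s, X (s, Sum.inr i) := by
      rw [Finset.mul_sum]
      refine Finset.sum_congr rfl (fun s _ => ?_)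
      rw [Finset.sum_eq_single i]
      · simp; ring
      · intro b _ hb; simp [hb.symm]
      · simp
    rw [hT, Finset.mul_sum, Finset.sum_mul]
    have e1 : ∀ s, X (s, Sum.inl true) * (ε₁⁻¹ * (K⁻¹ * fderiv ℝ g x (Pi.single s 1) i)) =
        (ε₁ * K)⁻¹ * X (s, Sum.inl true) * fderiv ℝ g x (Pi.single s 1) i := by intro s; rw [mul_inv]; ring
    have e2 : ∀ s, X (s, Sum.inl false) * (ε₁⁻¹ * (δ⁻¹ * g x i)) = (ε₁ * δ)⁻¹ * X (s, Sum.inl false) * g x i := by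
      intro s; rw [mul_inv]; ring
    simp only [e1, e2]; ring

lemma compl_basis {ι J : Type} [Fintype ι] [Fintype J] {m : ℕ} (hc : Fintype.card J + m = Fintype.card ι)
    (fam : J → ι → ℝ) (hf : LinearIndependent ℝ fam) :
    ∃ (c : Fin m → ι → ℝ) (V : Module.Basis (J ⊕ Fin m) ℝ (ι → ℝ)), ⇑V = Sum.elim fam c := by
  classical
  obtain ⟨q, hq⟩ := Submodule.exists_isCompl (Submodule.span ℝ (range fam))
  have h1 := Submodule.finrank_add_eq_of_isCompl hq
  rw [finrank_span_eq_card hf, Module.finrank_fintype_fun_eq_card] at h1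
  have h2 : Module.finrank ℝ q = m := by omega
  let b := Module.finBasisOfFinrankEq ℝ q h2
  have hli : LinearIndependent ℝ (Sum.elim fam (fun i => (b i : ι → ℝ))) := by
    refine LinearIndependent.sum_type hf (b.linearIndependent.map' q.subtype (by simp)) ?_
    have hsub : Submodule.span ℝ (range (q.subtype ∘ b)) ≤ q := by
      rw [Submodule.span_le]; rintro _ ⟨i, rfl⟩; exact (b i).2
    exact hq.disjoint.mono_right hsub
  have hcard : Fintype.card (J ⊕ Fin m) = Module.finrank ℝ (ι → ℝ) := by
    rw [Module.finrank_fintype_fun_eq_card, Fintype.card_sum, Fintype.card_fin, hc]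
  by_cases hne : Nonempty (J ⊕ Fin m)
  · exact ⟨_, basisOfLinearIndependentOfCardEqFinrank hli hcard, coe_basisOfLinearIndependentOfCardEqFinrank hli hcard⟩
  · have := not_nonempty_iff.mp hne
    have h0 : Module.finrank ℝ (ι → ℝ) = 0 := by rw [← hcard]; exact Fintype.card_eq_zero
    have := Module.finrank_zero_iff.mp h0
    exact ⟨fun _ => 0, Module.Basis.empty _, Subsingleton.elim _ _⟩

lemma count_S {X : Type} [TopologicalSpace X] {d m : ℕ} {ι : Type} [Fintype ι] (x₀ : X)
    (hc : d + 1 + m = Fintype.card ι) (fam : X → Option (Fin d) → ι → ℝ)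
    (hcont : ∀ j, ContinuousAt (fun x => fam x j) x₀) (hf : LinearIndependent ℝ (fam x₀)) :
    ∃ Cb c : ℝ, 0 < Cb ∧ 0 < c ∧ ∀ᶠ x in nhds x₀, ∀ Q Y ε₂ : ℝ, 0 < Q → 0 < Y → 0 < ε₂ → ∀ z : ι → ℝ,
      ∃ y : ι → ℝ, ENNReal.ofReal (c * (Q * Y ^ d * ε₂ ^ m)) ≤ ({w : ι → ℤ | ∃ (α : ℝ) (β : Fin d → ℝ) (γ : ι → ℝ),
        |α| ≤ 1 ∧ (∀ s, |β s| ≤ 1) ∧ (∀ i, |γ i| ≤ Cb) ∧ ∀ i, y i + w i = z i + Q * α * fam x none i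
          + ∑ s, Y * β s * fam x (some s) i + ε₂ * γ i}.encard : ℝ≥0∞) := by
  classical
  obtain ⟨c, V, hV⟩ := compl_basis (m := m) (by simpa using hc) (fam x₀) hf
  have hcontdet : ContinuousAt (fun x => V.det (Sum.elim (fam x) c)) x₀ := by
    simp only [Module.Basis.det_apply]
    refine (Continuous.matrix_det continuous_id).continuousAt.comp ?_
    refine continuousAt_pi.mpr (fun i => continuousAt_pi.mpr (fun j => ?_))
    have hlin : Continuous (fun v : ι → ℝ => V.repr v i) :=
      LinearMap.continuous_of_finiteDimensional (V.coord i)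
    refine hlin.continuousAt.comp (f := fun x => Sum.elim (fam x) c j) ?_
    rcases j with j | j
    · exact hcont j
    · exact continuousAt_const
  have h1 : V.det (Sum.elim (fam x₀) c) = 1 := by rw [← hV]; exact Module.Basis.det_self V
  have hev : ∀ᶠ x in nhds x₀, 1 / 2 < V.det (Sum.elim (fam x) c) :=
    hcontdet.eventually (lt_mem_nhds (by show (1:ℝ)/2 < V.det (Sum.elim (fam x₀) c); rw [h1]; norm_num))
  have hvb : Bornology.IsBounded (ZSpan.fundamentalDomain V) := ZSpan.fundamentalDomain_isBounded V
  have hvf : volume (ZSpan.fundamentalDomain V) ≠ ⊤ := hvb.measure_lt_top.ne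
  have hv0 : volume (ZSpan.fundamentalDomain V) ≠ 0 := ZSpan.measure_fundamentalDomain_ne_zero V
  have hvpos := ENNReal.toReal_pos hv0 hvf
  refine ⟨1 + ∑ l, ‖c l‖, 1 / 2 * (volume (ZSpan.fundamentalDomain V)).toReal, by positivity, by positivity, ?_⟩
  filter_upwards [hev] with x hx Q Y ε₂ hQ hY hε z
  let sc : Option (Fin d) ⊕ Fin m → ℝ := Sum.elim (fun o => o.elim Q (fun _ => Y)) (fun _ => ε₂)
  let v : Option (Fin d) ⊕ Fin m → ι → ℝ := fun j => sc j • Sum.elim (fam x) c j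
  have hprod : ∏ j, sc j = Q * Y ^ d * ε₂ ^ m := by
    simp [sc, Fintype.prod_sum_type, Fintype.prod_option]
  have hdet : V.det v = (Q * Y ^ d * ε₂ ^ m) * V.det (Sum.elim (fam x) c) := by
    rw [← hprod]
    exact (V.det.map_smul_univ sc _).trans (by rw [smul_eq_mul])
  have hpos : 0 < Q * Y ^ d * ε₂ ^ m := by positivity
  have hun : IsUnit (V.det v) := by
    rw [isUnit_iff_ne_zero, hdet]
    have : (0:ℝ) < V.det (Sum.elim (fam x) c) := by linarith
    positivity
  obtain ⟨hli, hsp⟩ := (Module.Basis.is_basis_iff_det V).mpr hun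
  let b : Module.Basis (Option (Fin d) ⊕ Fin m) ℝ (ι → ℝ) := Module.Basis.mk hli hsp.ge
  have hb : ⇑b = v := Module.Basis.coe_mk _ _
  let S : Set (ι → ℝ) := (fun p => p - z) ⁻¹' (ZSpan.fundamentalDomain b)
  have hSm : MeasurableSet S := (ZSpan.fundamentalDomain_measurableSet b).preimage (measurable_id.sub_const z)
  have hSv : volume S = volume (ZSpan.fundamentalDomain b) := by
    have := measure_preimage_add_right (volume : Measure (ι → ℝ)) (-z) (ZSpan.fundamentalDomain b)
    simpa only [← sub_eq_add_neg] using this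
  have hvol := ZSpan.measure_fundamentalDomain b (volume : Measure (ι → ℝ)) V
  rw [hb] at hvol
  have hSfin : volume S ≠ ⊤ := by rw [hSv]; exact (ZSpan.fundamentalDomain_isBounded b).measure_lt_top.ne
  obtain ⟨y, hy⟩ := blich S hSm hSfin
  refine ⟨y, le_trans ?_ (hy.trans ?_)⟩
  · rw [hSv, hvol, ← ENNReal.ofReal_toReal hvf, ← ENNReal.ofReal_mul (abs_nonneg _)]
    apply ENNReal.ofReal_le_ofReal
    rw [ENNReal.toReal_ofReal hvpos.le, hdet, abs_of_pos (mul_pos hpos (by linarith))]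
    have : 1 / 2 * (Q * Y ^ d * ε₂ ^ m) ≤ (Q * Y ^ d * ε₂ ^ m) * V.det (Sum.elim (fam x) c) := by nlinarith
    nlinarith
  · have : {w : ι → ℤ | y + ir w ∈ S} ⊆ {w : ι → ℤ | ∃ (α : ℝ) (β : Fin d → ℝ) (γ : ι → ℝ),
        |α| ≤ 1 ∧ (∀ s, |β s| ≤ 1) ∧ (∀ i, |γ i| ≤ 1 + ∑ l, ‖c l‖) ∧ ∀ i, y i + w i = z i + Q * α * fam x none i
          + ∑ s, Y * β s * fam x (some s) i + ε₂ * γ i} := by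
      intro w hw
      have hw' : y + ir w - z ∈ ZSpan.fundamentalDomain b := hw
      rw [ZSpan.mem_fundamentalDomain] at hw'
      have hab : ∀ j, |b.repr (y + ir w - z) j| ≤ 1 := fun j => by
        rw [abs_of_nonneg (hw' j).1]; exact (hw' j).2.le
      have hs := b.sum_repr (y + ir w - z)
      rw [hb] at hs
      refine ⟨b.repr (y + ir w - z) (Sum.inl none), fun s => b.repr (y + ir w - z) (Sum.inl (some s)),
        fun i => ∑ l, b.repr (y + ir w - z) (Sum.inr l) * c l i, hab _, fun s => hab _, fun i => ?_, fun i => ?_⟩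
      · refine (Finset.abs_sum_le_sum_abs _ _).trans (le_trans (Finset.sum_le_sum (fun l _ => ?_)) (le_add_of_nonneg_left zero_le_one))
        rw [abs_mul]
        have := norm_le_pi_norm (c l) i
        rw [Real.norm_eq_abs] at this
        nlinarith [hab (Sum.inr l), abs_nonneg (c l i), abs_nonneg (b.repr (y + ir w - z) (Sum.inr l))]
      · have hi := congrFun hs i
        simp only [v, sc, Fintype.sum_sum_type, Fintype.sum_option, Finset.sum_apply, Pi.add_apply, Pi.smul_apply,
          smul_eq_mul, Sum.elim_inl, Sum.elim_inr, Option.elim, Pi.sub_apply, ir] at hi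
        rw [Finset.mul_sum]
        have e1 : ∀ a e k : ℝ, a * (e * k) = e * a * k := by intros; ring
        have e2 : ∀ a e k : ℝ, a * (e * k) = e * (a * k) := by intros; ring
        simp only [e2 _ ε₂, e1 _ Q, e1 _ Y] at hi
        show y i + (w i : ℝ) = _
        linarith
    exact_mod_cast encard_le_encard this

lemma fam_li {d n : ℕ} (f : (Fin d → ℝ) → Fin n → ℝ) (x₀ : Fin d → ℝ) (hf : DifferentiableAt ℝ f x₀)
    (hinj : Function.Injective (fderiv ℝ f x₀)) :
    LinearIndependent ℝ (fun o : Option (Fin d) => o.elim (gof f x₀) (fun s => fderiv ℝ (gof f) x₀ (Pi.single s 1))) := by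
  rw [Fintype.linearIndependent_iff]
  intro g hg
  simp only [Fintype.sum_option, Option.elim] at hg
  have h0 := congrFun hg 0
  simp [gof_fd0, gof, Finset.sum_apply] at h0
  rw [h0, zero_smul, zero_add] at hg
  have h1 : fderiv ℝ f x₀ (∑ s, g (some s) • Pi.single s 1) = 0 := by
    funext j
    have h2 := congrFun hg j.succ
    simp only [gof_fd f x₀ hf, Finset.sum_apply, Pi.smul_apply, Fin.cons_succ] at h2
    rw [map_sum]
    simpa [Finset.sum_apply] using h2
  have h2 := hinj (h1.trans (map_zero _).symm)
  rintro (_ | s)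
  · exact h0
  · have := congrFun h2 s
    simpa [Finset.sum_apply, Pi.single_apply] using this

lemma count_good {d n m : ℕ} (hm : d + m = n) (f : (Fin d → ℝ) → Fin n → ℝ) (x₀ : Fin d → ℝ) (hf : ContDiffAt ℝ 2 f x₀)
    (hinj : Function.Injective (fderiv ℝ f x₀)) :
    ∃ C₅ c : ℝ, 1 ≤ C₅ ∧ 0 < c ∧ ∀ᶠ x in nhds x₀, ∀ δ K T ε₁ : ℝ, 0 < δ → 0 < K → 0 < T → 0 < ε₁ →
      (∀ u : Fin (n + 1) → ℤ, u ≠ 0 → ∃ s j, ε₁ ≤ |ir u ⬝ᵥ row (gof f) δ K T s x j|) → ∀ z : Fin (n + 1) → ℝ,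
      ENNReal.ofReal (c * ((ε₁ * δ)⁻¹ * (ε₁ * K)⁻¹ ^ d * (ε₁ * T)⁻¹ ^ m)) ≤
       ({w : Fin (n + 1) → ℤ | ∃ (α : ℝ) (β : Fin d → ℝ) (γ : Fin (n + 1) → ℝ),
        |α| ≤ C₅ ∧ (∀ s, |β s| ≤ C₅) ∧ (∀ i, |γ i| ≤ C₅) ∧ ∀ i, (w i : ℝ) = z i + (ε₁ * δ)⁻¹ * α * gof f x i
          + ∑ s, (ε₁ * K)⁻¹ * β s * fderiv ℝ (gof f) x (Pi.single s 1) i + (ε₁ * T)⁻¹ * γ i}.encard : ℝ≥0∞) := by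
  have hg := gof_cd f x₀ 2 hf
  obtain ⟨Cb, c, hCb, hc, hev⟩ := count_S x₀ (m := m) (ι := Fin (n + 1)) (by simp; omega)
    (fun x o => o.elim (gof f x) (fun s => fderiv ℝ (gof f) x (Pi.single s 1)))
    (by
      rintro (_ | s)
      · exact hg.continuousAt
      · exact (hg.fderiv_right (m := 0) (by norm_num)).continuousAt.clm_apply continuousAt_const)
    (fam_li f x₀ (hf.differentiableAt (by norm_num)) hinj)
  obtain ⟨CN, hCN⟩ : ∃ CN : ℝ, CN = (d + 1) * 2 ^ (d * (2 + Fintype.card (Fin (n + 1)))) := ⟨_, rfl⟩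
  have hCN0 : 0 ≤ CN := by rw [hCN]; positivity
  refine ⟨1 + Cb + CN, c, by linarith, hc, ?_⟩
  filter_upwards [hev] with x hx δ K T ε₁ hδ hK hT hε₁ hgood z
  obtain ⟨y, hy⟩ := hx (ε₁ * δ)⁻¹ (ε₁ * K)⁻¹ (ε₁ * T)⁻¹ (by positivity) (by positivity) (by positivity) z
  refine hy.trans ?_
  obtain ⟨α', β', γ', w', hα', hβ', hγ', hw'⟩ := good_cover (gof f) δ K T ε₁ hε₁ x hgood y
  rw [← hCN] at hα' hβ' hγ'
  have hinjw : Function.Injective (fun w : Fin (n + 1) → ℤ => w - w') := sub_left_injective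
  rw [← hinjw.encard_image]
  refine ENat.toENNReal_le.mpr (encard_le_encard ?_)
  rintro _ ⟨w, ⟨α, β, γ, hα, hβ, hγ, hw⟩, rfl⟩
  refine ⟨α - α', β - β', γ - γ', ?_, fun s => ?_, fun i => ?_, fun i => ?_⟩
  · exact (abs_sub _ _).trans (by linarith)
  · exact (abs_sub _ _).trans (by linarith [hβ s, hβ' s])
  · exact (abs_sub _ _).trans (by linarith [hγ i, hγ' i])
  · have h1 := hw i
    have h2 := hw' i
    simp only [Option.elim] at h1
    simp only [Pi.sub_apply, mul_sub, sub_mul, Finset.sum_sub_distrib, Int.cast_sub]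
    linarith

lemma inj_of_rank {d n : ℕ} (A : (Fin d → ℝ) →L[ℝ] (Fin n → ℝ)) (h : LinearMap.rank A.toLinearMap = (d : Cardinal)) :
    Function.Injective A := by
  have h1 : Module.finrank ℝ (LinearMap.range A.toLinearMap) = d := by
    rw [Module.finrank]; rw [LinearMap.rank] at h; rw [h]; simp
  have h2 := LinearMap.finrank_range_add_finrank_ker A.toLinearMap
  rw [h1, Module.finrank_fintype_fun_eq_card, Fintype.card_fin] at h2
  have h3 : Module.finrank ℝ (LinearMap.ker A.toLinearMap) = 0 := by omega
  exact LinearMap.ker_eq_bot.mp (Submodule.finrank_eq_zero.mp h3)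

lemma loc_an {d n : ℕ} (f : (Fin d → ℝ) → Fin n → ℝ) (x₀ : Fin d → ℝ) (hf : ContDiffAt ℝ 2 f x₀)
    (hinj : Function.Injective (fderiv ℝ f x₀)) :
    ∃ ρ F C₂ L : ℝ, 0 < ρ ∧ 1 ≤ F ∧ 0 ≤ C₂ ∧ 1 ≤ L ∧
      (∀ x ∈ Metric.ball x₀ ρ, DifferentiableAt ℝ f x ∧ ‖f x‖ ≤ F ∧ ‖fderiv ℝ f x‖ ≤ F) ∧
      (∀ x ∈ Metric.ball x₀ ρ, ∀ y ∈ Metric.ball x₀ ρ,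
        ‖f y - f x - fderiv ℝ f x (y - x)‖ ≤ C₂ * ‖y - x‖ ^ 2 ∧ ‖y - x‖ ≤ L * ‖f y - f x‖) := by
  have h1 : ∀ᶠ x in nhds x₀, DifferentiableAt ℝ f x := by
    filter_upwards [hf.eventually (by simp)] with x hx using hx.differentiableAt (by norm_num)
  have hd : ContDiffAt ℝ 1 (fderiv ℝ f) x₀ := hf.fderiv_right (by norm_num)
  have h2 : ∀ᶠ x in nhds x₀, ‖f x‖ < ‖f x₀‖ + 1 :=
    hf.continuousAt.norm.eventually (gt_mem_nhds (lt_add_one _))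
  have h3 : ∀ᶠ x in nhds x₀, ‖fderiv ℝ f x‖ < ‖fderiv ℝ f x₀‖ + 1 :=
    hd.continuousAt.norm.eventually (gt_mem_nhds (lt_add_one _))
  obtain ⟨K, t, ht, hK⟩ := hd.exists_lipschitzOnWith
  obtain ⟨A, hA0, hA⟩ := (fderiv ℝ f x₀).toLinearMap.exists_antilipschitzWith (LinearMap.ker_eq_bot.mpr hinj)
  have hA1 : ∀ v, ‖v‖ ≤ A * ‖fderiv ℝ f x₀ v‖ := fun v => by
    simpa using hA.le_mul_dist v 0
  have hApos : (0 : ℝ) < A := by exact_mod_cast hA0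
  have h4 := (hf.hasStrictFDerivAt (by norm_num)).isLittleO.bound (show (0:ℝ) < (2 * (A:ℝ))⁻¹ by positivity)
  rw [nhds_prod_eq, eventually_prod_iff] at h4
  obtain ⟨pa, ha, pb, hb, hab⟩ := h4
  have hall := h1.and (h2.and (h3.and ((show ∀ᶠ x in nhds x₀, x ∈ t from ht).and (ha.and hb))))
  obtain ⟨ρ, hρ, hall⟩ := Metric.eventually_nhds_iff_ball.mp hall
  refine ⟨ρ, ‖f x₀‖ + ‖fderiv ℝ f x₀‖ + 1, K, 2 * A + 1, hρ, by linarith [norm_nonneg (f x₀), norm_nonneg (fderiv ℝ f x₀)],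
    K.2, by linarith, fun x hx => ?_, fun x hx y hy => ⟨?_, ?_⟩⟩
  · obtain ⟨a, b, c, -⟩ := hall x hx
    exact ⟨a, by linarith [norm_nonneg (fderiv ℝ f x₀)], by linarith [norm_nonneg (f x₀)]⟩
  · have hseg : segment ℝ x y ⊆ Metric.ball x₀ ρ := (convex_ball x₀ ρ).segment_subset hx hy
    have := (convex_segment x y).norm_image_sub_le_of_norm_fderiv_le' (𝕜 := ℝ) (f := f) (φ := fderiv ℝ f x) (C := K * ‖y - x‖)
      (fun z hz => (hall z (hseg hz)).1) (fun z hz => by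
        have e := hK.dist_le_mul z (hall z (hseg hz)).2.2.2.1 x (hall x hx).2.2.2.1
        rw [dist_eq_norm, dist_eq_norm] at e
        refine e.trans (mul_le_mul_of_nonneg_left ?_ K.2)
        obtain ⟨θ, hθ, rfl⟩ := (segment_eq_image' ℝ x y ▸ hz)
        rw [add_sub_cancel_left, norm_smul, Real.norm_eq_abs, abs_of_nonneg hθ.1]
        nlinarith [norm_nonneg (y - x), hθ.2]) (left_mem_segment ℝ x y) (right_mem_segment ℝ x y)
    refine this.trans (le_of_eq (by ring))
  · have e := hab (hall y hy).2.2.2.2.1 (hall x hx).2.2.2.2.2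
    have e1 := hA1 (y - x)
    simp only at e
    have e2 : ‖fderiv ℝ f x₀ (y - x)‖ ≤ ‖f y - f x‖ + (2 * (A:ℝ))⁻¹ * ‖y - x‖ := by
      have := norm_sub_norm_le (fderiv ℝ f x₀ (y - x)) (f y - f x)
      rw [norm_sub_rev (fderiv ℝ f x₀ (y - x))] at this
      linarith
    have e3 : (A : ℝ) * ((2 * (A:ℝ))⁻¹ * ‖y - x‖) = ‖y - x‖ / 2 := by field_simp
    nlinarith [mul_le_mul_of_nonneg_left e2 hApos.le, norm_nonneg (f y - f x)]

lemma pt_lem {d n : ℕ} (f : (Fin d → ℝ) → Fin n → ℝ) (x : Fin d → ℝ) (hf : DifferentiableAt ℝ f x) (θ : Fin n → ℝ)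
    (C₅ F H Q Y ε₂ : ℝ) (hF : ‖f x‖ ≤ F) (hC : 1 ≤ C₅) (hH : 0 < H) (hQ : 0 ≤ Q) (hY : 0 ≤ Y) (hε : 0 ≤ ε₂)
    (hsm : C₅ * (Q + ε₂) ≤ 3 / 10 * H) (w : Fin (n + 1) → ℤ) (α : ℝ) (β : Fin d → ℝ) (γ : Fin (n + 1) → ℝ)
    (hα : |α| ≤ C₅) (hβ : ∀ s, |β s| ≤ C₅) (hγ : ∀ i, |γ i| ≤ C₅)
    (hw : ∀ i, (w i : ℝ) = (H * (1 + Real.exp (-1)) / 2 * gof f x i - (Fin.cons 0 θ : Fin (n + 1) → ℝ) i) + Q * α * gof f x i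
          + ∑ s, Y * β s * fderiv ℝ (gof f) x (Pi.single s 1) i + ε₂ * γ i) :
    Real.exp (-1) * H ≤ w 0 ∧ (w 0 : ℝ) ≤ H ∧ ∃ u : Fin d → ℝ, ‖u‖ ≤ 3 * C₅ * Y / H ∧
      ‖(fun j => ((w j.succ : ℝ) + θ j) / (w 0 : ℝ)) - f x - fderiv ℝ f x u‖ ≤ 3 * ε₂ * C₅ * (1 + F) / H := by
  have he1 : Real.exp (-1) < 4 / 10 := by
    rw [Real.exp_neg, inv_lt_comm₀ (Real.exp_pos _) (by norm_num)]
    linarith [Real.exp_one_gt_d9]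
  have he2 : 1 / 3 < Real.exp (-1) := by
    rw [Real.exp_neg, lt_inv_comm₀ (by norm_num) (Real.exp_pos _)]
    linarith [Real.exp_one_lt_d9]
  have h0 := hw 0
  simp only [gof_fd0, gof, Fin.cons_zero, mul_zero, Finset.sum_const_zero, mul_one, sub_zero, add_zero] at h0
  have hb : |Q * α + ε₂ * γ 0| ≤ 3 / 10 * H := by
    refine (abs_add_le _ _).trans ?_
    rw [abs_mul, abs_mul, abs_of_nonneg hQ, abs_of_nonneg hε]
    nlinarith [mul_le_mul_of_nonneg_left hα hQ, mul_le_mul_of_nonneg_left (hγ 0) hε]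
  rw [abs_le] at hb
  have hq1 : Real.exp (-1) * H ≤ w 0 := by rw [h0]; nlinarith
  have hq2 : (w 0 : ℝ) ≤ H := by rw [h0]; nlinarith
  have hq3 : H / 3 ≤ w 0 := by nlinarith
  have hq0 : (0:ℝ) < w 0 := by linarith
  have hinv : ∀ a : ℝ, 0 ≤ a → a / w 0 ≤ 3 * a / H := by
    intro a ha
    rw [div_le_div_iff₀ hq0 hH]; nlinarith
  refine ⟨hq1, hq2, fun s => Y * β s / w 0, ?_, ?_⟩
  · refine (pi_norm_le_iff_of_nonneg (by positivity)).mpr (fun s => ?_)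
    rw [Real.norm_eq_abs, abs_div, abs_of_pos hq0, abs_mul, abs_of_nonneg hY]
    refine (hinv _ (by positivity)).trans ?_
    have := mul_le_mul_of_nonneg_left (hβ s) hY
    gcongr ?_ / H
    linarith
  · have hF0 : 0 ≤ F := (norm_nonneg _).trans hF
    refine (pi_norm_le_iff_of_nonneg (by positivity)).mpr (fun j => ?_)
    have hj := hw j.succ
    simp only [gof_fd f x hf, gof, Fin.cons_succ] at hj
    have hlin : fderiv ℝ f x (fun s => Y * β s / w 0) j = (∑ s, Y * β s * fderiv ℝ f x (Pi.single s 1) j) / w 0 := by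
      have : (fun s => Y * β s / w 0) = ∑ s, (Y * β s / w 0) • (Pi.single s 1 : Fin d → ℝ) := by
        funext k; simp [Finset.sum_apply, Pi.single_apply]
      rw [this, map_sum, Finset.sum_apply, Finset.sum_div]
      refine Finset.sum_congr rfl (fun s _ => ?_)
      rw [map_smul, Pi.smul_apply, smul_eq_mul]; ring
    have hval : ((fun j => ((w j.succ : ℝ) + θ j) / (w 0 : ℝ)) - f x - fderiv ℝ f x (fun s => Y * β s / w 0)) j
        = ε₂ * (γ j.succ - γ 0 * f x j) / w 0 := by
      simp only [Pi.sub_apply, hlin]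
      rw [eq_div_iff hq0.ne', sub_mul, sub_mul, div_mul_cancel₀ _ hq0.ne', div_mul_cancel₀ _ hq0.ne', hj, h0]
      ring
    rw [hval, Real.norm_eq_abs, abs_div, abs_of_pos hq0, abs_mul, abs_of_nonneg hε]
    refine (hinv _ (by positivity)).trans ?_
    have h1 : |γ j.succ - γ 0 * f x j| ≤ C₅ * (1 + F) := by
      refine (abs_sub _ _).trans ?_
      rw [abs_mul]
      have e1 := (norm_le_pi_norm (f x) j).trans hF
      rw [Real.norm_eq_abs] at e1
      nlinarith [hγ 0, hγ j.succ, mul_le_mul (hγ 0) e1 (abs_nonneg _) (by linarith)]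
    have := mul_le_mul_of_nonneg_left h1 hε
    gcongr ?_ / H
    linarith

lemma dcount {d n : ℕ} {W : Type} (N : Finset W) (f : (Fin d → ℝ) → Fin n → ℝ) (P : W → Fin n → ℝ) (G : Set (Fin d → ℝ))
    (L D : ℝ) (hL : 0 ≤ L) (hlip : ∀ x ∈ G, ∀ y ∈ G, ‖y - x‖ ≤ L * ‖f y - f x‖) (N₀ : ℝ≥0∞)
    (h : ∀ x ∈ G, N₀ ≤ ({w | w ∈ N ∧ ‖f x - P w‖ ≤ D}.encard : ℝ≥0∞)) :
    N₀ * volume G ≤ N.card * volume (Metric.closedBall (0 : Fin d → ℝ) (2 * L * D)) := by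
  classical
  have hex : ∀ w, ∃ a : Fin d → ℝ, ∀ x ∈ G, ‖f x - P w‖ ≤ D → x ∈ Metric.closedBall a (2 * L * D) := by
    intro w
    by_cases hne : ∃ a ∈ G, ‖f a - P w‖ ≤ D
    · obtain ⟨a, ha, haD⟩ := hne
      refine ⟨a, fun x hx hxD => ?_⟩
      rw [mem_closedBall_iff_norm]
      refine (hlip a ha x hx).trans ?_
      have : ‖f x - f a‖ ≤ D + D := by
        rw [← sub_sub_sub_cancel_right (f x) (f a) (P w)]
        exact (norm_sub_le _ _).trans (by linarith)
      nlinarith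
    · push Not at hne
      exact ⟨0, fun x hx hxD => absurd hxD (not_le.mpr (hne x hx))⟩
  choose a ha using hex
  let φ : (Fin d → ℝ) → ℝ≥0∞ := fun x => ∑ w ∈ N, (Metric.closedBall (a w) (2 * L * D)).indicator 1 x
  have hφ : Measurable φ := Finset.measurable_sum _ (fun w _ => measurable_one.indicator Metric.isClosed_closedBall.measurableSet)
  have h1 : G ⊆ {x | N₀ ≤ φ x} := by
    intro x hx
    refine (h x hx).trans ?_
    have e : {w | w ∈ N ∧ ‖f x - P w‖ ≤ D} = ((N.filter (fun w => ‖f x - P w‖ ≤ D) : Finset W) : Set W) := by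
      ext w; simp
    rw [e, Set.encard_coe_eq_coe_finsetCard, ENat.toENNReal_coe, Finset.card_filter, Nat.cast_sum]
    refine Finset.sum_le_sum (fun w _ => ?_)
    by_cases hw : ‖f x - P w‖ ≤ D
    · rw [if_pos hw, indicator_of_mem (ha w x hx hw)]; simp
    · rw [if_neg hw]; simp
  calc N₀ * volume G ≤ N₀ * volume {x | N₀ ≤ φ x} := by gcongr
    _ ≤ ∫⁻ x, φ x := mul_meas_ge_le_lintegral hφ N₀
    _ = ∑ w ∈ N, volume (Metric.closedBall (a w) (2 * L * D)) := by
        rw [lintegral_finsetSum _ (fun w _ => measurable_one.indicator Metric.isClosed_closedBall.measurableSet)]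
        refine Finset.sum_congr rfl (fun w _ => ?_)
        rw [lintegral_indicator_one Metric.isClosed_closedBall.measurableSet]
    _ = _ := by
        have : ∀ w, volume (Metric.closedBall (a w) (2 * L * D)) = volume (Metric.closedBall (0 : Fin d → ℝ) (2 * L * D)) :=
          fun w => Measure.addHaar_closedBall_center _ _ _
        simp only [this, Finset.sum_const, nsmul_eq_mul]

lemma eta_pow {k d : ℕ} (hk : 1 ≤ k) (C t ε : ℝ) (hC : 1 ≤ C) (ht : 0 ≤ t) (h : C * Real.exp (-t * etaND (k + 1) d) ≤ ε) :
    C ≤ Real.exp t ^ 3 * ε ^ (2 * k + 1) := by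
  have hk' : (1 : ℝ) ≤ k := by exact_mod_cast hk
  have hη : etaND (k + 1) d * (2 * k + 1) ≤ 3 := by
    rw [etaND]; push_cast
    split_ifs
    · rw [add_sub_cancel_right, div_mul_eq_mul_div, div_le_iff₀ (by linarith)]; linarith
    · rw [show 2 * ((k : ℝ) + 1) - 1 = 2 * k + 1 by ring, div_mul_cancel₀ _ (by positivity)]
  have h1 : (C * Real.exp (-t * etaND (k + 1) d)) ^ (2 * k + 1) ≤ ε ^ (2 * k + 1) := by gcongr
  have h2 : C * Real.exp (-(3 * t)) ≤ (C * Real.exp (-t * etaND (k + 1) d)) ^ (2 * k + 1) := by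
    rw [mul_pow, ← Real.exp_nat_mul]
    gcongr
    · exact le_self_pow₀ hC (by omega)
    · push_cast; nlinarith
  have h3 : Real.exp t ^ 3 = Real.exp (3 * t) := by rw [← Real.exp_nat_mul]; norm_num
  rw [h3]
  calc C = Real.exp (3 * t) * (C * Real.exp (-(3 * t))) := by
        rw [mul_left_comm, ← Real.exp_add]; simp
    _ ≤ _ := by gcongr; exact h2.trans h1

lemma params {k d : ℕ} (hk : 1 ≤ k) (ε₁ c₃ cQ cY cε : ℝ) (h1 : 0 < ε₁) (h3 : 0 < c₃) (hQ : 0 < cQ) (hY : 0 < cY) (hε : 0 < cε) :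
    ∃ C : ℝ, 1 ≤ C ∧ ∀ κ, 0 < κ → ∃ M : ℝ, ∀ t, M ≤ t → 0 ≤ t → ∀ ε, 0 < ε → ε < 1 → C * Real.exp (-t * etaND (k + 1) d) ≤ ε →
      ∀ δ K T, δ = (ε₁ * (cQ * Real.exp t))⁻¹ → K = (ε₁ * √(cY * ε * Real.exp t))⁻¹ → T = (ε₁ * (cε * ε))⁻¹ →
      δ ≤ κ ∧ δ * (K * T ^ (k - 1)) ≤ κ ∧ δ * (K * T ^ k) ≤ c₃ := by
  obtain ⟨A, hA⟩ : ∃ A : ℝ, A = (c₃ * (ε₁ * cQ) * ε₁ * (ε₁ * cε) ^ k)⁻¹ ^ 2 / cY := ⟨_, rfl⟩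
  refine ⟨max 1 A, le_max_left _ _, fun κ hκ => ?_⟩
  obtain ⟨T₁, hT₁⟩ : ∃ T₁ : ℝ, T₁ = max 1 (c₃ / κ) := ⟨_, rfl⟩
  have hT1 : 1 ≤ T₁ := hT₁ ▸ le_max_left _ _
  have hT1' : c₃ / κ ≤ T₁ := hT₁ ▸ le_max_right _ _
  refine ⟨max (T₁ ^ (k - 1) / (ε₁ * cQ * κ)) (cε * T₁ / (ε₁ * cY)), fun t ht ht0 ε he he1 hC δ K T hδ hK hT => ?_⟩
  have hHt : t ≤ Real.exp t := by linarith [Real.add_one_le_exp t]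
  have hA2 := eta_pow hk _ t ε (le_max_left _ _) ht0 hC
  have hH0 := Real.exp_pos t
  have hH1 : T₁ ^ (k - 1) / (ε₁ * cQ * κ) ≤ Real.exp t := ((le_max_left _ _).trans ht).trans hHt
  have hH2 : cε * T₁ / (ε₁ * cY) ≤ Real.exp t := ((le_max_right _ _).trans ht).trans hHt
  generalize Real.exp t = H at *
  have hA3 : A ≤ H ^ 3 * ε ^ (2 * k + 1) := (le_max_right _ _).trans hA2
  have hδ0 : 0 < δ := by rw [hδ]; positivity
  have hs0 : 0 < √(cY * ε * H) := by positivity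
  have hK0 : 0 < K := by rw [hK]; positivity
  have hT0 : 0 < T := by rw [hT]; positivity
  have hpow : 1 ≤ T₁ ^ (k - 1) := one_le_pow₀ hT1
  have hδκ : δ * T₁ ^ (k - 1) ≤ κ := by
    rw [div_le_iff₀ (by positivity)] at hH1
    rw [hδ, inv_mul_le_iff₀ (by positivity)]; linarith
  have hmain : δ * (K * T ^ k) ≤ c₃ := by
    have e1 : δ * (K * T ^ k) = ((ε₁ * cQ) * ε₁ * (ε₁ * cε) ^ k)⁻¹ * (H * √(cY * ε * H) * ε ^ k)⁻¹ := by
      rw [hδ, hK, hT, ← mul_assoc ε₁ cε ε, inv_pow, mul_pow (ε₁ * cε) ε]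
      rw [← mul_inv, ← mul_inv, ← mul_inv]; congr 1; ring
    have e2 : (c₃ * (ε₁ * cQ) * ε₁ * (ε₁ * cε) ^ k)⁻¹ ≤ H * √(cY * ε * H) * ε ^ k := by
      refine (sq_le_sq₀ (by positivity) (by positivity)).mp ?_
      rw [hA, div_le_iff₀ hY] at hA3
      refine hA3.trans (le_of_eq ?_)
      rw [mul_pow, mul_pow, Real.sq_sqrt (by positivity)]; ring
    rw [e1, ← mul_inv, inv_le_comm₀ (by positivity) h3]
    have e3 : c₃⁻¹ = (c₃ * (ε₁ * cQ) * ε₁ * (ε₁ * cε) ^ k)⁻¹ * (ε₁ * cQ * ε₁ * (ε₁ * cε) ^ k) := by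
      field_simp
    rw [e3, mul_comm]
    gcongr
  refine ⟨by nlinarith, ?_, hmain⟩
  by_cases hc : T₁ ≤ T
  · have e : δ * (K * T ^ (k - 1)) * T = δ * (K * T ^ k) := by
      rw [mul_assoc, mul_assoc, ← pow_succ, Nat.sub_add_cancel hk]
    have e2 : c₃ ≤ κ * T := by
      have := hT1'.trans hc
      rw [div_le_iff₀ hκ] at this; linarith
    exact le_of_mul_le_mul_right (e.le.trans (hmain.trans e2)) hT0
  · push Not at hc
    have hK1 : K ≤ 1 := by
      rw [hK]
      apply inv_le_one_of_one_le₀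
      rw [hT, inv_lt_iff_one_lt_mul₀ (by positivity)] at hc
      rw [div_le_iff₀ (by positivity)] at hH2
      have : (1:ℝ) ≤ (ε₁ * √(cY * ε * H)) ^ 2 := by
        rw [mul_pow, Real.sq_sqrt (by positivity)]
        have e4 := mul_le_mul_of_nonneg_left hH2 (show 0 ≤ ε₁ * ε by positivity)
        nlinarith
      nlinarith [mul_pos h1 hs0]
    calc δ * (K * T ^ (k - 1)) ≤ δ * (1 * T₁ ^ (k - 1)) := by gcongr
      _ ≤ κ := by rw [one_mul]; exact hδκ

lemma Nstar_fin {d n : ℕ} (f : (Fin d → ℝ) → Fin n → ℝ) (θ : Fin n → ℝ) (z : Fin d → ℝ) (r ε t F : ℝ) (hr : 0 < r)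
    (hF : ∀ x ∈ Metric.ball z r, ‖f x‖ ≤ F) : (NstarSet f θ (Metric.ball z r) ε t).Finite := by
  have hF0 : 0 ≤ F := (norm_nonneg _).trans (hF z (Metric.mem_ball_self hr))
  obtain ⟨D, hD⟩ : ∃ D, D = F + (|ε / Real.exp t| + 1) := ⟨_, rfl⟩
  have hfin : ((Set.pi univ (fun j : Fin n => Icc ⌈-(D * Real.exp t) - θ j⌉ ⌊D * Real.exp t - θ j⌋)) ×ˢ Icc (0:ℤ) ⌊Real.exp t⌋).Finite :=
    (Set.Finite.pi' (fun j => finite_Icc _ _) |>.subset (by intro p hp j; exact hp j (mem_univ j))).prod (finite_Icc _ _)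
  refine hfin.subset ?_
  rintro ⟨p, q⟩ ⟨h1, h2, h3⟩
  simp only at h1 h2 h3
  have hq0 : (0 : ℝ) < q := (Real.exp_pos _).trans_le h1
  obtain ⟨_, ⟨x, hx, rfl⟩, hlt⟩ := exists_lt_of_csInf_lt (by exact (Metric.nonempty_ball.mpr hr).image _)
    (h3.trans_lt (lt_of_le_of_lt (le_abs_self _) (lt_add_one _)))
  refine ⟨fun j _ => ?_, ⟨by exact_mod_cast hq0.le, Int.le_floor.mpr h2⟩⟩
  have e1 := (norm_le_pi_norm _ j).trans hlt.le
  have e2 := (norm_le_pi_norm (f x) j).trans (hF x hx)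
  simp only [Real.norm_eq_abs] at e1 e2
  have e3 : |((p j : ℝ) + θ j) / q| ≤ D := by
    rw [abs_le] at e1 e2 ⊢
    constructor <;> linarith [e1.1, e1.2, e2.1, e2.2]
  have hD0 : 0 ≤ D := (abs_nonneg _).trans e3
  rw [abs_div, abs_of_pos hq0, div_le_iff₀ hq0] at e3
  have e4 := abs_le.mp (e3.trans (mul_le_mul_of_nonneg_left h2 hD0))
  exact ⟨Int.ceil_le.mpr (by linarith [e4.1]), Int.le_floor.mpr (by linarith [e4.2])⟩

set_option maxHeartbeats 1600000 in
lemma core {d n m : ℕ} (f : (Fin d → ℝ) → Fin n → ℝ) (θ : Fin n → ℝ) (z : Fin d → ℝ)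
    (r F C₂ L C₅ c₄ ε₁ cQ cY cε t ε δ K T : ℝ) (hr : 0 < r) (hF1 : 1 ≤ F) (hC₂ : 0 ≤ C₂) (hL : 1 ≤ L) (hC₅ : 1 ≤ C₅) (hc₄ : 0 < c₄)
    (hε₁ : 0 < ε₁) (hcQ : 0 < cQ) (hcY : 0 < cY) (hcε : 0 < cε) (ht : 0 ≤ t) (hε : 0 < ε) (hε' : ε < 1)
    (hδ : δ = (ε₁ * (cQ * Real.exp t))⁻¹) (hK : K = (ε₁ * √(cY * ε * Real.exp t))⁻¹) (hT : T = (ε₁ * (cε * ε))⁻¹)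
    (h1 : ∀ x ∈ Metric.ball z r, DifferentiableAt ℝ f x ∧ ‖f x‖ ≤ F ∧ ‖fderiv ℝ f x‖ ≤ F)
    (h2 : ∀ x ∈ Metric.ball z r, ∀ y ∈ Metric.ball z r,
        ‖f y - f x - fderiv ℝ f x (y - x)‖ ≤ C₂ * ‖y - x‖ ^ 2 ∧ ‖y - x‖ ≤ L * ‖f y - f x‖)
    (q1 : C₅ * (cQ + cε) ≤ 3 / 10) (q2 : 18 * C₅ ^ 2 * (C₂ + 1) * cY ≤ 1) (q3 : 6 * C₅ * (1 + F) * cε ≤ 1)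
    (hsm : 3 * C₅ * √(cY * ε * Real.exp t) / Real.exp t < r / 2)
    (G : Set (Fin d → ℝ)) (hG : G ⊆ Metric.closedBall z (r / 2))
    (hGv : 2⁻¹ * volume (Metric.closedBall z (r / 2)) ≤ volume G)
    (hcount : ∀ x ∈ G, ∀ z : Fin (n + 1) → ℝ,
      ENNReal.ofReal (c₄ * ((ε₁ * δ)⁻¹ * (ε₁ * K)⁻¹ ^ d * (ε₁ * T)⁻¹ ^ m)) ≤
       ({w : Fin (n + 1) → ℤ | ∃ (α : ℝ) (β : Fin d → ℝ) (γ : Fin (n + 1) → ℝ),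
        |α| ≤ C₅ ∧ (∀ s, |β s| ≤ C₅) ∧ (∀ i, |γ i| ≤ C₅) ∧ ∀ i, (w i : ℝ) = z i + (ε₁ * δ)⁻¹ * α * gof f x i
          + ∑ s, (ε₁ * K)⁻¹ * β s * fderiv ℝ (gof f) x (Pi.single s 1) i + (ε₁ * T)⁻¹ * γ i}.encard : ℝ≥0∞)) :
    c₄ * cQ * cε ^ m / (2 * (8 * L * (3 * C₅ * F + 3 * C₅ * (1 + F) * cε / √cY)) ^ d) * ε ^ m * Real.exp t ^ (d + 1) * (2 * r) ^ d
      ≤ (Nstar f θ (Metric.ball z r) ε t : ℝ) := by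
  have hH1 : 1 ≤ Real.exp t := Real.one_le_exp ht
  have hexp : Real.exp (t - 1) = Real.exp (-1) * Real.exp t := by rw [← Real.exp_add]; ring_nf
  have hfin := Nstar_fin f θ z r ε t F hr (fun x hx => (h1 x hx).2.1)
  obtain ⟨C₁, hC₁⟩ : ∃ C₁, C₁ = 3 * C₅ * F + 3 * C₅ * (1 + F) * cε / √cY := ⟨_, rfl⟩
  have hsY : 0 < √cY := by positivity
  have hC₁0 : 0 < C₁ := by rw [hC₁]; positivity
  obtain ⟨H, hH⟩ : ∃ H, H = Real.exp t := ⟨_, rfl⟩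
  rw [← hH] at hδ hK hsm hH1 hexp
  have hH0 : 0 < H := by linarith
  obtain ⟨Y, hY⟩ : ∃ Y, Y = √(cY * ε * H) := ⟨_, rfl⟩
  have hY0 : 0 < Y := by rw [hY]; positivity
  have hY2 : Y ^ 2 = cY * ε * H := by rw [hY, Real.sq_sqrt (by positivity)]
  have hYε : √cY * ε ≤ Y := by
    rw [hY]; apply Real.le_sqrt_of_sq_le
    rw [mul_pow, Real.sq_sqrt hcY.le]
    have : ε ^ 2 ≤ ε * H := by nlinarith
    nlinarith
  rw [← hY] at hK hsm
  have eQ : (ε₁ * δ)⁻¹ = cQ * H := by rw [hδ]; field_simp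
  have eY : (ε₁ * K)⁻¹ = Y := by rw [hK]; field_simp
  have eT : (ε₁ * T)⁻¹ = cε * ε := by rw [hT]; field_simp
  simp only [eQ, eY, eT] at hcount
  have hGb : ∀ x ∈ G, dist x z ≤ r / 2 := fun x hx => hG hx
  have hGball : ∀ x ∈ G, x ∈ Metric.ball z r := fun x hx => by
    rw [Metric.mem_ball]; linarith [hGb x hx]
  have hd := dcount hfin.toFinset f (fun pq : (Fin n → ℤ) × ℤ => fun j => ((pq.1 j : ℝ) + θ j) / (pq.2 : ℝ)) G L (C₁ * Y / H)
    (by linarith) (fun x hx y hy => (h2 x (hGball x hx) y (hGball y hy)).2)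
    (ENNReal.ofReal (c₄ * (cQ * H * Y ^ d * (cε * ε) ^ m))) (by
      intro x hx
      have hxb := hGball x hx
      refine (hcount x hx (fun i => H * (1 + Real.exp (-1)) / 2 * gof f x i - (Fin.cons 0 θ : Fin (n + 1) → ℝ) i)).trans ?_
      have hinj : Function.Injective (fun w : Fin (n + 1) → ℤ => ((fun j => w j.succ : Fin n → ℤ), w 0)) := by
        intro w w' h
        simp only [Prod.mk.injEq] at h
        funext i
        refine Fin.cases h.2 (fun j => congrFun h.1 j) i
      rw [← hinj.encard_image]
      refine ENat.toENNReal_le.mpr (encard_le_encard ?_)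
      rintro _ ⟨w, ⟨α, β, γ, hα, hβ, hγ, hw⟩, rfl⟩
      obtain ⟨b1, b2, u, hu, hP⟩ := pt_lem f x (h1 x hxb).1 θ C₅ F H (cQ * H) Y (cε * ε) (h1 x hxb).2.1 hC₅ hH0
        (by positivity) hY0.le (by positivity) (by
          have : cε * ε ≤ cε * H := by gcongr; linarith
          nlinarith) w α β γ hα hβ hγ hw
      have hxu : x + u ∈ Metric.ball z r := by
        rw [Metric.mem_ball]
        have := dist_triangle (x + u) x z
        rw [dist_self_add_left] at this
        linarith [hGb x hx]
      have hTay := (h2 x hxb (x + u) hxu).1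
      rw [add_sub_cancel_left] at hTay
      refine ⟨hfin.mem_toFinset.mpr ⟨by rw [hexp]; exact b1, by rw [← hH]; exact b2, ?_⟩, ?_⟩
      · refine (csInf_le (by exact ⟨0, by rintro _ ⟨_, _, rfl⟩; exact norm_nonneg _⟩) (Set.mem_image_of_mem _ hxu)).trans ?_
        · rw [← hH]
          have e : (fun i => f (x + u) i - ((w i.succ : ℝ) + θ i) / (w 0 : ℝ)) =
              (f (x + u) - f x - fderiv ℝ f x u) - ((fun j => ((w j.succ : ℝ) + θ j) / (w 0 : ℝ)) - f x - fderiv ℝ f x u) := by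
            funext i; simp only [Pi.sub_apply]; ring
          show ‖(fun i => f (x + u) i - ((w i.succ : ℝ) + θ i) / (w 0 : ℝ))‖ ≤ _
          rw [e]
          refine (norm_sub_le _ _).trans ((add_le_add hTay hP).trans ?_)
          have s1 : C₂ * ‖u‖ ^ 2 ≤ ε / 2 / H := by
            have : ‖u‖ ^ 2 ≤ (3 * C₅ * Y / H) ^ 2 := by gcongr
            rw [div_pow, mul_pow, hY2] at this
            have e5 : (3 * C₅) ^ 2 * (cY * ε * H) / H ^ 2 = 9 * C₅ ^ 2 * cY * ε / H := by field_simp; ring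
            rw [e5] at this
            refine (mul_le_mul_of_nonneg_left this hC₂).trans ?_
            rw [← mul_div_assoc]
            gcongr ?_ / H
            have p : 0 ≤ C₅ ^ 2 * cY := by positivity
            nlinarith
          have s2 : 3 * (cε * ε) * C₅ * (1 + F) / H ≤ ε / 2 / H := by
            gcongr ?_ / H; nlinarith
          calc _ ≤ ε / 2 / H + ε / 2 / H := add_le_add s1 s2
            _ = ε / H := by ring
      · have e : f x - (fun j => ((w j.succ : ℝ) + θ j) / (w 0 : ℝ)) =
              -((fun j => ((w j.succ : ℝ) + θ j) / (w 0 : ℝ)) - f x - fderiv ℝ f x u) - fderiv ℝ f x u := by abel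
        show ‖f x - (fun j => ((w j.succ : ℝ) + θ j) / (w 0 : ℝ))‖ ≤ _
        rw [e]
        refine (norm_sub_le _ _).trans ?_
        rw [norm_neg]
        have s1 : ‖fderiv ℝ f x u‖ ≤ F * (3 * C₅ * Y / H) :=
          ((fderiv ℝ f x).le_opNorm u).trans (mul_le_mul (h1 x hxb).2.2 hu (norm_nonneg _) (by linarith))
        refine (add_le_add hP s1).trans ?_
        rw [← mul_div_assoc, ← add_div]
        gcongr ?_ / H
        rw [hC₁]
        have s3 : 3 * C₅ * (1 + F) * cε / √cY * Y ≥ 3 * C₅ * (1 + F) * cε * ε := by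
          rw [ge_iff_le, div_mul_eq_mul_div, le_div_iff₀ hsY]
          have := mul_le_mul_of_nonneg_left hYε (show 0 ≤ 3 * C₅ * (1 + F) * cε by positivity)
          linarith
        rw [add_mul]
        linarith)
  have hL0 : 0 < L := by linarith
  have hcard : ((hfin.toFinset.card : ℕ) : ℝ) = (Nstar f θ (Metric.ball z r) ε t : ℝ) := by
    rw [Nstar, Set.ncard_eq_toFinset_card _ hfin]
  have hd2 := (mul_le_mul_right hGv (ENNReal.ofReal (c₄ * (cQ * H * Y ^ d * (cε * ε) ^ m)))).trans hd
  rw [Real.volume_pi_closedBall _ (by positivity), Real.volume_pi_closedBall _ (by positivity), Fintype.card_fin] at hd2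
  have hd3 := ENNReal.toReal_mono (ENNReal.mul_ne_top (ENNReal.natCast_ne_top _) ENNReal.ofReal_ne_top) hd2
  rw [ENNReal.toReal_mul, ENNReal.toReal_mul, ENNReal.toReal_mul, ENNReal.toReal_ofReal (by positivity),
    ENNReal.toReal_ofReal (by positivity), ENNReal.toReal_ofReal (by positivity), ENNReal.toReal_natCast, hcard] at hd3
  rw [← hC₁, ← hH]
  generalize (Nstar f θ (Metric.ball z r) ε t : ℝ) = N at *
  simp only [ENNReal.toReal_inv, ENNReal.toReal_ofNat] at hd3
  rw [show 2 * (r / 2) = r by ring, show 2 * (2 * L * (C₁ * Y / H)) = (4 * L * C₁) * (Y / H) by ring, mul_pow (4 * L * C₁), div_pow Y] at hd3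
  have e8 : (8 * L * C₁) ^ d = 2 ^ d * (4 * L * C₁) ^ d := by rw [← mul_pow]; ring
  rw [e8]
  have hB : 0 < (4 * L * C₁) ^ d := by positivity
  have hYd : 0 < Y ^ d := by positivity
  have hHd : 0 < H ^ d := by positivity
  generalize (4 * L * C₁) ^ d = B at *
  have key : c₄ * cQ * cε ^ m / (2 * (2 ^ d * B)) * ε ^ m * H ^ (d + 1) * (2 * r) ^ d =
      (c₄ * (cQ * H * Y ^ d * (cε * ε) ^ m) * (2⁻¹ * r ^ d)) / (B * (Y ^ d / H ^ d)) := by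
    rw [mul_pow cε, mul_pow 2 r, pow_succ]; field_simp
  rw [key, div_le_iff₀ (by positivity)]
  exact hd3

lemma small_lem (C₅ cY ε r H : ℝ) (h5 : 0 < C₅) (hcY : 0 < cY) (hε : 0 < ε) (hε' : ε < 1) (hr : 0 < r) (hH0 : 0 < H)
    (htr : 36 * C₅ ^ 2 * cY / r ^ 2 < H) : 3 * C₅ * √(cY * ε * H) / H < r / 2 := by
  rw [div_lt_iff₀ hH0]
  have : √(cY * ε * H) < r * H / (6 * C₅) := by
    rw [Real.sqrt_lt' (by positivity), div_pow, lt_div_iff₀ (by positivity)]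
    rw [div_lt_iff₀ (by positivity)] at htr
    have h0 : 0 ≤ cY * H * (6 * C₅) ^ 2 := by positivity
    have e4 : cY * ε * H * (6 * C₅) ^ 2 ≤ 36 * C₅ ^ 2 * cY * H := by nlinarith
    have := mul_lt_mul_of_pos_right htr hH0
    rw [mul_pow]
    linarith
  rw [lt_div_iff₀ (by positivity)] at this
  linarith

lemma half_lem {d : ℕ} (S : Set (Fin d → ℝ)) (p : (Fin d → ℝ) → Prop) (hv : volume S ≠ ⊤)
    (h : volume {x ∈ S | ¬ p x} ≤ 2⁻¹ * volume S) : 2⁻¹ * volume S ≤ volume {x ∈ S | p x} := by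
  have h2t : 2⁻¹ * volume S ≠ ⊤ := ENNReal.mul_ne_top (by simp) hv
  have hle : volume S ≤ volume {x ∈ S | p x} + 2⁻¹ * volume S := by
    refine le_trans ?_ (add_le_add le_rfl h)
    refine (measure_mono ?_).trans (measure_union_le _ _)
    intro x hx
    by_cases h : p x
    · exact Or.inl ⟨hx, h⟩
    · exact Or.inr ⟨hx, h⟩
  refine (ENNReal.add_le_add_iff_right h2t).mp (le_trans (le_of_eq ?_) hle)
  rw [← add_mul, ENNReal.inv_two_add_inv_two, one_mul]

/-- **Lower bound for rational points near nondegenerate manifolds** (Theorem 1.4). -/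
theorem lower_bound_rational_points
    {d n m : ℕ} (hn : 2 ≤ n) (hd : 1 ≤ d) (hdn : d < n) (hm : d + m = n)
    (θ : Fin n → ℝ) (U : Set (Fin d → ℝ)) (hU : IsOpen U)
    (f : (Fin d → ℝ) → Fin n → ℝ) (x₀ : Fin d → ℝ) (hx₀ : x₀ ∈ U)
    (hns : IsNonsingularOn f U) (hnd : IsNondegenerateAt f x₀) :
    ∃ B₀ : Set (Fin d → ℝ), IsOpen B₀ ∧ x₀ ∈ B₀ ∧ B₀ ⊆ U ∧
    ∃ c : ℝ, 0 < c ∧ ∃ C : ℝ, 0 < C ∧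
      ∀ z : Fin d → ℝ, ∀ r : ℝ, 0 < r → Metric.ball z r ⊆ B₀ →
        ∃ t₀ : ℝ, ∀ t : ℝ, t₀ ≤ t → ∀ ε : ℝ, 0 < ε → ε < 1 →
          C * Real.exp (-t * etaND n d) ≤ ε →
          c * ε ^ m * Real.exp (((d : ℝ) + 1) * t) * (volume (Metric.ball z r)).toReal ≤
            (Nstar f θ (Metric.ball z r) ε t : ℝ) := by
  obtain ⟨k, rfl⟩ : ∃ k, n = k + 1 := ⟨n - 1, by omega⟩
  have hk : 1 ≤ k := by omega
  obtain ⟨l, hf, hND⟩ := nd_setup hdn f x₀ hnd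
  have hf2 : ContDiffAt ℝ 2 f x₀ := hf.of_le (by norm_cast; omega)
  have hinj := inj_of_rank _ (hns x₀ hx₀)
  obtain ⟨s₀, j₀, hs⟩ : ∃ (s₀ : Fin d) (j₀ : Fin (k + 1)), fderiv ℝ f x₀ (Pi.single s₀ 1) j₀ ≠ 0 := by
    by_contra hcon
    push Not at hcon
    have h0 : fderiv ℝ f x₀ (Pi.single ⟨0, hd⟩ 1) = fderiv ℝ f x₀ 0 := by
      rw [map_zero]; funext j; exact hcon _ j
    have := congrFun (hinj h0) ⟨0, hd⟩
    simp at this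
  obtain ⟨R, hR, ε₁, hε₁, c₃, hc₃, hgp⟩ := good_points hd f x₀ hf hND s₀ j₀ hs
  obtain ⟨C₅, c₄, hC₅, hc₄, hev⟩ := count_good hm f x₀ hf2 hinj
  obtain ⟨ρ, F, C₂, L, hρ, hF, hC₂, hL, hl1, hl2⟩ := loc_an f x₀ hf2 hinj
  obtain ⟨ρ₂, hρ₂, hev⟩ := Metric.eventually_nhds_iff_ball.mp hev
  obtain ⟨ρ₃, hρ₃, hU3⟩ := Metric.isOpen_iff.mp hU x₀ hx₀
  obtain ⟨R₀, hR₀, a1, a2, a3, a4⟩ : ∃ R₀ : ℝ, 0 < R₀ ∧ R₀ ≤ ρ ∧ R₀ ≤ ρ₂ ∧ R₀ ≤ ρ₃ ∧ R₀ * (1 + 2 * 5 ^ (k + 3)) ≤ R := by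
    refine ⟨min (min ρ ρ₂) (min ρ₃ (R / (1 + 2 * 5 ^ (k + 3)))), by positivity, (min_le_left _ _).trans (min_le_left _ _),
      (min_le_left _ _).trans (min_le_right _ _), (min_le_right _ _).trans (min_le_left _ _), ?_⟩
    rw [← le_div_iff₀ (by positivity)]
    exact (min_le_right _ _).trans (min_le_right _ _)
  obtain ⟨cQ, hcQ, eQ⟩ : ∃ cQ : ℝ, 0 < cQ ∧ C₅ * cQ = 3 / 20 := ⟨3 / 20 / C₅, by positivity, by field_simp⟩
  obtain ⟨cY, hcY, eY⟩ : ∃ cY : ℝ, 0 < cY ∧ 18 * C₅ ^ 2 * (C₂ + 1) * cY = 1 :=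
    ⟨(18 * C₅ ^ 2 * (C₂ + 1))⁻¹, by positivity, mul_inv_cancel₀ (by positivity)⟩
  obtain ⟨cε, hcε, e1, e2, e3⟩ : ∃ cε : ℝ, 0 < cε ∧ C₅ * cε ≤ 3 / 20 ∧ 6 * C₅ * (1 + F) * cε ≤ 1 ∧ ε₁ * cε ≤ 1 := by
    refine ⟨min (3 / 20 / C₅) (min (1 / (6 * C₅ * (1 + F))) (1 / ε₁)), by positivity, ?_, ?_, ?_⟩
    · rw [← le_div_iff₀' (by positivity)]; exact min_le_left _ _
    · rw [← le_div_iff₀' (by positivity)]; exact (min_le_right _ _).trans (min_le_left _ _)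
    · rw [← le_div_iff₀' (by positivity)]; exact (min_le_right _ _).trans (min_le_right _ _)
  obtain ⟨C, hC, hpar⟩ := params (d := d) hk ε₁ c₃ cQ cY cε hε₁ hc₃ hcQ hcY hcε
  have hsY : 0 < √cY := by positivity
  refine ⟨Metric.ball x₀ R₀, Metric.isOpen_ball, Metric.mem_ball_self hR₀, (Metric.ball_subset_ball a3).trans hU3,
    c₄ * cQ * cε ^ m / (2 * (8 * L * (3 * C₅ * F + 3 * C₅ * (1 + F) * cε / √cY)) ^ d), by positivity, C, by linarith, ?_⟩
  intro z r hr hB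
  have hz : dist z x₀ < R₀ := hB (Metric.mem_ball_self hr)
  have hr2 : r / 2 < 2 * R₀ := by
    have hy : (z + fun _ => r / 2) ∈ Metric.ball z r := by
      rw [Metric.mem_ball, dist_self_add_left]
      refine lt_of_le_of_lt (pi_norm_const_le (r / 2)) ?_
      rw [Real.norm_eq_abs, abs_of_pos (by positivity)]; linarith
    have h1 : dist (z + fun _ => r / 2) x₀ < R₀ := hB hy
    have h2 := dist_triangle_right (z + fun _ => r / 2) z x₀
    rw [dist_self_add_left] at h2
    have h3 := norm_le_pi_norm (fun _ : Fin d => r / 2) ⟨0, hd⟩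
    rw [Real.norm_eq_abs, abs_of_pos (by positivity)] at h3
    linarith
  obtain ⟨κ, hκ, hgood⟩ := hgp z (r / 2) (by positivity) (by
    have := mul_lt_mul_of_pos_left hr2 (show (0:ℝ) < 5 ^ (k + 3) by positivity)
    nlinarith)
  obtain ⟨M, hM⟩ := hpar κ hκ
  refine ⟨max 0 (max M (36 * C₅ ^ 2 * cY / r ^ 2)), fun t ht ε hε hε' hCε => ?_⟩
  have ht0 : 0 ≤ t := (le_max_left _ _).trans ht
  have htM : M ≤ t := ((le_max_left _ _).trans (le_max_right _ _)).trans ht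
  have htr : 36 * C₅ ^ 2 * cY / r ^ 2 < Real.exp t :=
    (((le_max_right _ _).trans (le_max_right _ _)).trans ht).trans_lt (by linarith [Real.add_one_le_exp t])
  obtain ⟨p1, p2, p3⟩ := hM t htM ht0 ε hε hε' hCε _ _ _ rfl rfl rfl
  have hT1 : 1 ≤ (ε₁ * (cε * ε))⁻¹ := by
    refine (one_le_inv₀ (by positivity)).mpr ?_
    nlinarith [mul_pos hε₁ hcε]
  have hbad := hgood _ _ _ (by positivity) (by positivity) hT1 p1 p2 p3
  have hexp : Real.exp (((d : ℝ) + 1) * t) = Real.exp t ^ (d + 1) := by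
    rw [← Real.exp_nat_mul]; push_cast; rfl
  rw [Real.volume_pi_ball _ hr, Fintype.card_fin, ENNReal.toReal_ofReal (by positivity), hexp]
  have hball : Metric.ball z r ⊆ Metric.ball x₀ ρ := hB.trans (Metric.ball_subset_ball a1)
  have hcb : Metric.closedBall z (r / 2) ⊆ Metric.ball z r := Metric.closedBall_subset_ball (by linarith)
  refine core f θ z r F C₂ L C₅ c₄ ε₁ cQ cY cε t ε _ _ _ hr hF hC₂ hL hC₅ hc₄ hε₁ hcQ hcY hcε ht0 hε hε' rfl rfl rfl
    (fun x hx => hl1 x (hball hx)) (fun x hx y hy => hl2 x (hball hx) y (hball hy)) (by linarith) eY.le e2 ?_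
    {x ∈ Metric.closedBall z (r / 2) | ∀ u : Fin (k + 2) → ℤ, u ≠ 0 → ∃ s j, ε₁ ≤ |ir u ⬝ᵥ row (gof f) (ε₁ * (cQ * Real.exp t))⁻¹
      (ε₁ * √(cY * ε * Real.exp t))⁻¹ (ε₁ * (cε * ε))⁻¹ s x j|} (fun x hx => hx.1) ?_ ?_
  · exact small_lem C₅ cY ε r _ (by linarith) hcY hε hε' hr (Real.exp_pos t) htr
  · exact half_lem _ _ measure_closedBall_lt_top.ne hbad
  · intro x hx z'
    exact hev x (Metric.ball_subset_ball a2 (hB (hcb hx.1))) _ _ _ ε₁ (by positivity) (by positivity) (by positivity) hε₁ hx.2 z'
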